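/- Let E be a field of characteristic different from 2 such that every square-free polynomial in E[X] divides a square-reflexive polynomial in E[X]. Then: (1) every regular quadratic form of dimension 5 over E(X) is isotropic; and (2) for every finite family of pairs (a₁,b₁),…,(aₙ,bₙ) of elements of E(X)^×, there exist c, d₁,…,dₙ ∈ E(X)^× such that the 2-fold Pfister form ⟨1,−aᵢ,−bᵢ,aᵢbᵢ⟩ is isometric to ⟨1,−c,−dᵢ,cdᵢ⟩ for each i. -/

import Mathlib

open Polynomial

/-- `f` is square-reflexive over `E`. -/
def IsSquareReflexive {E : Type*} [Field E] (f : Polynomial E) : Prop :=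
  Squarefree f ∧
  ∀ α : (Polynomial E ⧸ Ideal.span {f})ˣ,
    (∃ u : Eˣ, Algebra.norm E (α : Polynomial E ⧸ Ideal.span {f}) = (u : E) ^ 2 ∨
               Algebra.norm E (α : Polynomial E ⧸ Ideal.span {f}) = f.leadingCoeff * (u : E) ^ 2) →
    ∃ g : Polynomial E, IsCoprime f g ∧
      (∃ β : (Polynomial E ⧸ Ideal.span {f})ˣ,
        Ideal.Quotient.mk (Ideal.span {f}) g
          = (α : Polynomial E ⧸ Ideal.span {f}) * (β : Polynomial E ⧸ Ideal.span {f}) ^ 2) ∧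
      IsSquare (Ideal.Quotient.mk (Ideal.span {g}) f)

/-- Isotropy of the diagonal quadratic form `⟨a 0, …, a (n-1)⟩`. -/
def IsotropicDiag {R : Type*} [CommRing R] {n : ℕ} (a : Fin n → R) : Prop :=
  ∃ x : Fin n → R, x ≠ 0 ∧ ∑ i, a i * x i ^ 2 = 0

/-- The 2-fold Pfister form `⟨1, -a, -b, ab⟩` over a field `F`. -/
noncomputable def Pfister2 (F : Type*) [Field F] (a b : F) : QuadraticForm F (Fin 4 → F) :=
  QuadraticMap.weightedSumSquares F ![1, -a, -b, a * b]

def HermP (F : Type*) [Field F] (ι : Type) [Fintype ι] : Prop :=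
  ∀ (_ : DecidableEq ι) (M : Matrix ι ι F[X]), M.transpose = M → M.det ≠ 0 → Nonempty ι →
    ∃ U : Matrix ι ι F[X], IsUnit U.det ∧ ∃ i, (U.transpose * M * U) i i = 0 ∨
      Fintype.card ι * ((U.transpose * M * U) i i).natDegree ≤ M.det.natDegree

set_option maxHeartbeats 1000000 in
theorem hermP_step (F : Type*) [Field F] (ι : Type) [Fintype ι] (ih : HermP F ι) :
    HermP F (ι ⊕ Unit) := by
  intro hd M hM hdet _
  let hdι : DecidableEq ι := Classical.decEq ι
  obtain rfl : hd = @instDecidableEqSum ι Unit hdι _ := Subsingleton.elim _ _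
  by_contra hcon
  push Not at hcon
  -- all values nonzero
  let S : Set ℕ := {d | ∃ U : Matrix (ι ⊕ Unit) (ι ⊕ Unit) F[X], IsUnit U.det ∧
    ((U.transpose * M * U) (Sum.inr ()) (Sum.inr ())).natDegree = d}
  have hS : S.Nonempty := ⟨_, 1, by simp, rfl⟩
  obtain ⟨U, hU, hUd⟩ := Nat.sInf_mem hS
  have hmin : ∀ V : Matrix (ι ⊕ Unit) (ι ⊕ Unit) F[X], IsUnit V.det → ∀ i,
      sInf S ≤ ((V.transpose * M * V) i i).natDegree := by
    intro V hV i
    apply Nat.sInf_le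
    refine ⟨V.submatrix id (Equiv.swap i (Sum.inr ())), ?_, ?_⟩
    · rw [Matrix.det_permute']
      refine IsUnit.mul ?_ hV
      rcases Int.units_eq_one_or (Equiv.Perm.sign (Equiv.swap i (Sum.inr ()))) with h | h <;>
        simp [h]
    · congr 1
      have : (V.submatrix id (Equiv.swap i (Sum.inr ()))).transpose * M *
          (V.submatrix id (Equiv.swap i (Sum.inr ()))) =
          (V.transpose * M * V).submatrix (Equiv.swap i (Sum.inr ()))
            (Equiv.swap i (Sum.inr ())) := by
        ext1 a b
        simp [Matrix.mul_apply, Matrix.submatrix]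
      rw [this]; simp
  set d := sInf S with hdef
  obtain ⟨M1, hM1⟩ : ∃ M1, M1 = U.transpose * M * U := ⟨_, rfl⟩
  have hM1s : M1.transpose = M1 := by
    rw [hM1, Matrix.transpose_mul, Matrix.transpose_mul, hM, Matrix.transpose_transpose,
      Matrix.mul_assoc]
  have hM1det : M1.det = U.det ^ 2 * M.det := by
    simp [hM1, Matrix.det_mul]; ring
  have hM1deg : M1.det.natDegree = M.det.natDegree := by
    rw [hM1det, Polynomial.natDegree_mul (pow_ne_zero _ hU.ne_zero) hdet]
    simp [Polynomial.natDegree_eq_zero_of_isUnit (hU.pow 2)]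
  have hM1ne : M1.det ≠ 0 := by
    rw [hM1det]; exact mul_ne_zero (pow_ne_zero _ hU.ne_zero) hdet
  have hmin1 : ∀ V : Matrix (ι ⊕ Unit) (ι ⊕ Unit) F[X], IsUnit V.det → ∀ i,
      (V.transpose * M1 * V) i i ≠ 0 ∧ d ≤ ((V.transpose * M1 * V) i i).natDegree := by
    intro V hV i
    have e : V.transpose * M1 * V = (U * V).transpose * M * (U * V) := by
      rw [hM1, Matrix.transpose_mul]; simp only [Matrix.mul_assoc]
    have hUV : IsUnit (U * V).det := by rw [Matrix.det_mul]; exact hU.mul hV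
    rw [e]
    exact ⟨(hcon _ hUV i).1, hmin _ hUV i⟩
  have hMd := (hcon U hU (Sum.inr ()))
  rw [← hM1] at hMd hUd
  set m := M1 (Sum.inr ()) (Sum.inr ()) with hm
  have hm0 : m ≠ 0 := hMd.1
  have hlt := hMd.2
  rw [hUd] at hlt
  -- blocks
  set N := M1.toBlocks₁₁ with hN
  set r : ι → F[X] := fun j => M1 (Sum.inr ()) (Sum.inl j) with hr
  have hrs : ∀ j, M1 (Sum.inl j) (Sum.inr ()) = r j := fun j => by
    have := congrFun (congrFun hM1s (Sum.inr ())) (Sum.inl j)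
    simpa [Matrix.transpose_apply] using this
  have hMb : M1 = Matrix.fromBlocks N (Matrix.of fun j _ => r j) (Matrix.of fun _ j => r j) (Matrix.of fun _ _ => m) := by
    ext1 a b
    rcases a with a | a <;> rcases b with b | b
    · rfl
    · exact hrs a
    · rfl
    · rfl
  let M2 : Matrix ι ι F[X] := Matrix.of fun i j => m * N i j - r i * r j
  have hprod : Matrix.fromBlocks (Matrix.scalar ι m) (Matrix.of fun j (_ : Unit) => - r j) 0 (1 : Matrix Unit Unit F[X]) * M1 =
      Matrix.fromBlocks M2 0 (Matrix.of fun _ j => r j) (Matrix.of fun _ _ => m) := by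
    rw [hMb, Matrix.fromBlocks_multiply]
    congr 1
    · ext1 i j; simp [Matrix.mul_apply, M2, Matrix.diagonal_apply]; ring
    · ext1 i j; simp [Matrix.mul_apply, Matrix.diagonal_apply]; ring
    · ext1 i j; simp
    · ext1 i j; simp
  have hdet2 : m ^ Fintype.card ι * M1.det = M2.det * m := by
    have := congrArg Matrix.det hprod
    rw [Matrix.det_mul, Matrix.det_fromBlocks_zero₂₁, Matrix.det_fromBlocks_zero₁₂] at this
    simpa [Matrix.det_unique] using this
  have hM2ne : M2.det ≠ 0 := by
    intro h
    rw [h, zero_mul] at hdet2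
    exact mul_ne_zero (pow_ne_zero _ hm0) hM1ne hdet2
  have hdeg2 : Fintype.card ι * d + M.det.natDegree = M2.det.natDegree + d := by
    have := congrArg natDegree hdet2
    rw [natDegree_mul (pow_ne_zero _ hm0) hM1ne, natDegree_mul hM2ne hm0, natDegree_pow, hM1deg]
      at this
    rw [hUd] at this
    exact this
  simp only [Fintype.card_sum, Fintype.card_unit] at hlt
  rcases isEmpty_or_nonempty ι with hι | hι
  · have : M2.det = 1 := by simp
    rw [this] at hdeg2
    simp at hdeg2 hlt
    omega
  have hNs : ∀ i j, N i j = N j i := fun i j => by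
    have := congrFun (congrFun hM1s (Sum.inl j)) (Sum.inl i)
    simpa [hN, Matrix.toBlocks₁₁] using this
  have hM2s : M2.transpose = M2 := by
    ext1 i j
    simp only [Matrix.transpose_apply, M2, Matrix.of_apply]
    rw [hNs j i]; ring
  obtain ⟨U', hU', i', hi'⟩ := ih inferInstance M2 hM2s hM2ne hι
  set ρ : F[X] := ∑ j, r j * U' j i' with hρ
  set x : F[X] := - (ρ / m) with hx
  let V : Matrix (ι ⊕ Unit) (ι ⊕ Unit) F[X] := Matrix.fromBlocks U' 0 (Matrix.of fun _ _ => x) 1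
  have hV : IsUnit V.det := by
    simp only [V]
    rw [Matrix.det_fromBlocks_zero₁₂]; simpa using hU'
  obtain ⟨hn0, hnd⟩ := hmin1 V hV (Sum.inl i')
  set n11 := (V.transpose * M1 * V) (Sum.inl i') (Sum.inl i') with hn11
  set Nq : F[X] := (U'.transpose * N * U') i' i' with hNq
  have e1 : n11 = Nq + 2 * x * ρ + x ^ 2 * m := by
    rw [hn11, hMb]
    simp only [V]
    rw [Matrix.fromBlocks_transpose, Matrix.fromBlocks_multiply, Matrix.fromBlocks_multiply]
    simp only [Matrix.fromBlocks_apply₁₁, Matrix.add_apply, Matrix.add_mul]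
    have a1 : ((Matrix.of fun (_ : Unit) (_ : ι) => x : Matrix Unit ι F[X]).transpose * (Matrix.of fun (_ : Unit) j => r j : Matrix Unit ι F[X]) * U') i' i' = x * ρ := by
      simp [Matrix.mul_apply, hρ, Finset.mul_sum, mul_assoc]
    have a2 : (U'.transpose * (Matrix.of fun j (_ : Unit) => r j : Matrix ι Unit F[X]) * (Matrix.of fun (_ : Unit) (_ : ι) => x : Matrix Unit ι F[X])) i' i' = x * ρ := by
      simp [Matrix.mul_apply, hρ, Finset.mul_sum, mul_comm]
    have a3 : ((Matrix.of fun (_ : Unit) (_ : ι) => x : Matrix Unit ι F[X]).transpose * (Matrix.of fun (_ _ : Unit) => m : Matrix Unit Unit F[X]) * (Matrix.of fun (_ : Unit) (_ : ι) => x : Matrix Unit ι F[X])) i' i' = x ^ 2 * m := by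
      simp [Matrix.mul_apply]; ring
    rw [a1, a2, a3]; ring
  have e2 : (U'.transpose * M2 * U') i' i' = m * Nq - ρ ^ 2 := by
    have : M2 = m • N - Matrix.of (fun i j => r i * r j) := by
      ext1 i j; simp [M2]
    have hA : (U'.transpose * (m • N) * U') i' i' = m * Nq := by
      rw [Matrix.mul_smul, Matrix.smul_mul, Matrix.smul_apply, smul_eq_mul]
    have hB : (U'.transpose * Matrix.of (fun i j => r i * r j) * U') i' i' = ρ ^ 2 := by
      rw [hρ, sq, Finset.sum_mul_sum, Matrix.mul_apply, Finset.sum_comm]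
      refine Finset.sum_congr rfl fun a _ => ?_
      rw [Matrix.mul_apply, Finset.sum_mul]
      refine Finset.sum_congr rfl fun b _ => ?_
      rw [Matrix.transpose_apply, Matrix.of_apply]
      ring
    rw [this, Matrix.mul_sub, Matrix.sub_mul, Matrix.sub_apply, hA, hB]
  set r1 : F[X] := ρ + x * m with hr1
  have hr1d : r1.degree < m.degree := by
    have : r1 = ρ % m := by
      rw [hr1, hx, EuclideanDomain.mod_eq_sub_mul_div]; ring
    rw [this]
    exact EuclideanDomain.mod_lt ρ hm0
  have e3 : (U'.transpose * M2 * U') i' i' = m * n11 - r1 ^ 2 := by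
    rw [e2, e1, hr1]; ring
  have hmn : (r1 ^ 2).degree < (m * n11).degree := by
    rw [degree_mul, degree_pow, two_nsmul]
    have h1 : m.degree ≤ n11.degree := by
      rw [degree_eq_natDegree hm0, degree_eq_natDegree hn0]
      rw [hUd]
      exact_mod_cast hnd
    calc r1.degree + r1.degree < m.degree + m.degree := by
          have hmb : m.degree ≠ ⊥ := by simpa using hm0
          have hrle := hr1d.le
          by_cases hrb : r1 = 0
          · simp [hrb]
            rw [degree_eq_natDegree hm0]; exact bot_lt_iff_ne_bot.2 (by exact_mod_cast WithBot.coe_ne_bot)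
          · rw [degree_eq_natDegree hm0, degree_eq_natDegree hrb] at *
            have : r1.natDegree < m.natDegree := by exact_mod_cast hr1d
            exact_mod_cast (by omega : r1.natDegree + r1.natDegree < m.natDegree + m.natDegree)
      _ ≤ _ := by gcongr
  have e4 : ((U'.transpose * M2 * U') i' i').degree = (m * n11).degree := by
    rw [e3]; exact degree_sub_eq_left_of_degree_lt hmn
  have e5 : ((U'.transpose * M2 * U') i' i').natDegree = d + n11.natDegree := by
    rw [natDegree_eq_of_degree_eq e4, natDegree_mul hm0 hn0, hUd]
  have e6 : (U'.transpose * M2 * U') i' i' ≠ 0 := by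
    intro h; rw [h] at e4
    have := e4.symm
    simp [hm0, hn0] at this
  rcases hi' with h | h
  · exact e6 h
  · rw [e5] at h
    have : Fintype.card ι * (d + d) ≤ M2.det.natDegree :=
      le_trans (Nat.mul_le_mul_left _ (by omega)) h
    nlinarith

theorem hermP_all (F : Type*) [Field F] (n : ℕ) : HermP F (Fin n) := by
  suffices h : ∀ (ι : Type) [Fintype ι], HermP F ι from h _
  refine fun ι _ => Fintype.induction_empty_option (P := fun ι _ => HermP F ι) ?_ ?_ ?_ ι
  · intro α β _ e h
    let := Fintype.ofEquiv β e.symm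
    intro hd M hM hdet hne
    have : DecidableEq α := e.decidableEq
    obtain ⟨U, hU, i, hi⟩ := h inferInstance (M.submatrix e e) (by rw [Matrix.transpose_submatrix, hM])
      (by simpa using hdet) (e.nonempty)
    refine ⟨U.submatrix e.symm e.symm, by simpa using hU, e i, ?_⟩
    have : ((U.submatrix e.symm e.symm).transpose * M * U.submatrix e.symm e.symm) =
      (U.transpose * (M.submatrix e e) * U).submatrix e.symm e.symm := by
      rw [← Matrix.submatrix_mul_equiv _ _ _ e.symm, ← Matrix.submatrix_mul_equiv _ _ _ e.symm]
      simp
    rw [this]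
    have hc : Fintype.card α = Fintype.card β := Fintype.card_congr e
    simpa [← hc] using hi
  · intro _ _ _ _ h
    exact absurd h (by simp)
  · intro α _ h
    have h2 := hermP_step F α h
    intro hd M hM hdet hne
    let e := Equiv.optionEquivSumPUnit.{0} α
    classical
    obtain ⟨U, hU, i, hi⟩ := h2 (@instDecidableEqSum _ _ (Classical.decEq _) _) (M.submatrix e.symm e.symm) (by rw [Matrix.transpose_submatrix, hM])
      (by simpa using hdet) (⟨Sum.inr ()⟩)
    refine ⟨U.submatrix e e, by simpa using hU, e.symm i, ?_⟩
    have : ((U.submatrix e e).transpose * M * U.submatrix e e) =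
      (U.transpose * (M.submatrix e.symm e.symm) * U).submatrix e e := by
      rw [← Matrix.submatrix_mul_equiv _ _ _ e, ← Matrix.submatrix_mul_equiv _ _ _ e]
      simp
    rw [this]
    simpa using hi

theorem exists_const_vec (F : Type*) [Field F] (h2 : (2:F) ≠ 0) (n : ℕ)
    (M : Type*) [AddCommGroup M] [Module F[X] M] [Module.Free F[X] M] [Module.Finite F[X] M]
    (B : M →ₗ[F[X]] M →ₗ[F[X]] F[X]) (hs : ∀ x y, B x y = B y x)
    (hp : ∀ φ : M →ₗ[F[X]] F[X], ∃ x, B x = φ) (hn : Module.finrank F[X] M = n + 1) :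
    ∃ v, ∃ c : F, c ≠ 0 ∧ B v v = C c := by
  classical
  let b := Module.finBasisOfFinrankEq F[X] M hn
  let G : Matrix (Fin (n+1)) (Fin (n+1)) F[X] := Matrix.of fun i j => B (b i) (b j)
  choose x hx using fun j => hp (b.coord j)
  have hG : IsUnit G.det := by
    apply Matrix.isUnit_det_of_left_inverse (B := Matrix.of fun j k => b.repr (x j) k)
    ext1 j i
    rw [Matrix.mul_apply]
    have h := congrArg (fun φ => φ (b i)) (hx j)
    simp only [Module.Basis.coord_apply, Module.Basis.repr_self] at h
    conv at h => lhs; rw [← b.sum_repr (x j)]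
    simp only [map_sum, map_smul, LinearMap.sum_apply, LinearMap.smul_apply, smul_eq_mul] at h
    simp only [Matrix.of_apply, G]
    rw [h, Matrix.one_apply, Finsupp.single_apply]
    simp [eq_comm]
  have hGs : G.transpose = G := by
    ext1 i j; simp only [Matrix.transpose_apply, G, Matrix.of_apply]; exact hs _ _
  obtain ⟨U, hU, i, hi⟩ := hermP_all F (n+1) inferInstance G hGs hG.ne_zero inferInstance
  let v := ∑ j, U j i • b j
  have hv : B v v = (U.transpose * G * U) i i := by
    simp only [v, map_sum, map_smul, LinearMap.sum_apply, LinearMap.smul_apply, smul_eq_mul]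
    rw [Matrix.mul_apply]
    refine Finset.sum_congr rfl fun a _ => ?_
    rw [Matrix.mul_apply, mul_comm]
    congr 1
  by_cases h0 : (U.transpose * G * U) i i = 0
  · let φ : M →ₗ[F[X]] F[X] := ∑ j, (U⁻¹) i j • b.coord j
    obtain ⟨w, hw⟩ := hp φ
    have hwv : B w v = 1 := by
      rw [hw]
      simp only [φ, v, map_sum, LinearMap.sum_apply, LinearMap.smul_apply, map_smul, smul_eq_mul,
        Module.Basis.coord_apply, Module.Basis.repr_self]
      have : (U⁻¹ * U) i i = 1 := by rw [Matrix.nonsing_inv_mul _ hU]; simp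
      rw [Matrix.mul_apply] at this
      refine Eq.trans ?_ this
      simp only [Finsupp.single_apply, mul_ite, mul_one, mul_zero, Finset.sum_ite_eq,
        Finset.mem_univ, if_true]
      first | rfl | exact Finset.sum_congr rfl fun a _ => mul_comm _ _ | skip
    refine ⟨w + (C (2⁻¹ : F) * (1 - B w w)) • v, 1, one_ne_zero, ?_⟩
    have hvw : B v w = 1 := by rw [hs]; exact hwv
    simp only [map_add, map_smul, LinearMap.add_apply, LinearMap.smul_apply, smul_eq_mul, hwv, hvw,
      hv, h0]
    have : C (2⁻¹ : F) * 2 = 1 := by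
      rw [show (2 : F[X]) = C 2 from rfl, ← C_mul, inv_mul_cancel₀ h2, C_1]
    rw [C_1]
    linear_combination (1 - B w w) * this
  · rcases hi with hi | hi
    · exact absurd hi h0
    · rw [natDegree_eq_zero_of_isUnit hG, Fintype.card_fin] at hi
      have hd : ((U.transpose * G * U) i i).natDegree = 0 := by
        rcases Nat.eq_zero_or_pos ((U.transpose * G * U) i i).natDegree with h | h
        · exact h
        · nlinarith
      rw [eq_C_of_natDegree_eq_zero hd] at h0 hv
      exact ⟨v, _, fun h => h0 (by rw [h, C_0]), hv⟩

theorem harder (F : Type*) [Field F] (h2 : (2:F) ≠ 0) (n : ℕ) :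
    ∀ (M : Type*) [AddCommGroup M] [Module F[X] M] [Module.Free F[X] M] [Module.Finite F[X] M]
    (B : M →ₗ[F[X]] M →ₗ[F[X]] F[X]) (_ : ∀ x y, B x y = B y x)
    (_ : ∀ φ : M →ₗ[F[X]] F[X], ∃ x, B x = φ) (_ : Module.finrank F[X] M = n),
    ∃ (e : Fin n → M) (c : Fin n → F), (∀ i, c i ≠ 0) ∧
      (∀ i j, B (e i) (e j) = if i = j then C (c i) else 0) ∧
      ∀ x, x = ∑ i, (C (c i)⁻¹ * B x (e i)) • e i := by
  induction n with
  | zero =>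
    intro M _ _ _ _ B hs hp hn
    have : Subsingleton M := Module.finrank_zero_iff.1 hn
    exact ⟨Fin.elim0, Fin.elim0, fun i => i.elim0, fun i => i.elim0, fun x => Subsingleton.elim _ _⟩
  | succ n ih =>
    intro M _ _ _ _ B hs hp hn
    obtain ⟨v, c, hc, hv⟩ := exists_const_vec F h2 n M B hs hp hn
    have hcc : C c⁻¹ * C c = (1 : F[X]) := by rw [← C_mul, inv_mul_cancel₀ hc, C_1]
    let N := LinearMap.ker (B v)
    let pr : M →ₗ[F[X]] N := LinearMap.codRestrict N
      (LinearMap.id - (C c⁻¹ • (B v)).smulRight v) (by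
        intro x
        simp only [N, LinearMap.mem_ker, LinearMap.sub_apply, LinearMap.id_apply,
          LinearMap.smulRight_apply, map_sub, map_smul, LinearMap.smul_apply, smul_eq_mul, hv]
        linear_combination (- B v x) * hcc)
    have hpr : ∀ x, (pr x : M) = x - (C c⁻¹ * B v x) • v := fun x => rfl
    have hprN : ∀ x : N, pr x = x := fun x => by
      apply Subtype.ext
      rw [hpr]
      have : B v x = 0 := x.2
      simp [this]
    let eqv : M ≃ₗ[F[X]] F[X] × N :=
      LinearEquiv.ofLinear ((B v).prod pr)
        (((C c⁻¹ • LinearMap.id).smulRight v).coprod N.subtype)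
        (by
          ext1
          · ext1
            apply Prod.ext
            · simp [hv, hcc]
            · apply Subtype.ext
              simp only [LinearMap.coe_comp, Function.comp_apply, LinearMap.coprod_inl, LinearMap.prod_apply,
                Pi.prod, LinearMap.coe_inl]
              simp [hpr, hv, hcc]
          · ext1 y
            have hy : B v y = 0 := y.2
            apply Prod.ext
            · simp [hy]
            · simp [hprN])
        (by ext1 x; simp [hpr])
    have hfr : Module.finrank F[X] N = n := by
      have h1 := eqv.finrank_eq
      rw [Module.finrank_prod, Module.finrank_self, hn] at h1
      omega
    have hprB : ∀ x (y : N), B (pr x) y = B x y := fun x y => by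
      have hy : B v y = 0 := y.2
      rw [hpr]; simp [hy]
    obtain ⟨e, d, hd, he, hx⟩ := ih N (B.domRestrict₁₂ N N) (fun x y => hs _ _) (by
      intro φ
      obtain ⟨x, hx⟩ := hp (φ ∘ₗ pr)
      refine ⟨pr x, ?_⟩
      ext1 y
      rw [LinearMap.domRestrict₁₂_apply, hprB, hx, LinearMap.comp_apply, hprN]) hfr
    have hve : ∀ y : N, B v y = 0 := fun y => y.2
    refine ⟨Fin.cons v (fun i => (e i : M)), Fin.cons c d, ?_, ?_, ?_⟩
    · intro i; refine Fin.cases ?_ ?_ i <;> simp [hc, hd]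
    · intro i j
      refine Fin.cases ?_ (fun i => ?_) i <;> refine Fin.cases ?_ (fun j => ?_) j
      · simp [hv]
      · simp only [Fin.cons_zero, Fin.cons_succ, hve]
        rw [if_neg (Fin.succ_ne_zero j).symm]
      · simp only [Fin.cons_zero, Fin.cons_succ]
        rw [hs, hve, if_neg (Fin.succ_ne_zero i)]
      · simp only [Fin.cons_succ, Fin.succ_inj]
        exact he i j
    · intro x
      rw [Fin.sum_univ_succ]
      simp only [Fin.cons_zero, Fin.cons_succ]
      have h := congrArg Subtype.val (hx (pr x))
      simp only [LinearMap.domRestrict₁₂_apply, hprB, AddSubmonoidClass.coe_finsetSum,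
        Submodule.coe_smul] at h
      rw [← h, hpr, hs x v]
      abel

def bil {R ι : Type*} [CommRing R] [Fintype ι] (d : ι → R) (y z : ι → R) : R :=
  ∑ i, d i * y i * z i

/-- self-dual at `p` -/
def SD {R ι : Type*} [CommRing R] [Fintype ι] (d : ι → R) (p : R) : Prop :=
  ∃ W : Submodule R (ι → R), (∀ y, p • y ∈ W) ∧ (∀ y ∈ W, ∀ z ∈ W, p ^ 2 ∣ bil d y z) ∧
    (∀ y, (∀ z ∈ W, p ^ 2 ∣ bil d y z) → y ∈ W)

theorem exists_monic_assoc {F : Type*} [Field F] {p : F[X]} (hp : p ≠ 0) :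
    ∃ q : F[X], q.Monic ∧ Associated p q := by
  classical
  exact ⟨normalize p, monic_normalize hp, associated_normalize p⟩

theorem sq_dvd_of_primes {F : Type*} [Field F] (x Δ : F[X]) : Squarefree Δ →
    (∀ p : F[X], Irreducible p → p.Monic → p ∣ Δ → p ^ 2 ∣ x) → Δ ^ 2 ∣ x := by
  refine WfDvdMonoid.induction_on_irreducible Δ ?_ ?_ ?_
  · intro h; exact absurd h not_squarefree_zero
  · intro u hu _ _; exact (hu.pow 2).dvd
  · intro a i ha hi ih hs h
    obtain ⟨q, hq, hiq⟩ := exists_monic_assoc hi.ne_zero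
    have hqi : Irreducible q := hiq.irreducible hi
    have h1 : i ^ 2 ∣ x := (pow_dvd_pow_of_dvd hiq.dvd 2).trans
      (h q hqi hq (hiq.symm.dvd.trans (dvd_mul_right _ _)))
    have h2 : a ^ 2 ∣ x := ih hs.of_mul_right fun p hp hm hpa => h p hp hm (hpa.mul_left _)
    have hc : IsCoprime i a := (Irreducible.coprime_iff_not_dvd hi).2 fun hd => by
      obtain ⟨b, rfl⟩ := hd
      exact hi.not_isUnit (hs i ⟨b, by ring⟩)
    rw [mul_pow]
    exact (hc.pow).mul_dvd h1 h2

theorem thmA (F : Type*) [Field F] (h2 : (2:F) ≠ 0) (n : ℕ) (d : Fin n → F[X])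
    (hd : ∀ i, d i ≠ 0) (Δ : F[X]) (hΔ : Squarefree Δ) (hdΔ : ∀ i, d i ∣ Δ)
    (hloc : ∀ p : F[X], Irreducible p → p.Monic → p ∣ Δ → SD d p) :
    ∃ (Y : Fin n → Fin n → F[X]) (c : Fin n → F), (∀ i, c i ≠ 0) ∧
      ∀ i j, bil d (Y i) (Y j) = if i = j then Δ ^ 2 * C (c i) else 0 := by
  classical
  have hΔ0 : Δ ≠ 0 := hΔ.ne_zero
  have hloc' : ∀ p : F[X], ∃ W : Submodule F[X] (Fin n → F[X]), (Irreducible p → p.Monic → p ∣ Δ →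
    (∀ y, p • y ∈ W) ∧ (∀ y ∈ W, ∀ z ∈ W, p ^ 2 ∣ bil d y z) ∧
    (∀ y, (∀ z ∈ W, p ^ 2 ∣ bil d y z) → y ∈ W)) := by
    intro p
    by_cases h : Irreducible p ∧ p.Monic ∧ p ∣ Δ
    · obtain ⟨W, hW⟩ := hloc p h.1 h.2.1 h.2.2
      exact ⟨W, fun _ _ _ => hW⟩
    · exact ⟨⊤, fun h1 h2 h3 => absurd ⟨h1, h2, h3⟩ h⟩
  choose W hW using hloc'
  let L : Submodule F[X] (Fin n → F[X]) :=
    ⨅ p : {p : F[X] // Irreducible p ∧ p.Monic ∧ p ∣ Δ}, W p.1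
  have memL : ∀ y, y ∈ L ↔ ∀ p : F[X], Irreducible p → p.Monic → p ∣ Δ → y ∈ W p := by
    intro y
    simp only [L, Submodule.mem_iInf, Subtype.forall]
    exact ⟨fun h p h1 h2 h3 => h p ⟨h1, h2, h3⟩, fun h p hp => h p hp.1 hp.2.1 hp.2.2⟩
  have hΔL : ∀ y : Fin n → F[X], Δ • y ∈ L := by
    intro y
    rw [memL]
    rintro p h1 h2 ⟨q, rfl⟩
    rw [mul_smul]
    exact (hW p h1 h2 (dvd_mul_right _ _)).1 _
  have hint : ∀ y ∈ L, ∀ z ∈ L, Δ ^ 2 ∣ bil d y z := by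
    intro y hy z hz
    apply sq_dvd_of_primes _ _ hΔ
    intro p h1 h2 h3
    exact (hW p h1 h2 h3).2.1 y ((memL y).1 hy p h1 h2 h3) z ((memL z).1 hz p h1 h2 h3)
  have hdual : ∀ y, (∀ z ∈ L, Δ ^ 2 ∣ bil d y z) → y ∈ L := by
    intro y hy
    rw [memL]
    intro p h1 h2 h3
    obtain ⟨q, hq⟩ := h3
    apply (hW p h1 h2 ⟨q, hq⟩).2.2
    intro z hz
    have hqz : q • z ∈ L := by
      rw [memL]
      intro p' h1' h2' h3'
      by_cases hpp : p' = p
      · rw [hpp]; exact Submodule.smul_mem _ _ hz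
      · have : p' ∣ q := by
          rw [hq] at h3'
          rcases h1'.prime.dvd_or_dvd h3' with h | h
          · exact absurd (eq_of_monic_of_associated h2' h2 (h1'.associated_of_dvd h1 h)) hpp
          · exact h
        obtain ⟨r, rfl⟩ := this
        rw [mul_smul]
        exact (hW p' h1' h2' (h3')).1 _
    have h := hy _ hqz
    have h4 : bil d y (q • z) = q * bil d y z := by
      simp only [bil, Finset.mul_sum, Pi.smul_apply, smul_eq_mul]
      exact Finset.sum_congr rfl fun i _ => by ring
    have hq0 : q ≠ 0 := by rintro rfl; simp at hq; exact hΔ0 hq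
    rw [h4, hq, show (p * q) ^ 2 = q * (p ^ 2 * q) by ring] at h
    exact (dvd_mul_right _ _).trans ((mul_dvd_mul_iff_left hq0).1 h)
  have hint' : ∀ y z : L, ∃ r, bil d y z = Δ ^ 2 * r := fun y z => hint y y.2 z z.2
  choose β hβ using hint'
  have hΔ2 : Δ ^ 2 ≠ 0 := pow_ne_zero 2 hΔ0
  let B : L →ₗ[F[X]] L →ₗ[F[X]] F[X] := LinearMap.mk₂ F[X] β
    (fun x y z => by
      apply mul_left_cancel₀ hΔ2
      rw [mul_add, ← hβ, ← hβ, ← hβ]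
      simp only [bil, ← Finset.sum_add_distrib, Submodule.coe_add, Pi.add_apply]
      exact Finset.sum_congr rfl fun i _ => by ring)
    (fun r x y => by
      apply mul_left_cancel₀ hΔ2
      rw [smul_eq_mul, mul_left_comm, ← hβ, ← hβ]
      simp only [bil, Finset.mul_sum, Submodule.coe_smul, Pi.smul_apply, smul_eq_mul]
      exact Finset.sum_congr rfl fun i _ => by ring)
    (fun x y z => by
      apply mul_left_cancel₀ hΔ2
      rw [mul_add, ← hβ, ← hβ, ← hβ]
      simp only [bil, ← Finset.sum_add_distrib, Submodule.coe_add, Pi.add_apply]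
      exact Finset.sum_congr rfl fun i _ => by ring)
    (fun r x y => by
      apply mul_left_cancel₀ hΔ2
      rw [smul_eq_mul, mul_left_comm, ← hβ, ← hβ]
      simp only [bil, Finset.mul_sum, Submodule.coe_smul, Pi.smul_apply, smul_eq_mul]
      exact Finset.sum_congr rfl fun i _ => by ring)
  have hB : ∀ x y : L, bil d x y = Δ ^ 2 * B x y := hβ
  have hfr : Module.finrank F[X] L = n := by
    apply le_antisymm
    · simpa using Submodule.finrank_le L
    · let f : (Fin n → F[X]) →ₗ[F[X]] L := LinearMap.codRestrict L (Δ • LinearMap.id)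
        (fun y => hΔL y)
      have hf : Function.Injective f := by
        intro x y hxy
        have h := congrArg Subtype.val hxy
        have h' : Δ • x = Δ • y := h
        exact smul_right_injective _ hΔ0 h'
      simpa using LinearMap.finrank_le_finrank_of_injective hf
  obtain ⟨e, c, hc, he, -⟩ := harder F h2 n L B
    (by
      intro x y
      apply mul_left_cancel₀ hΔ2
      rw [← hB, ← hB]
      simp only [bil]
      exact Finset.sum_congr rfl fun i _ => by ring)
    (by
      intro φ
      choose q hq using hdΔ
      let y : Fin n → F[X] := fun i => q i * φ ⟨Δ • Pi.single i 1, hΔL _⟩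
      have hy : ∀ z : L, bil d y z = Δ ^ 2 * φ z := by
        intro z
        have h1 : Δ • z = ∑ i, (z : Fin n → F[X]) i •
            (⟨Δ • Pi.single i 1, hΔL _⟩ : L) := by
          apply Subtype.ext
          simp only [Submodule.coe_smul, AddSubmonoidClass.coe_finsetSum]
          funext j
          simp only [Finset.sum_apply, Pi.smul_apply, smul_eq_mul, Pi.single_apply]
          simp [mul_comm]
        have h2 : Δ * φ z = ∑ i, (z : Fin n → F[X]) i * φ ⟨Δ • Pi.single i 1, hΔL _⟩ := by
          rw [← smul_eq_mul, ← map_smul, h1, map_sum]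
          simp only [map_smul, smul_eq_mul]
        rw [pow_two, mul_assoc, h2, Finset.mul_sum]
        simp only [bil, y]
        exact Finset.sum_congr rfl fun i _ => by rw [← mul_assoc (d i), ← hq i]; ring
      have hyL : y ∈ L := hdual y fun z hz => ⟨_, hy ⟨z, hz⟩⟩
      refine ⟨⟨y, hyL⟩, ?_⟩
      ext1 z
      apply mul_left_cancel₀ hΔ2
      rw [← hB, ← hy])
    hfr
  refine ⟨fun i => e i, c, hc, fun i j => ?_⟩
  rw [hB, he]
  split_ifs <;> simp

/-- binary forms are universal mod `p` -/
def UP {F : Type*} [Field F] (p : F[X]) : Prop :=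
  ∀ a b : F[X], ¬ p ∣ a → ¬ p ∣ b → ∃ s t, p ∣ a * s ^ 2 + b * t ^ 2 - 1

theorem SD_of_I {F : Type*} [Field F] {ι : Type*} [Fintype ι] [DecidableEq ι] (d : ι → F[X])
    (p : F[X]) (hp : Irreducible p) (I : Finset ι) (u : ι → F[X]) (hI : ∀ m ∈ I, d m = p * u m)
    (hn : ∀ m ∉ I, ¬ p ∣ d m) (V : Submodule F[X] (ι → F[X])) (hV1 : ∀ y, p • y ∈ V)
    (hVI : ∀ y, (∀ m ∈ I, y m = 0) → y ∈ V)
    (hV2 : ∀ y ∈ V, ∀ z ∈ V, p ∣ ∑ m ∈ I, u m * y m * z m)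
    (hV3 : ∀ y, (∀ z ∈ V, (∀ m ∉ I, z m = 0) → p ∣ ∑ m ∈ I, u m * y m * z m) → y ∈ V) :
    SD d p := by
  have key : ∀ y z, bil d y z = p * ∑ m ∈ I, u m * y m * z m + ∑ m ∈ Iᶜ, d m * y m * z m := by
    intro y z
    rw [bil, ← Finset.sum_add_sum_compl I, Finset.mul_sum]
    congr 1
    exact Finset.sum_congr rfl fun m hm => by rw [hI m hm]; ring
  let W : Submodule F[X] (ι → F[X]) :=
    { carrier := {y | y ∈ V ∧ ∀ m ∉ I, p ∣ y m}
      add_mem' := fun {a b} ha hb => ⟨V.add_mem ha.1 hb.1, fun m hm => dvd_add (ha.2 m hm) (hb.2 m hm)⟩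
      zero_mem' := ⟨V.zero_mem, fun m _ => dvd_zero _⟩
      smul_mem' := fun c y hy => ⟨V.smul_mem c hy.1, fun m hm => (hy.2 m hm).mul_left _⟩ }
  refine ⟨W, fun y => ⟨hV1 y, fun m _ => dvd_mul_right _ _⟩, ?_, ?_⟩
  · rintro y ⟨hy, hy'⟩ z ⟨hz, hz'⟩
    rw [key]
    refine dvd_add ?_ (Finset.dvd_sum fun m hm => ?_)
    · rw [pow_two]; exact mul_dvd_mul_left _ (hV2 y hy z hz)
    · rw [Finset.mem_compl] at hm
      rw [mul_assoc, pow_two]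
      exact (mul_dvd_mul (hy' m hm) (hz' m hm)).mul_left _
  · intro y hy
    refine ⟨hV3 y fun z hz hz' => ?_, fun m hm => ?_⟩
    · have h := hy z ⟨hz, fun m hm => by rw [hz' m hm]; exact dvd_zero _⟩
      rw [key, Finset.sum_eq_zero (s := Iᶜ), add_zero, pow_two] at h
      · exact (mul_dvd_mul_iff_left hp.ne_zero).1 h
      · intro m hm; rw [Finset.mem_compl] at hm; rw [hz' m hm, mul_zero]
    · have h := hy (p • Pi.single m 1) ⟨hV1 _, fun k _ => dvd_mul_right _ _⟩
      have h1 : bil d y (p • Pi.single m 1) = p * (d m * y m) := by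
        rw [bil, Finset.sum_eq_single m]
        · simp; ring
        · intro k _ hk; simp [hk]
        · simp
      rw [h1, pow_two] at h
      have h2 := (mul_dvd_mul_iff_left hp.ne_zero).1 h
      exact (hp.prime.dvd_or_dvd h2).resolve_left (hn m hm)

theorem mk_dvd {F : Type*} [Field F] {p x : F[X]} : p ∣ x ↔ AdjoinRoot.mk p x = 0 :=
  AdjoinRoot.mk_eq_zero.symm

theorem SD_two {F : Type*} [Field F] {ι : Type*} [Fintype ι] [DecidableEq ι] (d : ι → F[X])
    (p : F[X]) (hp : Irreducible p) (i j : ι) (hij : i ≠ j) (ui uj s : F[X])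
    (hi : d i = p * ui) (hj : d j = p * uj) (hui : ¬ p ∣ ui)
    (hs : p ∣ ui + uj * s ^ 2) (hn : ∀ m, m ≠ i → m ≠ j → ¬ p ∣ d m) : SD d p := by
  haveI : Fact (Irreducible p) := ⟨hp⟩
  let f : (ι → F[X]) →ₗ[F[X]] F[X] := LinearMap.proj j - s • LinearMap.proj i
  have hf : ∀ y, f y = y j - s * y i := fun y => rfl
  let V : Submodule F[X] (ι → F[X]) := Submodule.comap f (Ideal.span {p})
  have hV : ∀ y, y ∈ V ↔ p ∣ y j - s * y i := fun y => by
    rw [← hf, ← Ideal.mem_span_singleton]; rfl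
  have hsum : ∀ y z : ι → F[X], ∑ m ∈ ({i, j} : Finset ι), (if m = i then ui else uj) * y m * z m
      = ui * y i * z i + uj * y j * z j := by
    intro y z
    rw [Finset.sum_pair hij, if_pos rfl, if_neg hij.symm]
  have hs' := hs
  simp only [mk_dvd, map_add, map_sub, map_mul, map_pow] at hs' hui
  refine SD_of_I d p hp {i, j} (fun m => if m = i then ui else uj) ?_ ?_ V ?_ ?_ ?_ ?_
  · intro m hm
    simp only [Finset.mem_insert, Finset.mem_singleton] at hm
    rcases hm with rfl | rfl
    · simp [hi]
    · simp [hj, hij.symm]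
  · intro m hm
    simp only [Finset.mem_insert, Finset.mem_singleton, not_or] at hm
    exact hn m hm.1 hm.2
  · intro y; rw [hV]
    exact ⟨y j - s * y i, by simp only [Pi.smul_apply, smul_eq_mul]; ring⟩
  · intro y hy
    rw [hV, hy i (by simp), hy j (by simp)]; simp
  · intro y hy z hz
    rw [hV] at hy hz
    rw [hsum]
    simp only [mk_dvd, map_add, map_sub, map_mul, map_pow] at *
    linear_combination (AdjoinRoot.mk p (y i) * AdjoinRoot.mk p (z i)) * hs' +
      AdjoinRoot.mk p uj * AdjoinRoot.mk p (z j) * hy +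
      AdjoinRoot.mk p uj * AdjoinRoot.mk p s * AdjoinRoot.mk p (y i) * hz
  · intro y hy
    have h := hy (Pi.single i 1 + Pi.single j s) (by rw [hV]; simp [hij, hij.symm]) (by
      intro m hm
      simp only [Finset.mem_insert, Finset.mem_singleton, not_or] at hm
      simp [hm.1, hm.2])
    rw [hsum] at h
    rw [hV]
    simp only [Pi.add_apply, Pi.single_eq_same, Pi.single_eq_of_ne hij, Pi.single_eq_of_ne hij.symm,
      mk_dvd, map_add, map_sub, map_mul, map_pow, map_one, map_zero] at *
    apply mul_left_cancel₀ hui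
    linear_combination (-AdjoinRoot.mk p s) * h + AdjoinRoot.mk p (y j) * hs'

theorem exists_inv_mod {F : Type*} [Field F] {p : F[X]} (hp : Irreducible p) {a : F[X]}
    (ha : ¬ p ∣ a) : ∃ v, p ∣ v * a - 1 := by
  obtain ⟨x, y, h⟩ := (Irreducible.coprime_iff_not_dvd hp).2 ha
  exact ⟨y, -x, by linear_combination h⟩

theorem SD_four {F : Type*} [Field F] {ι : Type*} [Fintype ι] [DecidableEq ι] (d : ι → F[X])
    (p : F[X]) (hp : Irreducible p) (hU : UP p) (i j k l : ι) (hij : i ≠ j) (hik : i ≠ k)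
    (hil : i ≠ l) (hjk : j ≠ k) (hjl : j ≠ l) (hkl : k ≠ l) (ui uj uk ul w : F[X])
    (hi : d i = p * ui) (hj : d j = p * uj) (hk : d k = p * uk) (hl : d l = p * ul)
    (hui : ¬ p ∣ ui) (huj : ¬ p ∣ uj) (huk : ¬ p ∣ uk) (hul : ¬ p ∣ ul)
    (hw : p ∣ ui * uj * uk * ul - w ^ 2)
    (hn : ∀ m, m ≠ i → m ≠ j → m ≠ k → m ≠ l → ¬ p ∣ d m) : SD d p := by
  haveI : Fact (Irreducible p) := ⟨hp⟩
  obtain ⟨v, hv⟩ := exists_inv_mod hp huk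
  have hnv : ¬ p ∣ v := fun h => hp.not_isUnit (isUnit_of_dvd_one (by
    have := dvd_sub (h.mul_right uk) hv
    simpa using this))
  obtain ⟨s, t, hst0⟩ := hU (-ui * v) (-uj * v)
    (fun h => (hp.prime.dvd_or_dvd h).elim (fun h => hui ((dvd_neg).1 h)) hnv)
    (fun h => (hp.prime.dvd_or_dvd h).elim (fun h => huj ((dvd_neg).1 h)) hnv)
  have h3 : ¬ p ∣ ui * uj * uk := fun h =>
    (hp.prime.dvd_or_dvd h).elim (fun h => (hp.prime.dvd_or_dvd h).elim hui huj) huk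
  obtain ⟨v', hv'⟩ := exists_inv_mod hp h3
  obtain ⟨r, hr0⟩ : ∃ r, r = w * v' := ⟨_, rfl⟩
  have hst : AdjoinRoot.mk p (ui * s ^ 2 + uj * t ^ 2 + uk) = 0 := by
    simp only [mk_dvd, map_add, map_sub, map_mul, map_pow, map_one, map_neg] at *
    linear_combination (-AdjoinRoot.mk p uk) * hst0 + (-AdjoinRoot.mk p ui * AdjoinRoot.mk p s ^2
      -AdjoinRoot.mk p uj * AdjoinRoot.mk p t ^2) * hv
  have hr : AdjoinRoot.mk p (r ^ 2 * ui * uj * uk - ul) = 0 := by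
    simp only [mk_dvd, hr0, map_add, map_sub, map_mul, map_pow, map_one, map_neg] at *
    linear_combination (AdjoinRoot.mk p w ^ 2 * AdjoinRoot.mk p v' + AdjoinRoot.mk p ul) * hv' -
      AdjoinRoot.mk p v' * hw
  clear hw hv hv' hst0 hr0
  let f : (ι → F[X]) →ₗ[F[X]] F[X] := LinearMap.proj i - s • LinearMap.proj k -
    (r * uj * t) • LinearMap.proj l
  let g : (ι → F[X]) →ₗ[F[X]] F[X] := LinearMap.proj j - t • LinearMap.proj k +
    (r * ui * s) • LinearMap.proj l
  have hf : ∀ y, f y = y i - s * y k - (r * uj * t) * y l := fun y => rfl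
  have hg : ∀ y, g y = y j - t * y k + (r * ui * s) * y l := fun y => rfl
  let V : Submodule F[X] (ι → F[X]) := Submodule.comap f (Ideal.span {p}) ⊓ Submodule.comap g (Ideal.span {p})
  have hV : ∀ y, y ∈ V ↔ p ∣ y i - s * y k - (r * uj * t) * y l ∧
      p ∣ y j - t * y k + (r * ui * s) * y l := fun y => by
    rw [← hf, ← hg, ← Ideal.mem_span_singleton, ← Ideal.mem_span_singleton]; rfl
  obtain ⟨u, hu⟩ : ∃ u : ι → F[X], u = fun m => if m = i then ui else if m = j then uj else
    if m = k then uk else ul := ⟨_, rfl⟩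
  have eui : u i = ui := by rw [hu]; simp
  have euj : u j = uj := by rw [hu]; simp [hij.symm]
  have euk : u k = uk := by rw [hu]; simp [hik.symm, hjk.symm]
  have eul : u l = ul := by rw [hu]; simp [hil.symm, hjl.symm, hkl.symm]
  clear hu
  have hsum : ∀ y z : ι → F[X], ∑ m ∈ ({i, j, k, l} : Finset ι), u m * y m * z m
      = ui * y i * z i + uj * y j * z j + uk * y k * z k + ul * y l * z l := by
    intro y z
    rw [Finset.sum_insert, Finset.sum_insert, Finset.sum_pair hkl, eui, euj, euk, eul]
    · ring
    · simp [hjk, hjl]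
    · simp [hij, hik, hil]
  refine SD_of_I d p hp {i, j, k, l} u ?_ ?_ V ?_ ?_ ?_ ?_
  · intro m hm
    simp only [Finset.mem_insert, Finset.mem_singleton] at hm
    rcases hm with rfl | rfl | rfl | rfl
    · rw [eui, hi]
    · rw [euj, hj]
    · rw [euk, hk]
    · rw [eul, hl]
  · intro m hm
    simp only [Finset.mem_insert, Finset.mem_singleton, not_or] at hm
    exact hn m hm.1 hm.2.1 hm.2.2.1 hm.2.2.2
  · intro y; rw [hV]
    exact ⟨⟨y i - s * y k - (r * uj * t) * y l, by simp only [Pi.smul_apply, smul_eq_mul]; ring⟩,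
      ⟨y j - t * y k + (r * ui * s) * y l, by simp only [Pi.smul_apply, smul_eq_mul]; ring⟩⟩
  · intro y hy
    rw [hV, hy i (by simp), hy j (by simp), hy k (by simp), hy l (by simp)]; simp
  · intro y hy z hz
    rw [hV] at hy hz
    rw [hsum]
    simp only [mk_dvd, map_add, map_sub, map_mul, map_pow] at *
    obtain ⟨hy1, hy2⟩ := hy
    obtain ⟨hz1, hz2⟩ := hz
    have e1 := sub_eq_zero.1 (by rw [sub_sub] at hy1; exact hy1)
    have e2 := sub_eq_zero.1 (by rw [sub_sub] at hz1; exact hz1)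
    have e3 : AdjoinRoot.mk p (y j) = AdjoinRoot.mk p t * AdjoinRoot.mk p (y k) -
      AdjoinRoot.mk p r * AdjoinRoot.mk p ui * AdjoinRoot.mk p s * AdjoinRoot.mk p (y l) := by
      linear_combination hy2
    have e4 : AdjoinRoot.mk p (z j) = AdjoinRoot.mk p t * AdjoinRoot.mk p (z k) -
      AdjoinRoot.mk p r * AdjoinRoot.mk p ui * AdjoinRoot.mk p s * AdjoinRoot.mk p (z l) := by
      linear_combination hz2
    rw [e1, e2, e3, e4]
    linear_combination (AdjoinRoot.mk p (y k) * AdjoinRoot.mk p (z k) + AdjoinRoot.mk p r ^ 2 *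
      AdjoinRoot.mk p ui * AdjoinRoot.mk p uj * AdjoinRoot.mk p (y l) * AdjoinRoot.mk p (z l)) * hst
      - AdjoinRoot.mk p (y l) * AdjoinRoot.mk p (z l) * hr
  · intro y hy
    have h := hy (Pi.single i s + Pi.single j t + Pi.single k 1)
      (by rw [hV]; simp [hij, hij.symm, hik, hik.symm, hil, hil.symm, hjk, hjk.symm, hjl, hjl.symm,
            hkl, hkl.symm]) (by
      intro m hm
      simp only [Finset.mem_insert, Finset.mem_singleton, not_or] at hm
      simp [hm.1, hm.2])
    have h' := hy (Pi.single i (r * uj * t) + Pi.single j (- (r * ui * s)) + Pi.single l 1)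
      (by rw [hV]; simp [hij, hij.symm, hik, hik.symm, hil, hil.symm, hjk, hjk.symm, hjl, hjl.symm,
            hkl, hkl.symm]) (by
      intro m hm
      simp only [Finset.mem_insert, Finset.mem_singleton, not_or] at hm
      simp [hm.1, hm.2])
    rw [hsum] at h h'
    rw [hV]
    simp only [Pi.add_apply, Pi.single_eq_same, Pi.single_eq_of_ne hij, Pi.single_eq_of_ne hij.symm,
      Pi.single_eq_of_ne hik, Pi.single_eq_of_ne hik.symm, Pi.single_eq_of_ne hil,
      Pi.single_eq_of_ne hil.symm, Pi.single_eq_of_ne hjk, Pi.single_eq_of_ne hjk.symm,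
      Pi.single_eq_of_ne hjl, Pi.single_eq_of_ne hjl.symm, Pi.single_eq_of_ne hkl,
      Pi.single_eq_of_ne hkl.symm,
      mk_dvd, map_add, map_sub, map_mul, map_pow, map_one, map_zero, map_neg, add_zero, zero_add,
      mul_zero] at *
    have hr1 : AdjoinRoot.mk p r ≠ 0 := fun h0 => hul (by rw [h0] at hr; linear_combination -hr)
    have h5 : AdjoinRoot.mk p t * AdjoinRoot.mk p (y i) - AdjoinRoot.mk p s * AdjoinRoot.mk p (y j)
      + AdjoinRoot.mk p r * AdjoinRoot.mk p uk * AdjoinRoot.mk p (y l) = 0 := by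
      apply mul_left_cancel₀ (mul_ne_zero (mul_ne_zero hr1 hui) huj)
      linear_combination h' + AdjoinRoot.mk p (y l) * hr
    constructor
    · apply mul_left_cancel₀ huk
      linear_combination AdjoinRoot.mk p (y i) * hst - AdjoinRoot.mk p s * h -
        AdjoinRoot.mk p uj * AdjoinRoot.mk p t * h5
    · apply mul_left_cancel₀ huk
      linear_combination AdjoinRoot.mk p (y j) * hst - AdjoinRoot.mk p t * h +
        AdjoinRoot.mk p ui * AdjoinRoot.mk p s * h5

def UF (F : Type*) [Field F] : Prop := ∀ a b : F, a ≠ 0 → b ≠ 0 → ∃ s t, a * s ^ 2 + b * t ^ 2 = 1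

theorem UF.neg {F : Type*} [Field F] (h : UF F) {a b c : F} (ha : a ≠ 0) (hb : b ≠ 0) (hc : c ≠ 0) :
    ∃ s t, a * s ^ 2 + b * t ^ 2 + c = 0 := by
  obtain ⟨s, t, h⟩ := h (-a / c) (-b / c) (div_ne_zero (neg_ne_zero.2 ha) hc)
    (div_ne_zero (neg_ne_zero.2 hb) hc)
  refine ⟨s, t, ?_⟩
  field_simp at h
  linear_combination -h

def comb {R ι : Type*} [CommRing R] [Fintype ι] (Y : ι → ι → R) (a : ι → R) : ι → R :=
  fun k => ∑ i, a i * Y i k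

theorem bil_comb {F : Type*} [Field F] {n : ℕ} {d : Fin n → F[X]} {Δ : F[X]}
    {Y : Fin n → Fin n → F[X]} {c : Fin n → F}
    (hY : ∀ i j, bil d (Y i) (Y j) = if i = j then Δ ^ 2 * C (c i) else 0) (a b : Fin n → F[X]) :
    bil d (comb Y a) (comb Y b) = Δ ^ 2 * ∑ i, C (c i) * a i * b i := by
  have : bil d (comb Y a) (comb Y b) = ∑ i, ∑ j, a i * b j * bil d (Y i) (Y j) := by
    simp only [bil, comb, Finset.mul_sum, Finset.sum_mul]
    rw [Finset.sum_comm]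
    rw [Finset.sum_comm]
    rw [Finset.sum_congr rfl fun k _ => Finset.sum_comm]
    rw [Finset.sum_comm]
    refine Finset.sum_congr rfl fun i _ => ?_
    rw [Finset.sum_comm]
    refine Finset.sum_congr rfl fun j _ => ?_
    refine Finset.sum_congr rfl fun k _ => ?_
    ring
  rw [this, Finset.mul_sum]
  refine Finset.sum_congr rfl fun i _ => ?_
  rw [Finset.sum_eq_single i]
  · rw [hY, if_pos rfl]; ring
  · intro j _ hj; rw [hY, if_neg hj.symm, mul_zero]
  · simp

theorem comb_ne {F : Type*} [Field F] {n : ℕ} {d : Fin n → F[X]} {Δ : F[X]} (hΔ : Δ ≠ 0)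
    {Y : Fin n → Fin n → F[X]} {c : Fin n → F} (hc : ∀ i, c i ≠ 0)
    (hY : ∀ i j, bil d (Y i) (Y j) = if i = j then Δ ^ 2 * C (c i) else 0) (a : Fin n → F[X])
    (ha : a ≠ 0) : comb Y a ≠ 0 := by
  classical
  intro h
  apply ha
  funext i
  have h1 := bil_comb hY a (Pi.single i 1)
  rw [h, Finset.sum_eq_single i (by intro j _ hj; simp [hj]) (by simp)] at h1
  simp only [bil, Pi.zero_apply, mul_zero, zero_mul, Finset.sum_const_zero, Pi.single_eq_same,
    mul_one] at h1
  have := mul_eq_zero.1 h1.symm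
  simpa [hΔ, hc i] using this

theorem isoA (F : Type*) [Field F] (h2 : (2:F) ≠ 0) (hU : UF F) (n : ℕ) (d : Fin (n + 3) → F[X])
    (hd : ∀ i, d i ≠ 0) (Δ : F[X]) (hΔ : Squarefree Δ) (hdΔ : ∀ i, d i ∣ Δ)
    (hloc : ∀ p : F[X], Irreducible p → p.Monic → p ∣ Δ → SD d p) :
    ∃ x : Fin (n + 3) → F[X], x ≠ 0 ∧ ∑ i, d i * x i ^ 2 = 0 := by
  obtain ⟨Y, c, hc, hY⟩ := thmA F h2 _ d hd Δ hΔ hdΔ hloc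
  obtain ⟨s, t, hst⟩ := hU.neg (hc 0) (hc 1) (hc 2)
  let a : Fin (n + 3) → F[X] := Fin.cons (C s) (Fin.cons (C t) (Fin.cons 1 0))
  have ha : a ≠ 0 := fun h => by
    have := congrFun h 2
    change (1 : F[X]) = 0 at this
    exact one_ne_zero this
  refine ⟨comb Y a, comb_ne hΔ.ne_zero hc hY a ha, ?_⟩
  have h := bil_comb hY a a
  have h0 : ∑ i, C (c i) * a i * a i = 0 := by
    rw [Fin.sum_univ_succ, Fin.sum_univ_succ, Fin.sum_univ_succ]
    simp only [a, Fin.cons_zero, Fin.cons_succ, Pi.zero_apply, mul_zero, Finset.sum_const_zero]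
    have := congrArg C hst
    simp only [map_add, map_mul, map_pow, map_zero] at this
    change C (c 0) * C s * C s + (C (c 1) * C t * C t + (C (c 2) * 1 * 1 + 0)) = 0
    linear_combination this
  rw [h0, mul_zero] at h
  rw [← h, bil]
  exact Finset.sum_congr rfl fun i _ => by ring

theorem det_gram {R : Type*} [CommRing R] {n : ℕ} (Y : Fin n → Fin n → R) (d e : Fin n → R)
    (hY : ∀ i j, bil d (Y i) (Y j) = if i = j then e i else 0) :
    (Matrix.of Y).det ^ 2 * ∏ i, d i = ∏ i, e i := by
  have h : Matrix.of Y * Matrix.diagonal d * (Matrix.of Y).transpose = Matrix.diagonal e := by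
    ext1 i j
    rw [Matrix.mul_apply, Matrix.diagonal_apply, ← hY, bil]
    refine Finset.sum_congr rfl fun k _ => ?_
    rw [Matrix.mul_diagonal, Matrix.transpose_apply]
    simp only [Matrix.of_apply]
    ring
  have h' := congrArg Matrix.det h
  rw [Matrix.det_mul, Matrix.det_mul, Matrix.det_diagonal, Matrix.det_diagonal,
    Matrix.det_transpose] at h'
  linear_combination h'

theorem iso6 (F : Type*) [Field F] (h2 : (2:F) ≠ 0) (hU : UF F) (d : Fin 6 → F[X])
    (hd : ∀ i, d i ≠ 0) (Δ : F[X]) (hΔ : Squarefree Δ) (hdΔ : ∀ i, d i ∣ Δ)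
    (hloc : ∀ p : F[X], Irreducible p → p.Monic → p ∣ Δ → SD d p)
    (q : F[X]) (hq : ∏ i, d i = - q ^ 2) :
    ∃ x : Fin 6 → F[X], x ≠ 0 ∧ x 4 = 0 ∧ x 5 = 0 ∧ ∑ i, d i * x i ^ 2 = 0 := by
  obtain ⟨Y, c, hc, hY⟩ := thmA F h2 _ d hd Δ hΔ hdΔ hloc
  have hΔ0 := hΔ.ne_zero
  -- determinant
  have hdet : (Matrix.of Y).det ^ 2 * ∏ i, d i = (Δ ^ 6) ^ 2 * C (∏ i, c i) := by
    rw [det_gram Y d _ hY, Finset.prod_mul_distrib, Finset.prod_const, Finset.card_univ,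
      Fintype.card_fin, ← map_prod]
    ring
  rw [hq] at hdet
  obtain ⟨l, hl⟩ : ∃ l : F, l ^ 2 = - ∏ i, c i := by
    have h1 : ((Matrix.of Y).det * q) ^ 2 = (Δ ^ 6) ^ 2 * C (- ∏ i, c i) := by
      rw [C_neg]; linear_combination -hdet
    have h3 : Δ ^ 6 ∣ (Matrix.of Y).det * q :=
      (IsIntegrallyClosed.pow_dvd_pow_iff two_ne_zero).1 ⟨_, h1⟩
    obtain ⟨m, hm⟩ := h3
    rw [hm, mul_pow] at h1
    have h4 := mul_left_cancel₀ (pow_ne_zero 2 (pow_ne_zero 6 hΔ0)) h1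
    have h5 : m.natDegree = 0 := by
      have := congrArg natDegree h4
      rw [natDegree_pow, natDegree_C] at this
      omega
    rw [eq_C_of_natDegree_eq_zero h5, ← C_pow] at h4
    exact ⟨_, C_injective h4⟩
  obtain ⟨s, t, hst⟩ := hU.neg (hc 0) (hc 1) (hc 2)
  obtain ⟨s', t', hst'⟩ := hU.neg (hc 3) (hc 4) (hc 5)
  obtain ⟨lam, hlam⟩ : ∃ lam : F, lam = l / (c 0 * c 1 * c 2) := ⟨_, rfl⟩
  have hlam2 : lam ^ 2 * (c 0 * c 1 * c 2) = - (c 3 * c 4 * c 5) := by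
    have := hc 0
    have := hc 1
    have := hc 2
    rw [hlam]
    field_simp
    rw [hl, Fin.prod_univ_six]
    try ring
  let A : (Fin 3 → F[X]) →ₗ[F[X]] (Fin 6 → F[X]) := LinearMap.pi
    ![C s • LinearMap.proj 0 - C (lam * c 1 * t) • LinearMap.proj 2,
      C t • LinearMap.proj 0 + C (lam * c 0 * s) • LinearMap.proj 2,
      LinearMap.proj 0,
      C s' • LinearMap.proj 1 - C (c 4 * t') • LinearMap.proj 2,
      C t' • LinearMap.proj 1 + C (c 3 * s') • LinearMap.proj 2,
      LinearMap.proj 1]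
  have hA0 : ∀ v, A v 0 = C s * v 0 - C (lam * c 1 * t) * v 2 := fun v => rfl
  have hA1 : ∀ v, A v 1 = C t * v 0 + C (lam * c 0 * s) * v 2 := fun v => rfl
  have hA2 : ∀ v, A v 2 = v 0 := fun v => rfl
  have hA3 : ∀ v, A v 3 = C s' * v 1 - C (c 4 * t') * v 2 := fun v => rfl
  have hA4 : ∀ v, A v 4 = C t' * v 1 + C (c 3 * s') * v 2 := fun v => rfl
  have hA5 : ∀ v, A v 5 = v 1 := fun v => rfl
  have hC := congrArg C hst
  have hC' := congrArg C hst'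
  have hCl := congrArg C hlam2
  have hAne : ∀ v, v ≠ 0 → A v ≠ 0 := by
    intro v hv h
    have e0 : v 0 = 0 := by rw [← hA2 v, h]; rfl
    have e1 : v 1 = 0 := by rw [← hA5 v, h]; rfl
    have e2 : v 2 ≠ 0 := fun e2 => hv (by funext i; fin_cases i <;> assumption)
    have h3 := hA3 v
    have h4 := hA4 v
    rw [h, e1, Pi.zero_apply] at h3 h4
    have h3' : C (c 4 * t') = 0 := by
      have : C (c 4 * t') * v 2 = 0 := by linear_combination h3
      exact (mul_eq_zero.1 this).resolve_right e2
    have h4' : C (c 3 * s') = 0 := by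
      have : C (c 3 * s') * v 2 = 0 := by linear_combination -h4
      exact (mul_eq_zero.1 this).resolve_right e2
    have h3'' := (mul_eq_zero.1 (C_eq_zero.1 h3')).resolve_left (hc 4)
    have h4'' := (mul_eq_zero.1 (C_eq_zero.1 h4')).resolve_left (hc 3)
    rw [h3'', h4''] at hst'
    exact hc 5 (by linear_combination hst')
  have hAiso : ∀ v, ∑ i, C (c i) * A v i * A v i = 0 := by
    intro v
    simp only [map_add, map_mul, map_pow, map_zero, map_neg] at hC hC' hCl
    rw [Fin.sum_univ_six, hA0, hA1, hA2, hA3, hA4, hA5]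
    simp only [map_mul]
    linear_combination v 0 ^ 2 * hC + v 1 ^ 2 * hC' + v 2 ^ 2 * C lam ^ 2 * C (c 0) * C (c 1) * hC
      + v 2 ^ 2 * C (c 3) * C (c 4) * hC' - v 2 ^ 2 * hCl
  let P : (Fin 3 → F[X]) →ₗ[F[X]] (Fin 2 → F[X]) := LinearMap.pi
    ![∑ i, (Y i 4) • (LinearMap.proj i ∘ₗ A), ∑ i, (Y i 5) • (LinearMap.proj i ∘ₗ A)]
  have hP : LinearMap.ker P ≠ ⊥ := by
    intro h
    have := LinearMap.finrank_le_finrank_of_injective (LinearMap.ker_eq_bot.1 h)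
    simp at this
  obtain ⟨v, hv, hv0⟩ := Submodule.exists_mem_ne_zero_of_ne_bot hP
  rw [LinearMap.mem_ker] at hv
  refine ⟨comb Y (A v), comb_ne hΔ0 hc hY _ (hAne v hv0), ?_, ?_, ?_⟩
  · have := congrFun hv 0
    simp only [P, LinearMap.pi_apply, Matrix.cons_val_zero, LinearMap.sum_apply,
      LinearMap.smul_apply, LinearMap.comp_apply, LinearMap.proj_apply, smul_eq_mul,
      Pi.zero_apply] at this
    rw [← this, comb]
    exact Finset.sum_congr rfl fun i _ => mul_comm _ _
  · have := congrFun hv 1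
    simp only [P, LinearMap.pi_apply, Matrix.cons_val_one, Matrix.cons_val_zero,
      LinearMap.sum_apply, LinearMap.smul_apply, LinearMap.comp_apply, LinearMap.proj_apply,
      smul_eq_mul, Pi.zero_apply] at this
    rw [← this, comb]
    exact Finset.sum_congr rfl fun i _ => mul_comm _ _
  · have h := bil_comb hY (A v) (A v)
    rw [hAiso, mul_zero] at h
    rw [← h, bil]
    exact Finset.sum_congr rfl fun i _ => by ring

theorem sqf_nd {R : Type*} [CommRing R] {p a b : R} (h : Squarefree (a * b)) (hp : ¬ IsUnit p)
    (ha : p ∣ a) : ¬ p ∣ b := fun hb => hp (h p (mul_dvd_mul ha hb))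

theorem sqf_nd' {R : Type*} [CommRing R] {p a b : R} (h : Squarefree (a * b)) (hp : ¬ IsUnit p)
    (hb : p ∣ b) : ¬ p ∣ a := fun ha => hp (h p (mul_dvd_mul ha hb))

theorem exists_sq_mul_sqf {F : Type*} [Field F] (g : F[X]) : g ≠ 0 →
    ∃ m g0 : F[X], m ≠ 0 ∧ Squarefree g0 ∧ g = m ^ 2 * g0 := by
  refine WfDvdMonoid.induction_on_irreducible g ?_ ?_ ?_
  · intro h; exact absurd rfl h
  · intro u hu _; exact ⟨1, u, one_ne_zero, hu.squarefree, by ring⟩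
  · intro a i ha hi ih _
    obtain ⟨m, g0, hm, hg, rfl⟩ := ih ha
    by_cases h : i ∣ g0
    · obtain ⟨r, rfl⟩ := h
      exact ⟨m * i, r, mul_ne_zero hm hi.ne_zero, hg.of_mul_right, by ring⟩
    · refine ⟨m, i * g0, hm, ?_, by ring⟩
      rw [squarefree_mul_iff]
      exact ⟨((Irreducible.coprime_iff_not_dvd hi).2 h).isRelPrime, hi.squarefree, hg⟩

theorem sq_inv {F : Type*} [Field F] {p g β : F[X]} (hp : Irreducible p) (hg : ¬ p ∣ g)
    (h : p ∣ g - β ^ 2) : ∃ s, p ∣ 1 - g * s ^ 2 := by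
  have hβ : ¬ p ∣ β := fun hb => hg (by
    have := dvd_add h (dvd_pow hb two_ne_zero)
    simpa using this)
  obtain ⟨v, hv⟩ := exists_inv_mod hp hβ
  refine ⟨v, ?_⟩
  have h1 : p ∣ -(v * β - 1) * (v * β + 1) - v ^ 2 * (g - β ^ 2) :=
    dvd_sub (((dvd_neg).2 hv).mul_right _) (h.mul_left _)
  convert h1 using 1; ring

theorem thmL_sqf {E : Type*} [Field E] (h2 : (2:E) ≠ 0) (hU : UF E) (x y z k g s : E[X])
    (hsq : Squarefree (x * y * z * k * g)) (hUP : ∀ p, Irreducible p → p ∣ x * y * z → UP p)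
    (hs : g ∣ x * y * z * k - s ^ 2) (hx : ∃ β, x ∣ g + y * z * β ^ 2)
    (hy : ∃ β, y ∣ g + x * z * β ^ 2) (hz : ∃ β, z ∣ g + x * y * β ^ 2)
    (hk : ∃ β, k ∣ g - β ^ 2) :
    ∃ a b c w : E[X], (a ≠ 0 ∨ b ≠ 0 ∨ c ≠ 0 ∨ w ≠ 0) ∧
      y * z * a ^ 2 + x * z * b ^ 2 + x * y * c ^ 2 + x * y * z * k * w ^ 2 = 0 := by
  have h0 := hsq.ne_zero
  have hg0 : g ≠ 0 := right_ne_zero_of_mul h0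
  have h0 := left_ne_zero_of_mul h0
  have hk0 : k ≠ 0 := right_ne_zero_of_mul h0
  have h0 := left_ne_zero_of_mul h0
  have hz0 : z ≠ 0 := right_ne_zero_of_mul h0
  have h0 := left_ne_zero_of_mul h0
  have hy0 : y ≠ 0 := right_ne_zero_of_mul h0
  have hx0 := left_ne_zero_of_mul h0
  let d : Fin 6 → E[X] := ![y * z, x * z, x * y, x * y * z * k, g, - (x * y * z * k * g)]
  obtain ⟨v, hv, h4, h5, hsum⟩ := iso6 E h2 hU d (by
      intro i; fin_cases i <;> simp [d, hx0, hy0, hz0, hk0, hg0]) (x * y * z * k * g) hsq (by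
      intro i
      fin_cases i
      · exact ⟨x * k * g, by simp [d]; ring⟩
      · exact ⟨y * k * g, by simp [d]; ring⟩
      · exact ⟨z * k * g, by simp [d]; ring⟩
      · exact ⟨g, by simp [d]⟩
      · exact ⟨x * y * z * k, by simp [d]; ring⟩
      · exact ⟨-1, by simp [d]⟩) (by
      intro p hp _ hpd
      have hu := hp.not_isUnit
      have hpp := hp.prime
      rcases hpp.dvd_or_dvd hpd with hpd | hpd
      · rcases hpp.dvd_or_dvd hpd with hpd | hpd
        · have hUp : UP p := hUP p hp hpd
          rcases hpp.dvd_or_dvd hpd with hpd | hpd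
          · rcases hpp.dvd_or_dvd hpd with hpd | hpd
            · obtain ⟨β, hβ⟩ := hx
              have hβ' := hpd.trans hβ
              have hn : ¬ p ∣ y * z * k * g := sqf_nd (a := x) (by convert hsq using 1; ring) hu hpd
              obtain ⟨x', rfl⟩ := hpd
              have hn' : ¬ p ∣ x' := sqf_nd (a := p) (hsq.squarefree_of_dvd ⟨y * z * k * g, by ring⟩) hu
                dvd_rfl
              simp only [hpp.dvd_mul, not_or] at hn
              obtain ⟨⟨⟨n1, n2⟩, n3⟩, n4⟩ := hn
              refine SD_four d p hp hUp 1 2 3 5 (by decide) (by decide) (by decide) (by decide)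
                (by decide) (by decide) (x' * z) (x' * y) (x' * y * z * k) (- (x' * y * z * k * g))
                (x' ^ 2 * y ^ 2 * z ^ 2 * k * β) ?_ ?_ ?_ ?_ ?_ ?_ ?_ ?_ ?_ ?_
              · simp [d]; ring
              · simp [d]; ring
              · simp [d]; ring
              · simp [d]; ring
              · simp [hpp.dvd_mul, n1, n2, n3, n4, hn']
              · simp [hpp.dvd_mul, n1, n2, n3, n4, hn']
              · simp [hpp.dvd_mul, n1, n2, n3, n4, hn']
              · simp [hpp.dvd_mul, n1, n2, n3, n4, hn']
              · have := hβ'.mul_left (-x' ^ 4 * y ^ 3 * z ^ 3 * k ^ 2)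
                convert this using 1; ring
              · intro m
                fin_cases m <;> simp [d, hpp.dvd_mul, n1, n2, n3, n4]
            · obtain ⟨β, hβ⟩ := hy
              have hβ' := hpd.trans hβ
              have hn : ¬ p ∣ x * z * k * g := sqf_nd (a := y) (by convert hsq using 1; ring) hu hpd
              obtain ⟨y', rfl⟩ := hpd
              have hn' : ¬ p ∣ y' := sqf_nd (a := p) (hsq.squarefree_of_dvd ⟨x * z * k * g, by ring⟩) hu
                dvd_rfl
              simp only [hpp.dvd_mul, not_or] at hn
              obtain ⟨⟨⟨n1, n2⟩, n3⟩, n4⟩ := hn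
              refine SD_four d p hp hUp 0 2 3 5 (by decide) (by decide) (by decide) (by decide)
                (by decide) (by decide) (y' * z) (x * y') (x * y' * z * k) (- (x * y' * z * k * g))
                (x ^ 2 * y' ^ 2 * z ^ 2 * k * β) ?_ ?_ ?_ ?_ ?_ ?_ ?_ ?_ ?_ ?_
              · simp [d]; ring
              · simp [d]; ring
              · simp [d]; ring
              · simp [d]; ring
              · simp [hpp.dvd_mul, n1, n2, n3, n4, hn']
              · simp [hpp.dvd_mul, n1, n2, n3, n4, hn']
              · simp [hpp.dvd_mul, n1, n2, n3, n4, hn']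
              · simp [hpp.dvd_mul, n1, n2, n3, n4, hn']
              · have := hβ'.mul_left (-x ^ 3 * y' ^ 4 * z ^ 3 * k ^ 2)
                convert this using 1; ring
              · intro m
                fin_cases m <;> simp [d, hpp.dvd_mul, n1, n2, n3, n4]
          · obtain ⟨β, hβ⟩ := hz
            have hβ' := hpd.trans hβ
            have hn : ¬ p ∣ x * y * k * g := sqf_nd (a := z) (by convert hsq using 1; ring) hu hpd
            obtain ⟨z', rfl⟩ := hpd
            have hn' : ¬ p ∣ z' := sqf_nd (a := p) (hsq.squarefree_of_dvd ⟨x * y * k * g, by ring⟩) hu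
              dvd_rfl
            simp only [hpp.dvd_mul, not_or] at hn
            obtain ⟨⟨⟨n1, n2⟩, n3⟩, n4⟩ := hn
            refine SD_four d p hp hUp 0 1 3 5 (by decide) (by decide) (by decide) (by decide)
              (by decide) (by decide) (y * z') (x * z') (x * y * z' * k) (- (x * y * z' * k * g))
              (x ^ 2 * y ^ 2 * z' ^ 2 * k * β) ?_ ?_ ?_ ?_ ?_ ?_ ?_ ?_ ?_ ?_
            · simp [d]; ring
            · simp [d]; ring
            · simp [d]; ring
            · simp [d]; ring
            · simp [hpp.dvd_mul, n1, n2, n3, n4, hn']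
            · simp [hpp.dvd_mul, n1, n2, n3, n4, hn']
            · simp [hpp.dvd_mul, n1, n2, n3, n4, hn']
            · simp [hpp.dvd_mul, n1, n2, n3, n4, hn']
            · have := hβ'.mul_left (-x ^ 3 * y ^ 3 * z' ^ 4 * k ^ 2)
              convert this using 1; ring
            · intro m
              fin_cases m <;> simp [d, hpp.dvd_mul, n1, n2, n3, n4]
        · obtain ⟨β, hβ⟩ := hk
          have hβ' := hpd.trans hβ
          have hn : ¬ p ∣ x * y * z * g := sqf_nd (a := k) (by convert hsq using 1; ring) hu hpd
          obtain ⟨k', rfl⟩ := hpd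
          have hn' : ¬ p ∣ k' := sqf_nd (a := p) (hsq.squarefree_of_dvd ⟨x * y * z * g, by ring⟩) hu
            dvd_rfl
          simp only [hpp.dvd_mul, not_or] at hn
          obtain ⟨⟨⟨n1, n2⟩, n3⟩, n4⟩ := hn
          obtain ⟨σ, hσ⟩ := sq_inv hp n4 hβ'
          refine SD_two d p hp 3 5 (by decide) (x * y * z * k') (-(x * y * z * k' * g)) σ ?_ ?_ ?_ ?_ ?_
          · simp [d]; ring
          · simp [d]; ring
          · simp [hpp.dvd_mul, n1, n2, n3, n4, hn']
          · have := hσ.mul_left (x * y * z * k')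
            convert this using 1; ring
          · intro m
            fin_cases m <;> simp [d, hpp.dvd_mul, n1, n2, n3, n4]
      · have hβ' := hpd.trans hs
        have hn : ¬ p ∣ x * y * z * k := sqf_nd' hsq hu hpd
        obtain ⟨σ, hσ⟩ := sq_inv hp hn hβ'
        obtain ⟨g', rfl⟩ := hpd
        have hn' : ¬ p ∣ g' := sqf_nd (a := p) (hsq.squarefree_of_dvd ⟨x * y * z * k, by ring⟩) hu
          dvd_rfl
        simp only [hpp.dvd_mul, not_or] at hn
        obtain ⟨⟨⟨n1, n2⟩, n3⟩, n4⟩ := hn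
        refine SD_two d p hp 4 5 (by decide) g' (-(x * y * z * k * g')) σ ?_ ?_ ?_ ?_ ?_
        · simp [d]
        · simp [d]; ring
        · exact hn'
        · have := hσ.mul_left g'
          convert this using 1; ring
        · intro m
          fin_cases m <;> simp [d, hpp.dvd_mul, n1, n2, n3, n4])
      (x * y * z * (x * y * z * k) * g) (by
        rw [Fin.prod_univ_six]
        simp [d]; ring)
  refine ⟨v 0, v 1, v 2, v 3, ?_, ?_⟩
  · by_contra h
    push Not at h
    apply hv
    obtain ⟨e0, e1, e2, e3⟩ := h
    funext i
    fin_cases i <;> assumption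
  · rw [Fin.sum_univ_six, h4, h5] at hsum
    simp [d] at hsum
    linear_combination hsum

theorem sq_class_div {F : Type*} [Field F] {x m g c : F[X]} (hm : IsCoprime x m)
    (h : ∃ β, x ∣ m ^ 2 * g + c * β ^ 2) : ∃ β, x ∣ g + c * β ^ 2 := by
  obtain ⟨β, hβ⟩ := h
  obtain ⟨u, v, huv⟩ := hm
  refine ⟨β * v, ?_⟩
  have h1 := hβ.mul_left (v ^ 2)
  have h2 : x ∣ x * (u * (v * m + 1) * g) := dvd_mul_right _ _
  have h3 := dvd_add h1 h2
  convert h3 using 1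
  linear_combination (-(1 + v * m) * g) * huv

theorem thmL {E : Type*} [Field E] (h2 : (2:E) ≠ 0) (hU : UF E) (x y z k g s : E[X])
    (hsq : Squarefree (x * y * z * k)) (hcop : IsCoprime (x * y * z * k) g) (hg : g ≠ 0)
    (hUP : ∀ p, Irreducible p → p ∣ x * y * z → UP p)
    (hs : g ∣ x * y * z * k - s ^ 2) (hx : ∃ β, x ∣ g + y * z * β ^ 2)
    (hy : ∃ β, y ∣ g + x * z * β ^ 2) (hz : ∃ β, z ∣ g + x * y * β ^ 2)
    (hk : ∃ β, k ∣ g - β ^ 2) :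
    ∃ a b c w : E[X], (a ≠ 0 ∨ b ≠ 0 ∨ c ≠ 0 ∨ w ≠ 0) ∧
      y * z * a ^ 2 + x * z * b ^ 2 + x * y * c ^ 2 + x * y * z * k * w ^ 2 = 0 := by
  obtain ⟨m, g0, hm, hg0, rfl⟩ := exists_sq_mul_sqf g hg
  have hc0 : IsCoprime (x * y * z * k) g0 := hcop.of_mul_right_right
  have hcm : IsCoprime (x * y * z * k) m := by
    have := hcop.of_mul_right_left
    rw [pow_two] at this
    exact this.of_mul_right_left
  have hk' : ∃ β, k ∣ g0 + (-1) * β ^ 2 := sq_class_div (m := m) hcm.of_mul_left_right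
    (by obtain ⟨β, hβ⟩ := hk; exact ⟨β, by convert hβ using 1; ring⟩)
  refine thmL_sqf h2 hU x y z k g0 s ?_ hUP ((dvd_mul_left _ _).trans hs)
    (sq_class_div hcm.of_mul_left_left.of_mul_left_left.of_mul_left_left hx)
    (sq_class_div hcm.of_mul_left_left.of_mul_left_left.of_mul_left_right hy)
    (sq_class_div hcm.of_mul_left_left.of_mul_left_right hz)
    (by obtain ⟨β, hβ⟩ := hk'; exact ⟨β, by convert hβ using 1; ring⟩)
  rw [squarefree_mul_iff]
  exact ⟨hc0.isRelPrime, hsq, hg0⟩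

theorem iso8 {E : Type*} [Field E] (h2 : (2:E) ≠ 0) (hU : UF E)
    (hUP : ∀ p : E[X], Irreducible p → UP p) (a b c e0 e1 e2 e3 : E[X])
    (hsq : Squarefree (a * b * c * e0 * e1 * e2 * e3)) (d : Fin 8 → E[X])
    (hd0 : d 0 = (1))
    (hd1 : d 1 = (e2 * e3 * b * c))
    (hd2 : d 2 = (e1 * e3 * a * c))
    (hd3 : d 3 = (e1 * e2 * a * b))
    (hd4 : d 4 = -(e0 * e1 * e2 * e3))
    (hd5 : d 5 = -(e0 * e1 * b * c))
    (hd6 : d 6 = -(e0 * e2 * a * c))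
    (hd7 : d 7 = -(e0 * e3 * a * b))
    : ∃ x : Fin 8 → E[X], x ≠ 0 ∧ ∑ i, d i * x i ^ 2 = 0 := by
  have h0 := hsq.ne_zero
  simp only [mul_ne_zero_iff] at h0
  obtain ⟨⟨⟨⟨⟨⟨ha, hb⟩, hc⟩, he0⟩, he1⟩, he2⟩, he3⟩ := h0
  refine isoA E h2 hU 5 d ?_ _ hsq ?_ ?_
  · intro i
    fin_cases i
    · change d 0 ≠ 0; rw [hd0]; simp [ha, hb, hc, he0, he1, he2, he3]
    · change d 1 ≠ 0; rw [hd1]; simp [ha, hb, hc, he0, he1, he2, he3]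
    · change d 2 ≠ 0; rw [hd2]; simp [ha, hb, hc, he0, he1, he2, he3]
    · change d 3 ≠ 0; rw [hd3]; simp [ha, hb, hc, he0, he1, he2, he3]
    · change d 4 ≠ 0; rw [hd4]; simp [ha, hb, hc, he0, he1, he2, he3]
    · change d 5 ≠ 0; rw [hd5]; simp [ha, hb, hc, he0, he1, he2, he3]
    · change d 6 ≠ 0; rw [hd6]; simp [ha, hb, hc, he0, he1, he2, he3]
    · change d 7 ≠ 0; rw [hd7]; simp [ha, hb, hc, he0, he1, he2, he3]
  · intro i
    fin_cases i
    · change d 0 ∣ _; rw [hd0]; exact ⟨(a * b * c * e0 * e1 * e2 * e3), by ring⟩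
    · change d 1 ∣ _; rw [hd1]; exact ⟨(a * e0 * e1), by ring⟩
    · change d 2 ∣ _; rw [hd2]; exact ⟨(b * e0 * e2), by ring⟩
    · change d 3 ∣ _; rw [hd3]; exact ⟨(c * e0 * e3), by ring⟩
    · change d 4 ∣ _; rw [hd4]; exact ⟨-(a * b * c), by ring⟩
    · change d 5 ∣ _; rw [hd5]; exact ⟨-(a * e2 * e3), by ring⟩
    · change d 6 ∣ _; rw [hd6]; exact ⟨-(b * e1 * e3), by ring⟩
    · change d 7 ∣ _; rw [hd7]; exact ⟨-(c * e1 * e2), by ring⟩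
  · intro p hp _ hpd
    have hu := hp.not_isUnit
    have hpp := hp.prime
    have hUp := hUP p hp
    simp only [hpp.dvd_mul] at hpd
    rcases hpd with (((((hpd | hpd) | hpd) | hpd) | hpd) | hpd) | hpd
    · have hn : ¬ p ∣ b * c * e0 * e1 * e2 * e3 := sqf_nd (a := a) (by convert hsq using 1; ring) hu hpd
      obtain ⟨q, rfl⟩ := hpd
      have hq : ¬ p ∣ q := sqf_nd (a := p) (hsq.squarefree_of_dvd ⟨b * c * e0 * e1 * e2 * e3, by ring⟩) hu dvd_rfl
      simp only [hpp.dvd_mul, not_or] at hn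
      obtain ⟨⟨⟨⟨⟨n1, n2⟩, n3⟩, n4⟩, n5⟩, n6⟩ := hn
      refine SD_four d p hp hUp 2 3 6 7 (by decide) (by decide) (by decide) (by decide)
        (by decide) (by decide) ((q * e1 * e3 * c)) ((q * e1 * e2 * b)) (-(q * e0 * e2 * c)) (-(q * e0 * e3 * b))
        (q ^ 2 * e1 * e3 * c * e2 * b * e0) ?_ ?_ ?_ ?_ ?_ ?_ ?_ ?_ ?_ ?_
      · rw [hd2]; ring
      · rw [hd3]; ring
      · rw [hd6]; ring
      · rw [hd7]; ring
      iterate 4 (· simp [hpp.dvd_mul, n1, n2, n3, n4, n5, n6, hq])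
      · exact ⟨0, by ring⟩
      · intro m m1 m2 m3 m4
        fin_cases m <;> first | exact absurd rfl m1 | exact absurd rfl m2 | exact absurd rfl m3 | exact absurd rfl m4 | skip
        · change ¬ p ∣ d 0; rw [hd0]; exact fun h => hu (isUnit_of_dvd_one h)
        · change ¬ p ∣ d 1; rw [hd1]; simp [hpp.dvd_mul, n1, n2, n3, n4, n5, n6]
        · change ¬ p ∣ d 4; rw [hd4]; simp [hpp.dvd_mul, n1, n2, n3, n4, n5, n6]
        · change ¬ p ∣ d 5; rw [hd5]; simp [hpp.dvd_mul, n1, n2, n3, n4, n5, n6]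
    · have hn : ¬ p ∣ a * c * e0 * e1 * e2 * e3 := sqf_nd (a := b) (by convert hsq using 1; ring) hu hpd
      obtain ⟨q, rfl⟩ := hpd
      have hq : ¬ p ∣ q := sqf_nd (a := p) (hsq.squarefree_of_dvd ⟨a * c * e0 * e1 * e2 * e3, by ring⟩) hu dvd_rfl
      simp only [hpp.dvd_mul, not_or] at hn
      obtain ⟨⟨⟨⟨⟨n1, n2⟩, n3⟩, n4⟩, n5⟩, n6⟩ := hn
      refine SD_four d p hp hUp 1 3 5 7 (by decide) (by decide) (by decide) (by decide)
        (by decide) (by decide) ((q * e2 * e3 * c)) ((q * e1 * e2 * a)) (-(q * e0 * e1 * c)) (-(q * e0 * e3 * a))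
        (q ^ 2 * e2 * e3 * c * e1 * a * e0) ?_ ?_ ?_ ?_ ?_ ?_ ?_ ?_ ?_ ?_
      · rw [hd1]; ring
      · rw [hd3]; ring
      · rw [hd5]; ring
      · rw [hd7]; ring
      iterate 4 (· simp [hpp.dvd_mul, n1, n2, n3, n4, n5, n6, hq])
      · exact ⟨0, by ring⟩
      · intro m m1 m2 m3 m4
        fin_cases m <;> first | exact absurd rfl m1 | exact absurd rfl m2 | exact absurd rfl m3 | exact absurd rfl m4 | skip
        · change ¬ p ∣ d 0; rw [hd0]; exact fun h => hu (isUnit_of_dvd_one h)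
        · change ¬ p ∣ d 2; rw [hd2]; simp [hpp.dvd_mul, n1, n2, n3, n4, n5, n6]
        · change ¬ p ∣ d 4; rw [hd4]; simp [hpp.dvd_mul, n1, n2, n3, n4, n5, n6]
        · change ¬ p ∣ d 6; rw [hd6]; simp [hpp.dvd_mul, n1, n2, n3, n4, n5, n6]
    · have hn : ¬ p ∣ a * b * e0 * e1 * e2 * e3 := sqf_nd (a := c) (by convert hsq using 1; ring) hu hpd
      obtain ⟨q, rfl⟩ := hpd
      have hq : ¬ p ∣ q := sqf_nd (a := p) (hsq.squarefree_of_dvd ⟨a * b * e0 * e1 * e2 * e3, by ring⟩) hu dvd_rfl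
      simp only [hpp.dvd_mul, not_or] at hn
      obtain ⟨⟨⟨⟨⟨n1, n2⟩, n3⟩, n4⟩, n5⟩, n6⟩ := hn
      refine SD_four d p hp hUp 1 2 5 6 (by decide) (by decide) (by decide) (by decide)
        (by decide) (by decide) ((q * e2 * e3 * b)) ((q * e1 * e3 * a)) (-(q * e0 * e1 * b)) (-(q * e0 * e2 * a))
        (q ^ 2 * e2 * e3 * b * e1 * a * e0) ?_ ?_ ?_ ?_ ?_ ?_ ?_ ?_ ?_ ?_
      · rw [hd1]; ring
      · rw [hd2]; ring
      · rw [hd5]; ring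
      · rw [hd6]; ring
      iterate 4 (· simp [hpp.dvd_mul, n1, n2, n3, n4, n5, n6, hq])
      · exact ⟨0, by ring⟩
      · intro m m1 m2 m3 m4
        fin_cases m <;> first | exact absurd rfl m1 | exact absurd rfl m2 | exact absurd rfl m3 | exact absurd rfl m4 | skip
        · change ¬ p ∣ d 0; rw [hd0]; exact fun h => hu (isUnit_of_dvd_one h)
        · change ¬ p ∣ d 3; rw [hd3]; simp [hpp.dvd_mul, n1, n2, n3, n4, n5, n6]
        · change ¬ p ∣ d 4; rw [hd4]; simp [hpp.dvd_mul, n1, n2, n3, n4, n5, n6]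
        · change ¬ p ∣ d 7; rw [hd7]; simp [hpp.dvd_mul, n1, n2, n3, n4, n5, n6]
    · have hn : ¬ p ∣ a * b * c * e1 * e2 * e3 := sqf_nd (a := e0) (by convert hsq using 1; ring) hu hpd
      obtain ⟨q, rfl⟩ := hpd
      have hq : ¬ p ∣ q := sqf_nd (a := p) (hsq.squarefree_of_dvd ⟨a * b * c * e1 * e2 * e3, by ring⟩) hu dvd_rfl
      simp only [hpp.dvd_mul, not_or] at hn
      obtain ⟨⟨⟨⟨⟨n1, n2⟩, n3⟩, n4⟩, n5⟩, n6⟩ := hn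
      refine SD_four d p hp hUp 4 5 6 7 (by decide) (by decide) (by decide) (by decide)
        (by decide) (by decide) (-(q * e1 * e2 * e3)) (-(q * e1 * b * c)) (-(q * e2 * a * c)) (-(q * e3 * a * b))
        (q ^ 2 * e1 * e2 * e3 * b * c * a) ?_ ?_ ?_ ?_ ?_ ?_ ?_ ?_ ?_ ?_
      · rw [hd4]; ring
      · rw [hd5]; ring
      · rw [hd6]; ring
      · rw [hd7]; ring
      iterate 4 (· simp [hpp.dvd_mul, n1, n2, n3, n4, n5, n6, hq])
      · exact ⟨0, by ring⟩
      · intro m m1 m2 m3 m4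
        fin_cases m <;> first | exact absurd rfl m1 | exact absurd rfl m2 | exact absurd rfl m3 | exact absurd rfl m4 | skip
        · change ¬ p ∣ d 0; rw [hd0]; exact fun h => hu (isUnit_of_dvd_one h)
        · change ¬ p ∣ d 1; rw [hd1]; simp [hpp.dvd_mul, n1, n2, n3, n4, n5, n6]
        · change ¬ p ∣ d 2; rw [hd2]; simp [hpp.dvd_mul, n1, n2, n3, n4, n5, n6]
        · change ¬ p ∣ d 3; rw [hd3]; simp [hpp.dvd_mul, n1, n2, n3, n4, n5, n6]
    · have hn : ¬ p ∣ a * b * c * e0 * e2 * e3 := sqf_nd (a := e1) (by convert hsq using 1; ring) hu hpd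
      obtain ⟨q, rfl⟩ := hpd
      have hq : ¬ p ∣ q := sqf_nd (a := p) (hsq.squarefree_of_dvd ⟨a * b * c * e0 * e2 * e3, by ring⟩) hu dvd_rfl
      simp only [hpp.dvd_mul, not_or] at hn
      obtain ⟨⟨⟨⟨⟨n1, n2⟩, n3⟩, n4⟩, n5⟩, n6⟩ := hn
      refine SD_four d p hp hUp 2 3 4 5 (by decide) (by decide) (by decide) (by decide)
        (by decide) (by decide) ((q * e3 * a * c)) ((q * e2 * a * b)) (-(q * e0 * e2 * e3)) (-(q * e0 * b * c))
        (q ^ 2 * e3 * a * c * e2 * b * e0) ?_ ?_ ?_ ?_ ?_ ?_ ?_ ?_ ?_ ?_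
      · rw [hd2]; ring
      · rw [hd3]; ring
      · rw [hd4]; ring
      · rw [hd5]; ring
      iterate 4 (· simp [hpp.dvd_mul, n1, n2, n3, n4, n5, n6, hq])
      · exact ⟨0, by ring⟩
      · intro m m1 m2 m3 m4
        fin_cases m <;> first | exact absurd rfl m1 | exact absurd rfl m2 | exact absurd rfl m3 | exact absurd rfl m4 | skip
        · change ¬ p ∣ d 0; rw [hd0]; exact fun h => hu (isUnit_of_dvd_one h)
        · change ¬ p ∣ d 1; rw [hd1]; simp [hpp.dvd_mul, n1, n2, n3, n4, n5, n6]
        · change ¬ p ∣ d 6; rw [hd6]; simp [hpp.dvd_mul, n1, n2, n3, n4, n5, n6]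
        · change ¬ p ∣ d 7; rw [hd7]; simp [hpp.dvd_mul, n1, n2, n3, n4, n5, n6]
    · have hn : ¬ p ∣ a * b * c * e0 * e1 * e3 := sqf_nd (a := e2) (by convert hsq using 1; ring) hu hpd
      obtain ⟨q, rfl⟩ := hpd
      have hq : ¬ p ∣ q := sqf_nd (a := p) (hsq.squarefree_of_dvd ⟨a * b * c * e0 * e1 * e3, by ring⟩) hu dvd_rfl
      simp only [hpp.dvd_mul, not_or] at hn
      obtain ⟨⟨⟨⟨⟨n1, n2⟩, n3⟩, n4⟩, n5⟩, n6⟩ := hn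
      refine SD_four d p hp hUp 1 3 4 6 (by decide) (by decide) (by decide) (by decide)
        (by decide) (by decide) ((q * e3 * b * c)) ((q * e1 * a * b)) (-(q * e0 * e1 * e3)) (-(q * e0 * a * c))
        (q ^ 2 * e3 * b * c * e1 * a * e0) ?_ ?_ ?_ ?_ ?_ ?_ ?_ ?_ ?_ ?_
      · rw [hd1]; ring
      · rw [hd3]; ring
      · rw [hd4]; ring
      · rw [hd6]; ring
      iterate 4 (· simp [hpp.dvd_mul, n1, n2, n3, n4, n5, n6, hq])
      · exact ⟨0, by ring⟩
      · intro m m1 m2 m3 m4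
        fin_cases m <;> first | exact absurd rfl m1 | exact absurd rfl m2 | exact absurd rfl m3 | exact absurd rfl m4 | skip
        · change ¬ p ∣ d 0; rw [hd0]; exact fun h => hu (isUnit_of_dvd_one h)
        · change ¬ p ∣ d 2; rw [hd2]; simp [hpp.dvd_mul, n1, n2, n3, n4, n5, n6]
        · change ¬ p ∣ d 5; rw [hd5]; simp [hpp.dvd_mul, n1, n2, n3, n4, n5, n6]
        · change ¬ p ∣ d 7; rw [hd7]; simp [hpp.dvd_mul, n1, n2, n3, n4, n5, n6]
    · have hn : ¬ p ∣ a * b * c * e0 * e1 * e2 := sqf_nd (a := e3) (by convert hsq using 1; ring) hu hpd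
      obtain ⟨q, rfl⟩ := hpd
      have hq : ¬ p ∣ q := sqf_nd (a := p) (hsq.squarefree_of_dvd ⟨a * b * c * e0 * e1 * e2, by ring⟩) hu dvd_rfl
      simp only [hpp.dvd_mul, not_or] at hn
      obtain ⟨⟨⟨⟨⟨n1, n2⟩, n3⟩, n4⟩, n5⟩, n6⟩ := hn
      refine SD_four d p hp hUp 1 2 4 7 (by decide) (by decide) (by decide) (by decide)
        (by decide) (by decide) ((q * e2 * b * c)) ((q * e1 * a * c)) (-(q * e0 * e1 * e2)) (-(q * e0 * a * b))
        (q ^ 2 * e2 * b * c * e1 * a * e0) ?_ ?_ ?_ ?_ ?_ ?_ ?_ ?_ ?_ ?_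
      · rw [hd1]; ring
      · rw [hd2]; ring
      · rw [hd4]; ring
      · rw [hd7]; ring
      iterate 4 (· simp [hpp.dvd_mul, n1, n2, n3, n4, n5, n6, hq])
      · exact ⟨0, by ring⟩
      · intro m m1 m2 m3 m4
        fin_cases m <;> first | exact absurd rfl m1 | exact absurd rfl m2 | exact absurd rfl m3 | exact absurd rfl m4 | skip
        · change ¬ p ∣ d 0; rw [hd0]; exact fun h => hu (isUnit_of_dvd_one h)
        · change ¬ p ∣ d 3; rw [hd3]; simp [hpp.dvd_mul, n1, n2, n3, n4, n5, n6]
        · change ¬ p ∣ d 5; rw [hd5]; simp [hpp.dvd_mul, n1, n2, n3, n4, n5, n6]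
        · change ¬ p ∣ d 6; rw [hd6]; simp [hpp.dvd_mul, n1, n2, n3, n4, n5, n6]

noncomputable def nrm {E : Type*} [Field E] (f g : E[X]) : E :=
  Algebra.norm E (Ideal.Quotient.mk (Ideal.span {f}) g)

theorem nrm_eq_adj {E : Type*} [Field E] (f g : E[X]) :
    nrm f g = Algebra.norm E (AdjoinRoot.mk f g) := rfl

theorem det_aeval_splits {K : Type*} [Field K] {n : ℕ} (M : Matrix (Fin n) (Fin n) K) (g : K[X])
    (hg : g.Splits) : (aeval M g).det =
      g.leadingCoeff ^ n * (g.roots.map fun β => (-1) ^ n * M.charpoly.eval β).prod := by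
  let φ : K[X] →* K := (Matrix.detMonoidHom).comp ((aeval M : K[X] →ₐ[K] Matrix (Fin n) (Fin n) K) :
    K[X] →* Matrix (Fin n) (Fin n) K)
  have hφ : ∀ g, φ g = (aeval M g).det := fun g => rfl
  rw [← hφ]
  conv_lhs => rw [hg.eq_prod_roots, map_mul, map_multiset_prod, Multiset.map_map]
  congr 1
  · rw [hφ, aeval_C, Matrix.algebraMap_eq_diagonal, Matrix.det_diagonal]; simp
  · congr 1
    refine Multiset.map_congr rfl fun β _ => ?_
    rw [Function.comp_apply, hφ, Matrix.eval_charpoly, map_sub, aeval_X, aeval_C]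
    have h := Matrix.det_neg (Matrix.scalar (Fin n) β - M)
    rw [Fintype.card_fin, neg_sub] at h
    rw [← h]
    rfl

theorem nrm_resultant {E : Type*} [Field E] (f g : E[X]) (hf : f ≠ 0) :
    f.leadingCoeff ^ g.natDegree * nrm f g = resultant f g := by
  let pb := AdjoinRoot.powerBasis hf
  let M := Algebra.leftMulMatrix pb.basis pb.gen
  have hM : M.charpoly = f * C f.leadingCoeff⁻¹ := by
    rw [charpoly_leftMulMatrix, ← AdjoinRoot.minpoly_root hf, AdjoinRoot.powerBasis_gen]
  have hdim : pb.dim = f.natDegree := AdjoinRoot.powerBasis_dim hf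
  have h1 : nrm f g = (aeval M g).det := by
    rw [nrm_eq_adj, Algebra.norm_eq_matrix_det pb.basis, ← AdjoinRoot.aeval_eq,
      ← AdjoinRoot.powerBasis_gen hf, ← aeval_algHom_apply]
  let K := AlgebraicClosure E
  let i := algebraMap E K
  have hi : Function.Injective i := i.injective
  apply hi
  have hs : (g.map i).Splits := IsAlgClosed.splits _
  have h2 : i (nrm f g) = (aeval (M.map i) (g.map i)).det := by
    rw [h1, RingHom.map_det]
    congr 1
    refine map_aeval_eq_aeval_map (φ := i) (ψ := i.mapMatrix) ?_ g M
    ext1 x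
    simp [Matrix.algebraMap_eq_diagonal, i, K]
  have hc : (M.map i).charpoly = (f.map i) * C (i f.leadingCoeff⁻¹) := by
    rw [Matrix.charpoly_map, hM, Polynomial.map_mul, map_C]
  have hlf : f.leadingCoeff ≠ 0 := leadingCoeff_ne_zero.2 hf
  rw [map_mul, h2, det_aeval_splits _ _ hs, resultant_comm, map_mul, ← resultant_map_map]
  have h3 := resultant_eq_prod_eval (g.map i) (f.map i) f.natDegree (by simp) hs
  rw [natDegree_map] at h3
  rw [h3, hc, hdim, map_pow, map_pow, Multiset.prod_map_mul, Multiset.map_const', Multiset.prod_replicate]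
  have hcard : (g.map i).roots.card = g.natDegree := by
    rw [splits_iff_card_roots.1 hs, natDegree_map]
  simp only [eval_mul, eval_C, Multiset.prod_map_mul, Multiset.map_const', Multiset.prod_replicate]
  rw [hcard, map_neg, map_one, ← pow_mul, map_inv₀]
  have h4 : i f.leadingCoeff ^ g.natDegree * (i f.leadingCoeff)⁻¹ ^ g.natDegree = 1 := by
    rw [← mul_pow, mul_inv_cancel₀ ((map_ne_zero i).2 hlf), one_pow]
  linear_combination ((g.map i).leadingCoeff ^ f.natDegree * (-1) ^ (f.natDegree * g.natDegree) *
    (Multiset.map (fun x => eval x (f.map i)) (g.map i).roots).prod) * h4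

theorem nrm_congr {E : Type*} [Field E] {f g g' : E[X]} (h : f ∣ g - g') : nrm f g = nrm f g' := by
  unfold nrm
  congr 1
  rwa [Ideal.Quotient.eq, Ideal.mem_span_singleton]

theorem nrm_mul_right {E : Type*} [Field E] (f g g' : E[X]) :
    nrm f (g * g') = nrm f g * nrm f g' := by
  simp [nrm]

theorem nrm_mul_left {E : Type*} [Field E] (f f' g : E[X]) (hf : f ≠ 0) (hf' : f' ≠ 0) :
    nrm (f * f') g = nrm f g * nrm f' g := by
  have h := resultant_mul_left f f' g g.natDegree le_rfl
  rw [← nrm_resultant f g hf, ← nrm_resultant f' g hf', ← natDegree_mul hf hf',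
    ← nrm_resultant _ g (mul_ne_zero hf hf'), leadingCoeff_mul] at h
  have h1 := pow_ne_zero g.natDegree (leadingCoeff_ne_zero.2 hf)
  have h2 := pow_ne_zero g.natDegree (leadingCoeff_ne_zero.2 hf')
  apply mul_left_cancel₀ (mul_ne_zero h1 h2)
  rw [mul_pow] at h
  linear_combination h

theorem nrm_recip {E : Type*} [Field E] (f g : E[X]) (hf : f ≠ 0) (hg : g ≠ 0) :
    f.leadingCoeff ^ g.natDegree * nrm f g =
      (-1) ^ (f.natDegree * g.natDegree) * (g.leadingCoeff ^ f.natDegree * nrm g f) := by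
  rw [nrm_resultant f g hf, nrm_resultant g f hg, resultant_comm]

theorem nrm_C {E : Type*} [Field E] (f : E[X]) (hf : f ≠ 0) (c : E) :
    nrm f (C c) = c ^ f.natDegree := by
  have h := nrm_resultant f (C c) hf
  rw [natDegree_C, pow_zero, one_mul] at h
  rw [h]
  simp

theorem nrm_ne_zero {E : Type*} [Field E] (f g : E[X]) (hf : f ≠ 0) (h : IsCoprime f g) :
    nrm f g ≠ 0 := by
  intro h0
  obtain ⟨u, v, huv⟩ := h
  have h1 : nrm f (v * g) = nrm f 1 := nrm_congr ⟨-u, by linear_combination huv⟩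
  rw [nrm_mul_right, h0, mul_zero, ← C_1, nrm_C f hf, one_pow] at h1
  exact zero_ne_one h1

theorem exists_NF {E : Type*} [Field E] (A B : E[X]) (hA : A ≠ 0) (hB : B ≠ 0) :
    ∃ x y z s t : E[X], Squarefree (x * y * z) ∧ s ≠ 0 ∧ t ≠ 0 ∧ A = -(y * z) * s ^ 2 ∧
      B = - (x * z) * t ^ 2 := by
  classical
  obtain ⟨m, A0, hm, hA0, rfl⟩ := exists_sq_mul_sqf A hA
  obtain ⟨n, B0, hn, hB0, rfl⟩ := exists_sq_mul_sqf B hB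
  obtain ⟨a, b, h1, h2, h3⟩ := extract_gcd A0 B0
  obtain ⟨d, hd⟩ : ∃ d, d = gcd A0 B0 := ⟨_, rfl⟩
  rw [← hd] at h1 h2
  subst h1 h2
  clear hd
  have hab : IsCoprime a b := (gcd_isUnit_iff a b).1 h3
  refine ⟨b, a, -d, m, n, ?_, hm, hn, by ring, by ring⟩
  rw [squarefree_mul_iff] at hA0 hB0 ⊢
  rw [squarefree_mul_iff]
  refine ⟨?_, ⟨hab.symm.isRelPrime, hB0.2.2, hA0.2.2⟩, hA0.2.1.squarefree_of_dvd (by simp)⟩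
  have h1 : IsCoprime d a := isRelPrime_iff_isCoprime.1 hA0.1
  have h2 : IsCoprime d b := isRelPrime_iff_isCoprime.1 hB0.1
  exact (IsCoprime.mul_left h2.symm h1.symm).neg_right.isRelPrime

def Slot {R : Type*} [CommRing R] (A B h : R) : Prop :=
  ∃ a b c w : R, (a ≠ 0 ∨ b ≠ 0 ∨ c ≠ 0 ∨ w ≠ 0) ∧
    A * a ^ 2 + B * b ^ 2 - A * B * c ^ 2 = h * w ^ 2

theorem slot_of_L {E : Type*} [Field E] {x y z s t h : E[X]} (hz : z ≠ 0) (hs : s ≠ 0) (ht : t ≠ 0)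
    (H : ∃ a b c w : E[X], (a ≠ 0 ∨ b ≠ 0 ∨ c ≠ 0 ∨ w ≠ 0) ∧
      y * z * a ^ 2 + x * z * b ^ 2 + x * y * c ^ 2 + h * w ^ 2 = 0) :
    Slot (-(y * z) * s ^ 2) (-(x * z) * t ^ 2) h := by
  obtain ⟨a, b, c, w, h0, h1⟩ := H
  refine ⟨a * t * z, b * s * z, c, w * s * t * z, ?_, ?_⟩
  · simpa [hz, hs, ht] using h0
  · linear_combination (-(s * t * z) ^ 2) * h1

theorem crt2 {R : Type*} [CommRing R] {a b : R} (h : IsCoprime a b) (u v : R) :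
    ∃ c, a ∣ c - u ∧ b ∣ c - v := by
  obtain ⟨m, n, h⟩ := h
  exact ⟨n * b * u + m * a * v, ⟨m * (v - u), by linear_combination u * h⟩,
    ⟨n * (u - v), by linear_combination v * h⟩⟩

theorem nrm_pair {E : Type*} [Field E] (x y : E[X]) (h : IsCoprime x y) (hx : x ≠ 0) (hy : y ≠ 0) :
    ∃ q : E, q ≠ 0 ∧ nrm x y * nrm y x = (-1) ^ (x.natDegree * y.natDegree) *
      x.leadingCoeff ^ y.natDegree * y.leadingCoeff ^ x.natDegree * q ^ 2 := by
  have hr := nrm_recip x y hx hy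
  have h1 := pow_ne_zero y.natDegree (leadingCoeff_ne_zero.2 hx)
  have h2 := nrm_ne_zero y x hy h.symm
  refine ⟨nrm y x / x.leadingCoeff ^ y.natDegree, div_ne_zero h2 h1, ?_⟩
  field_simp
  linear_combination hr

theorem nrm_alpha {E : Type*} [Field E] (x y z k α : E[X]) (hsq : Squarefree (x * y * z * k))
    (hxy : x.natDegree % 2 = y.natDegree % 2) (hxz : x.natDegree % 2 = z.natDegree % 2)
    (hx : x ∣ α - -(y * z)) (hy : y ∣ α - -(x * z)) (hz : z ∣ α - -(x * y)) (hk : k ∣ α - 1) :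
    ∃ u : E, u ≠ 0 ∧ nrm (x * y * z * k) α = u ^ 2 := by
  have h0 := hsq.ne_zero
  simp only [mul_ne_zero_iff] at h0
  obtain ⟨⟨⟨hx0, hy0⟩, hz0⟩, hk0⟩ := h0
  simp only [squarefree_mul_iff, isRelPrime_iff_isCoprime, IsCoprime.mul_left_iff] at hsq
  obtain ⟨_, ⟨⟨cxz, cyz⟩, ⟨cxy, _⟩, _⟩, _⟩ := hsq
  rw [nrm_mul_left _ _ _ (by simp [hx0, hy0, hz0]) hk0, nrm_mul_left _ _ _ (by simp [hx0, hy0]) hz0,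
    nrm_mul_left _ _ _ hx0 hy0, nrm_congr hx, nrm_congr hy, nrm_congr hz, nrm_congr hk]
  have e : ∀ f g g' : E[X], f ≠ 0 → nrm f (-(g * g')) = (-1) ^ f.natDegree * nrm f g * nrm f g' := by
    intro f g g' hf
    rw [show -(g * g') = C (-1) * (g * g') by simp, nrm_mul_right, nrm_mul_right, nrm_C _ hf]; ring
  rw [e x _ _ hx0, e y _ _ hy0, e z _ _ hz0, ← C_1, nrm_C _ hk0, one_pow, mul_one]
  obtain ⟨q1, hq1, e1⟩ := nrm_pair x y cxy hx0 hy0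
  obtain ⟨q2, hq2, e2⟩ := nrm_pair x z cxz hx0 hz0
  obtain ⟨q3, hq3, e3⟩ := nrm_pair y z cyz hy0 hz0
  obtain ⟨m1, hm1⟩ : ∃ m, y.natDegree + z.natDegree = 2 * m := ⟨_, (Nat.two_mul_div_two_of_even (Nat.even_iff.2 (by omega))).symm⟩
  obtain ⟨m2, hm2⟩ : ∃ m, x.natDegree + z.natDegree = 2 * m := ⟨_, (Nat.two_mul_div_two_of_even (Nat.even_iff.2 (by omega))).symm⟩
  obtain ⟨m3, hm3⟩ : ∃ m, x.natDegree + y.natDegree = 2 * m := ⟨_, (Nat.two_mul_div_two_of_even (Nat.even_iff.2 (by omega))).symm⟩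
  have hev : Even (x.natDegree + y.natDegree + z.natDegree + x.natDegree * y.natDegree +
      x.natDegree * z.natDegree + y.natDegree * z.natDegree) := by
    rcases Nat.even_or_odd x.natDegree with h | h
    · have h' : Even y.natDegree := by rw [Nat.even_iff] at *; omega
      have h'' : Even z.natDegree := by rw [Nat.even_iff] at *; omega
      simp [Nat.even_add, Nat.even_mul, h, h', h'']
    · have h' : ¬ Even y.natDegree := by rw [Nat.odd_iff] at h; rw [Nat.even_iff]; omega
      have h'' : ¬ Even z.natDegree := by rw [Nat.odd_iff] at h; rw [Nat.even_iff]; omega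
      have h := Nat.not_even_iff_odd.2 h
      simp [Nat.even_add, Nat.even_mul, h, h', h'']
  have hs := hev.neg_one_pow (α := E)
  have lx := pow_ne_zero m1 (leadingCoeff_ne_zero.2 hx0)
  have ly := pow_ne_zero m2 (leadingCoeff_ne_zero.2 hy0)
  have lz := pow_ne_zero m3 (leadingCoeff_ne_zero.2 hz0)
  have f1 : x.leadingCoeff ^ y.natDegree * x.leadingCoeff ^ z.natDegree = (x.leadingCoeff ^ m1) ^ 2 := by
    rw [← pow_add, hm1, ← pow_mul, mul_comm]
  have f2 : y.leadingCoeff ^ x.natDegree * y.leadingCoeff ^ z.natDegree = (y.leadingCoeff ^ m2) ^ 2 := by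
    rw [← pow_add, hm2, ← pow_mul, mul_comm]
  have f3 : z.leadingCoeff ^ x.natDegree * z.leadingCoeff ^ y.natDegree = (z.leadingCoeff ^ m3) ^ 2 := by
    rw [← pow_add, hm3, ← pow_mul, mul_comm]
  refine ⟨x.leadingCoeff ^ m1 * y.leadingCoeff ^ m2 * z.leadingCoeff ^ m3 * (q1 * q2 * q3),
    by simp [lx, ly, lz, hq1, hq2, hq3, hx0, hy0, hz0], ?_⟩
  calc _ = (-1) ^ x.natDegree * (-1) ^ y.natDegree * (-1) ^ z.natDegree * (nrm x y * nrm y x) *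
        (nrm x z * nrm z x) * (nrm y z * nrm z y) := by ring
    _ = (-1) ^ (x.natDegree + y.natDegree + z.natDegree + x.natDegree * y.natDegree +
      x.natDegree * z.natDegree + y.natDegree * z.natDegree) *
      (x.leadingCoeff ^ y.natDegree * x.leadingCoeff ^ z.natDegree) *
      (y.leadingCoeff ^ x.natDegree * y.leadingCoeff ^ z.natDegree) *
      (z.leadingCoeff ^ x.natDegree * z.leadingCoeff ^ y.natDegree) * (q1 * q2 * q3) ^ 2 := by
        rw [e1, e2, e3]; simp only [pow_add]; ring
    _ = _ := by rw [hs, f1, f2, f3]; ring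

/-- usable form of square-reflexivity -/
theorem IsSquareReflexive.use {E : Type*} [Field E] {h : E[X]} (hr : IsSquareReflexive h) (α : E[X])
    (hα : IsCoprime h α) (hn : ∃ u : E, u ≠ 0 ∧ nrm h α = u ^ 2) :
    ∃ g β s : E[X], IsCoprime h g ∧ IsCoprime h β ∧ h ∣ g - α * β ^ 2 ∧ g ∣ h - s ^ 2 := by
  obtain ⟨u, hu, hn⟩ := hn
  obtain ⟨m, n, hmn⟩ := hα
  let φ := Ideal.Quotient.mk (Ideal.span {h})
  have hφ : ∀ x, φ x = 0 ↔ h ∣ x := fun x => by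
    rw [Ideal.Quotient.eq_zero_iff_mem, Ideal.mem_span_singleton]
  have h1 : φ α * φ n = 1 := by
    rw [← map_mul, ← map_one φ, ← sub_eq_zero, ← map_sub, hφ]
    exact ⟨-m, by linear_combination hmn⟩
  let a : (E[X] ⧸ Ideal.span {h})ˣ := ⟨φ α, φ n, h1, by rw [mul_comm]; exact h1⟩
  obtain ⟨g, hg, ⟨β, hβ⟩, r, hr⟩ := hr.2 a ⟨Units.mk0 u hu, Or.inl hn⟩
  obtain ⟨b, hb⟩ := Ideal.Quotient.mk_surjective (I := Ideal.span {h}) (β : E[X] ⧸ Ideal.span {h})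
  obtain ⟨b', hb'⟩ := Ideal.Quotient.mk_surjective (I := Ideal.span {h}) (β⁻¹.val)
  obtain ⟨s, hs⟩ := Ideal.Quotient.mk_surjective r
  refine ⟨g, b, s, hg, ?_, ?_, ?_⟩
  · have : φ (b * b' - 1) = 0 := by
      change Ideal.Quotient.mk _ _ = 0
      rw [map_sub, map_mul, hb, hb', map_one, Units.mul_inv, sub_self]
    rw [hφ] at this
    obtain ⟨q, hq⟩ := this
    exact ⟨-q, b', by linear_combination hq⟩
  · rw [← hφ]
    change Ideal.Quotient.mk _ _ = 0
    rw [map_sub, hβ, map_mul, map_pow, hb, sub_self]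
  · rw [← Ideal.mem_span_singleton, ← Ideal.Quotient.eq_zero_iff_mem, map_sub, hr, map_pow, hs]
    ring

theorem EV {E : Type*} [Field E] (h2 : (2:E) ≠ 0)
    (hwsr : ∀ f : E[X], Squarefree f → ∃ h : E[X], IsSquareReflexive h ∧ f ∣ h) (hU : UF E) (n : ℕ)
    (A B : Fin n → E[X]) (hA : ∀ i, A i ≠ 0) (hB : ∀ i, B i ≠ 0)
    (hAe : ∀ i, Even (A i).natDegree) (hBe : ∀ i, Even (B i).natDegree)
    (hUP : ∀ i p, Irreducible p → p ∣ A i * B i → UP p) (F0 : E[X]) (hF : F0 ≠ 0) :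
    ∃ h : E[X], Squarefree h ∧ (∀ p, Irreducible p → p ∣ F0 → p ∣ h) ∧ ∀ i, Slot (A i) (B i) h := by
  classical
  obtain ⟨T, hT⟩ : ∃ T, T = X * F0 * ∏ i, (A i * B i) := ⟨_, rfl⟩
  have hT0 : T ≠ 0 := by
    rw [hT]
    refine mul_ne_zero (mul_ne_zero X_ne_zero hF) (Finset.prod_ne_zero_iff.2 fun i _ => mul_ne_zero (hA i) (hB i))
  obtain ⟨h, hr, hh⟩ := hwsr (UniqueFactorizationMonoid.radical T) UniqueFactorizationMonoid.squarefree_radical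
  have hdiv : ∀ f, Squarefree f → f ∣ T → f ∣ h := fun f hf hfT =>
    ((UniqueFactorizationMonoid.dvd_radical_iff hf.isRadical hT0).2 hfT).trans hh
  refine ⟨h, hr.1, fun p hp hpF => hdiv p hp.squarefree ?_, fun i => ?_⟩
  · rw [hT]; exact (hpF.mul_left X).mul_right _
  have hXh : X ∣ h := hdiv X irreducible_X.squarefree (by rw [hT, mul_assoc]; exact dvd_mul_right _ _)
  obtain ⟨x, y, z, s, t, hsq, hs, ht, eA, eB⟩ := exists_NF (A i) (B i) (hA i) (hB i)
  have hd : x * y * z ∣ A i * B i := ⟨z * s ^ 2 * t ^ 2, by rw [eA, eB]; ring⟩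
  have hd' : x * y * z ∣ h := hdiv _ hsq (by
    rw [hT]
    exact (hd.trans (Finset.dvd_prod_of_mem (fun i => A i * B i) (Finset.mem_univ i))).mul_left _)
  obtain ⟨k, rfl⟩ := hd'
  have hsq' := hr.1
  have h0 := hsq.ne_zero
  simp only [mul_ne_zero_iff] at h0
  obtain ⟨⟨hx0, hy0⟩, hz0⟩ := h0
  have hdA := hAe i
  have hdB := hBe i
  rw [eA, natDegree_mul (by simp [hy0, hz0]) (by simp [hs]), natDegree_neg, natDegree_mul hy0 hz0,
    natDegree_pow, Nat.even_iff] at hdA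
  rw [eB, natDegree_mul (by simp [hx0, hz0]) (by simp [ht]), natDegree_neg, natDegree_mul hx0 hz0,
    natDegree_pow, Nat.even_iff] at hdB
  have hsq2 := hsq'
  simp only [squarefree_mul_iff, isRelPrime_iff_isCoprime, IsCoprime.mul_left_iff] at hsq2
  obtain ⟨⟨⟨cxk, cyk⟩, czk⟩, ⟨⟨cxz, cyz⟩, ⟨cxy, _⟩, _⟩, _⟩ := hsq2
  obtain ⟨c1, h11, h12⟩ := crt2 cxy (-(y * z)) (-(x * z))
  obtain ⟨c2, h21, h22⟩ := crt2 (cxz.mul_left cyz) c1 (-(x * y))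
  obtain ⟨α, h31, h32⟩ := crt2 ((cxk.mul_left cyk).mul_left czk) c2 1
  have hαx : x ∣ α - -(y * z) := by
    have e1 : x ∣ α - c2 := (Dvd.intro _ (by ring : x * (y * z) = x * y * z)).trans h31
    have e2 : x ∣ c2 - c1 := (dvd_mul_right _ _).trans h21
    have := dvd_add (dvd_add e1 e2) h11
    convert this using 1; ring
  have hαy : y ∣ α - -(x * z) := by
    have e1 : y ∣ α - c2 := (Dvd.intro _ (by ring : y * (x * z) = x * y * z)).trans h31
    have e2 : y ∣ c2 - c1 := (dvd_mul_left _ _).trans h21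
    have := dvd_add (dvd_add e1 e2) h12
    convert this using 1; ring
  have hαz : z ∣ α - -(x * y) := by
    have e1 : z ∣ α - c2 := (dvd_mul_left _ _).trans h31
    have := dvd_add e1 h22
    convert this using 1; ring
  have cop : ∀ {a b c : E[X]}, a ∣ b - c → IsCoprime a c → IsCoprime a b := by
    rintro a b c ⟨q, hq⟩ ⟨m, n, hmn⟩
    exact ⟨m - n * q, n, by linear_combination hmn + n * hq⟩
  have hcop : IsCoprime (x * y * z * k) α := by
    refine IsCoprime.mul_left (IsCoprime.mul_left (IsCoprime.mul_left ?_ ?_) ?_) ?_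
    · exact cop hαx (cxy.mul_right cxz).neg_right
    · exact cop hαy (cxy.symm.mul_right cyz).neg_right
    · exact cop hαz (cxz.symm.mul_right cyz.symm).neg_right
    · exact cop h32 isCoprime_one_right
  obtain ⟨g, β, r, hg, hβ, hgα, hgr⟩ := hr.use α hcop
    (nrm_alpha x y z k α hsq' (by omega) (by omega) hαx hαy hαz h32)
  have hg0 : g ≠ 0 := by
    rintro rfl
    exact not_isUnit_X (isUnit_of_dvd_unit hXh (isCoprime_zero_right.1 hg))
  have fin : ∀ {a c : E[X]}, a ∣ x * y * z * k → a ∣ α - c → a ∣ g - c * β ^ 2 := by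
    intro a c h1 h2
    have := dvd_add (h1.trans hgα) (h2.mul_right (β ^ 2))
    convert this using 1; ring
  rw [eA, eB]
  refine slot_of_L hz0 hs ht (thmL h2 hU x y z k g r hsq' hg hg0
    (fun p hp hpd => hUP i p hp (hpd.trans hd)) hgr ⟨β, ?_⟩ ⟨β, ?_⟩ ⟨β, ?_⟩ ⟨β, ?_⟩)
  · have := fin ⟨y * z * k, by ring⟩ hαx
    convert this using 1; ring
  · have := fin ⟨x * z * k, by ring⟩ hαy
    convert this using 1; ring
  · have := fin ⟨x * y * k, by ring⟩ hαz
    convert this using 1; ring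
  · have := fin ⟨x * y * z, by ring⟩ h32
    convert this using 1; ring

theorem tern_iso {F : Type*} [Field F] (h2 : (2:F) ≠ 0) (g h s t u v m1 m2 : F[X]) (r : F)
    (hg : g ≠ 0) (hh : h ≠ 0)
    (h1 : h - s ^ 2 = g * m1) (h3 : g - t ^ 2 = h * m2) (huv : u * h + v * g = 1)
    (hr : (g * h).eval r = 0) (hr2 : ¬ (X - C r) ^ 2 ∣ g * h) :
    ∃ x y z : F[X], (x ≠ 0 ∨ y ≠ 0 ∨ z ≠ 0) ∧ x ^ 2 = h * y ^ 2 + g * z ^ 2 := by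
  obtain ⟨p, hp⟩ : ∃ p, p = v ^ 2 * g - 2 * v - m1 * u ^ 2 * h := ⟨_, rfl⟩
  obtain ⟨q, hq⟩ : ∃ q, q = u ^ 2 * h - 2 * u - m2 * v ^ 2 * g := ⟨_, rfl⟩
  have hp' : g * p = s ^ 2 * u ^ 2 * h - 1 := by
    rw [hp]; linear_combination (u * h - v * g + 1) * huv * (-1) + u ^ 2 * h * h1
  have hq' : h * q = t ^ 2 * v ^ 2 * g - 1 := by
    rw [hq]; linear_combination (-1) * (v * g - u * h + 1) * huv + v ^ 2 * g * h3
  obtain ⟨b, hb⟩ : ∃ b, b = s * u * h := ⟨_, rfl⟩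
  obtain ⟨c, hc⟩ : ∃ c, c = t * v * g := ⟨_, rfl⟩
  obtain ⟨d, hd⟩ : ∃ d, d = s * t * u * v := ⟨_, rfl⟩
  have hdet : g * h * (p * q - d ^ 2) - b * (b * q - d * c) + c * (b * d - p * c) = 1 := by
    rw [hb, hc, hd]
    linear_combination (h * q - t ^ 2 * v ^ 2 * g) * hp' + ((s ^ 2 * u ^ 2 * h - 1) - s ^ 2 * u ^ 2 * h) * hq'
  let β : (Fin 3 → F[X]) → (Fin 3 → F[X]) → F[X] := fun x y =>
    (g * h * x 0 + b * x 1 + c * x 2) * y 0 + (b * x 0 + p * x 1 + d * x 2) * y 1 +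
      (c * x 0 + d * x 1 + q * x 2) * y 2
  let B : (Fin 3 → F[X]) →ₗ[F[X]] (Fin 3 → F[X]) →ₗ[F[X]] F[X] := LinearMap.mk₂ F[X] β
    (fun x y z => by simp only [β, Pi.add_apply]; ring)
    (fun x y z => by simp only [β, Pi.smul_apply, smul_eq_mul]; ring)
    (fun x y z => by simp only [β, Pi.add_apply]; ring)
    (fun x y z => by simp only [β, Pi.smul_apply, smul_eq_mul]; ring)
  have hB : ∀ x y, B x y = β x y := fun _ _ => rfl
  obtain ⟨e, k, hk, he, hx⟩ := harder F h2 3 (Fin 3 → F[X]) B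
    (by intro x y; rw [hB, hB]; simp only [β]; ring)
    (by
      intro φ
      obtain ⟨f0, hf0⟩ : ∃ f, f = φ (Pi.single 0 1) := ⟨_, rfl⟩
      obtain ⟨f1, hf1⟩ : ∃ f, f = φ (Pi.single 1 1) := ⟨_, rfl⟩
      obtain ⟨f2, hf2⟩ : ∃ f, f = φ (Pi.single 2 1) := ⟨_, rfl⟩
      refine ⟨![(p * q - d ^ 2) * f0 + (c * d - b * q) * f1 + (b * d - c * p) * f2,
        (c * d - b * q) * f0 + (g * h * q - c ^ 2) * f1 + (b * c - g * h * d) * f2,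
        (b * d - c * p) * f0 + (b * c - g * h * d) * f1 + (g * h * p - b ^ 2) * f2], ?_⟩
      apply LinearMap.pi_ext'
      intro i
      apply LinearMap.ext_ring
      rw [LinearMap.comp_apply, LinearMap.comp_apply, hB]
      fin_cases i
      · simp [β]; rw [← hf0]; linear_combination f0 * hdet
      · simp [β]; rw [← hf1]; linear_combination f1 * hdet
      · simp [β]; rw [← hf2]; linear_combination f2 * hdet)
    (by simp)
  have key : ∀ a : Fin 3 → F, a ≠ 0 → ∑ i, k i * a i ^ 2 = 0 →
    ∃ x y z : F[X], (x ≠ 0 ∨ y ≠ 0 ∨ z ≠ 0) ∧ x ^ 2 = h * y ^ 2 + g * z ^ 2 := by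
    intro a ha0 ha
    obtain ⟨w, hw⟩ : ∃ w, w = ∑ i, C (a i) • e i := ⟨_, rfl⟩
    have h4 : ∀ j, B w (e j) = C (a j) * C (k j) := by
      intro j
      rw [hw, map_sum, LinearMap.sum_apply]
      simp [he]
    have h5 : B w w = 0 := by
      nth_rewrite 2 [hw]
      rw [map_sum]
      simp only [map_smul, h4, smul_eq_mul]
      rw [← C_0, ← ha, map_sum]
      exact Finset.sum_congr rfl fun i _ => by simp; ring
    have hw0 : w ≠ 0 := by
      rintro h0
      apply ha0
      funext j
      have := h4 j
      rw [h0, map_zero, LinearMap.zero_apply, ← C_mul, eq_comm, C_eq_zero, mul_eq_zero] at this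
      exact this.resolve_right (hk j)
    rw [hB] at h5
    simp only [β] at h5
    refine ⟨g * h * w 0 + b * w 1 + c * w 2, w 1, w 2, ?_, ?_⟩
    · by_contra hcon
      push Not at hcon
      obtain ⟨e1, e2, e3⟩ := hcon
      rw [e2, e3] at e1
      simp [hg, hh] at e1
      apply hw0
      funext i
      fin_cases i <;> assumption
    · have f1 : b ^ 2 - h = g * h * p := by rw [hb]; linear_combination (-h) * hp'
      have f2 : c ^ 2 - g = g * h * q := by rw [hc]; linear_combination (-g) * hq'
      have f3 : b * c = g * h * d := by rw [hb, hc, hd]; ring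
      linear_combination g * h * h5 + w 1 ^ 2 * f1 + w 2 ^ 2 * f2 + 2 * w 1 * w 2 * f3
  have hx0 := hx (Pi.single 0 1)
  have h6 : g * h = ∑ i, C (k i)⁻¹ * (B (Pi.single 0 1) (e i)) ^ 2 := by
    have h7 := congrArg (fun z => B (Pi.single 0 1) z) hx0
    simp only [map_sum, map_smul, smul_eq_mul] at h7
    have h8 : B (Pi.single 0 1) (Pi.single 0 1) = g * h := by rw [hB]; simp [β]
    rw [h8] at h7
    rw [h7]
    exact Finset.sum_congr rfl fun i _ => by ring
  by_cases hall : ∀ i, (B (Pi.single 0 1) (e i)).eval r = 0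
  · exfalso
    apply hr2
    rw [h6]
    exact Finset.dvd_sum fun i _ => (pow_dvd_pow_of_dvd (dvd_iff_isRoot.2 (hall i)) 2).mul_left _
  · push Not at hall
    obtain ⟨i0, hi0⟩ := hall
    apply key (fun i => (k i)⁻¹ * (B (Pi.single 0 1) (e i)).eval r)
    · intro h0
      have := congrFun h0 i0
      simp [hk, hi0] at this
    · rw [h6, eval_finset_sum] at hr
      rw [← hr]
      refine Finset.sum_congr rfl fun i _ => ?_
      simp only [eval_mul, eval_C, eval_pow]
      have := hk i
      field_simp

universe u10

theorem quad_ext {E : Type u10} [Field E] (e : E) (he : ∀ r, r ^ 2 ≠ e) :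
    ∃ (L : Type u10) (_ : Field L) (φ : E →+* L) (ε : L), ε ^ 2 = φ e ∧
      (∀ z, ∃ a b, z = φ a + ε * φ b) ∧ ∀ a b, φ a + ε * φ b = 0 → a = 0 ∧ b = 0 := by
  haveI : Fact (∀ r : E, r ^ 2 ≠ e + 0 * r) := ⟨fun r => by simpa using he r⟩
  refine ⟨QuadraticAlgebra E e 0, inferInstance, algebraMap E (QuadraticAlgebra E e 0), ⟨0, 1⟩, ?_, ?_, ?_⟩
  · ext <;> simp [pow_two]
  · intro z
    refine ⟨z.re, z.im, ?_⟩
    ext <;> simp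
  · intro a b h
    have h1 := congrArg QuadraticAlgebra.re h
    have h2 := congrArg QuadraticAlgebra.im h
    simp at h1 h2
    exact ⟨h1, h2⟩

set_option maxHeartbeats 1000000 in
theorem norm_slot {E : Type*} [Field E] (h2 : (2:E) ≠ 0) (e : E) (he : ∀ r, r ^ 2 ≠ e)
    (g h s β A : E[X]) (r : E) (hg : g ≠ 0) (hh : h ≠ 0) (hc : IsCoprime h g) (hA : h ∣ A * (1 - A))
    (h1 : g ∣ h - s ^ 2) (h3 : h ∣ g - (C e * A + (1 - A)) * β ^ 2)
    (hr : (g * h).eval r = 0) (hr2 : ¬ (X - C r) ^ 2 ∣ g * h) :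
    ∃ w x y z : E[X], (w ≠ 0 ∨ x ≠ 0 ∨ y ≠ 0 ∨ z ≠ 0) ∧
      C e * w ^ 2 = h * x ^ 2 + g * y ^ 2 - h * g * z ^ 2 := by
  obtain ⟨L, _, φ, ε, hε, hsur, hinj⟩ := quad_ext e he
  obtain ⟨u, v, huv⟩ := hc
  obtain ⟨m1, h1⟩ := h1
  obtain ⟨n, hn⟩ := hA
  obtain ⟨m2, h3⟩ := h3
  have hmap : ∀ f : E[X], f.map φ = 0 ↔ f = 0 := fun f => Polynomial.map_eq_zero φ
  have hCe : C ε ^ 2 = C (φ e) := by rw [← hε, C_pow]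
  have hpsur : ∀ f : L[X], ∃ a b : E[X], f = a.map φ + C ε * b.map φ := by
    intro f
    induction f using Polynomial.induction_on' with
    | add p q hp hq =>
      obtain ⟨a, b, rfl⟩ := hp
      obtain ⟨a', b', rfl⟩ := hq
      exact ⟨a + a', b + b', by simp only [Polynomial.map_add]; ring⟩
    | monomial n c =>
      obtain ⟨a, b, rfl⟩ := hsur c
      refine ⟨monomial n a, monomial n b, ?_⟩
      rw [map_monomial, map_monomial, C_mul_monomial, ← map_add]
  have hpinj : ∀ a b : E[X], a.map φ + C ε * b.map φ = 0 → a = 0 ∧ b = 0 := by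
    intro a b hab
    have : ∀ n, a.coeff n = 0 ∧ b.coeff n = 0 := by
      intro n
      have := congrArg (fun f => coeff f n) hab
      simp only [coeff_add, coeff_map, coeff_C_mul, coeff_zero] at this
      exact hinj _ _ this
    exact ⟨by ext n; simpa using (this n).1, by ext n; simpa using (this n).2⟩
  obtain ⟨x, y, z, h0, hxyz⟩ := tern_iso (F := L) (by
      intro h; apply h2; apply φ.injective; rw [map_ofNat, map_zero]; exact h) (g.map φ) (h.map φ) (s.map φ)
    ((C ε * A.map φ + (1 - A.map φ)) * β.map φ) (u.map φ) (v.map φ) (m1.map φ)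
    (m2.map φ + (C (φ e) + 1 - 2 * C ε) * n.map φ * β.map φ ^ 2) (φ r)
    (by rwa [Ne, hmap]) (by rwa [Ne, hmap])
    (by have := congrArg (Polynomial.map φ) h1; simpa using this)
    (by
      have e1 := congrArg (Polynomial.map φ) h3
      have e2 := congrArg (Polynomial.map φ) hn
      simp only [Polynomial.map_sub, Polynomial.map_mul, Polynomial.map_add, Polynomial.map_pow,
        Polynomial.map_C, Polynomial.map_one] at e1 e2
      linear_combination e1 - A.map φ ^ 2 * β.map φ ^ 2 * hCe +
        (C (φ e) + 1 - 2 * C ε) * β.map φ ^ 2 * e2)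
    (by have := congrArg (Polynomial.map φ) huv; simpa using this)
    (by rw [← Polynomial.map_mul, eval_map, eval₂_at_apply, hr, map_zero])
    (by
      intro hd
      apply hr2
      rw [← Polynomial.map_dvd_map' φ]
      simpa using hd)
  obtain ⟨x1, x2, rfl⟩ := hpsur x
  obtain ⟨y1, y2, rfl⟩ := hpsur y
  obtain ⟨z1, z2, rfl⟩ := hpsur z
  obtain ⟨hT1, hT2⟩ := hpinj (x1 ^ 2 - h * y1 ^ 2 - g * z1 ^ 2 + C e * (x2 ^ 2 - h * y2 ^ 2 - g * z2 ^ 2))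
    (2 * (x1 * x2 - h * y1 * y2 - g * z1 * z2)) (by
      simp only [Polynomial.map_sub, Polynomial.map_mul, Polynomial.map_add, Polynomial.map_pow,
        Polynomial.map_C, Polynomial.map_ofNat]
      linear_combination hxyz - (x2.map φ ^ 2 - h.map φ * y2.map φ ^ 2 - g.map φ * z2.map φ ^ 2) * hCe)
  have hT3 : x1 * x2 - h * y1 * y2 - g * z1 * z2 = 0 := by
    have : (2 : E[X]) ≠ 0 := by
      rw [← C_ofNat]; exact fun h => h2 (C_eq_zero.1 h)
    exact (mul_eq_zero.1 hT2).resolve_left this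
  by_cases hb : x2 ^ 2 - h * y2 ^ 2 - g * z2 ^ 2 = 0
  · have ha : x1 ^ 2 - h * y1 ^ 2 - g * z1 ^ 2 = 0 := by rw [hb] at hT1; linear_combination hT1
    by_cases hz : x2 ≠ 0 ∨ y2 ≠ 0 ∨ z2 ≠ 0
    · refine ⟨0, g * z2, h * y2, x2, ?_, by linear_combination (h * g) * hb⟩
      rcases hz with h0 | h0 | h0
      · exact Or.inr (Or.inr (Or.inr h0))
      · exact Or.inr (Or.inr (Or.inl (mul_ne_zero hh h0)))
      · exact Or.inr (Or.inl (mul_ne_zero hg h0))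
    · refine ⟨0, g * z1, h * y1, x1, ?_, by linear_combination (h * g) * ha⟩
      push Not at hz
      obtain ⟨rfl, rfl, rfl⟩ := hz
      rw [Polynomial.map_zero, mul_zero, add_zero, add_zero, add_zero, Ne, hmap, Ne, hmap, Ne, hmap] at h0
      rcases h0 with h0 | h0 | h0
      · exact Or.inr (Or.inr (Or.inr h0))
      · exact Or.inr (Or.inr (Or.inl (mul_ne_zero hh h0)))
      · exact Or.inr (Or.inl (mul_ne_zero hg h0))
  · refine ⟨_, x1 * y2 - y1 * x2, z1 * x2 - x1 * z2, y1 * z2 - z1 * y2, Or.inl hb, ?_⟩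
    linear_combination (x2 ^ 2 - h * y2 ^ 2 - g * z2 ^ 2) * hT1 - (x1 * x2 - h * y1 * y2 - g * z1 * z2) * hT3

theorem prim_vec {E : Type*} [Field E] {n : ℕ} (v : Fin n → E[X]) (hv : v ≠ 0) :
    ∃ (d : E[X]) (v' : Fin n → E[X]), d ≠ 0 ∧ (∀ i, v i = d * v' i) ∧
      ∀ p, Irreducible p → ∃ i, ¬ p ∣ v' i := by
  classical
  obtain ⟨i0, hi0⟩ := Function.ne_iff.1 hv
  obtain ⟨v', h1, h2⟩ := Finset.extract_gcd v (s := Finset.univ) ⟨i0, Finset.mem_univ _⟩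
  refine ⟨_, v', ?_, fun i => h1 i (Finset.mem_univ _), ?_⟩
  · intro h0
    apply hi0
    rw [h1 i0 (Finset.mem_univ _), h0, zero_mul]; rfl
  · intro p hp
    by_contra hcon
    push Not at hcon
    have := Finset.dvd_gcd (s := Finset.univ) (f := v') fun i _ => hcon i
    rw [h2] at this
    exact hp.not_isUnit (isUnit_of_dvd_one this)

theorem fmul {E : Type*} [Field E] {p m : E[X]} (hp : Irreducible p) (hm : m ≠ 0) :
    FiniteMultiplicity p m := FiniteMultiplicity.of_prime_left hp.prime hm

theorem mult_mul {E : Type*} [Field E] {p m n : E[X]} (hp : Irreducible p) (hm : m ≠ 0) (hn : n ≠ 0) :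
    multiplicity p (m * n) = multiplicity p m + multiplicity p n :=
  multiplicity_mul hp.prime (fmul hp (mul_ne_zero hm hn))

theorem mult_sq {E : Type*} [Field E] {p m n : E[X]} (hp : Irreducible p) (hm : m ≠ 0) (hn : n ≠ 0) :
    multiplicity p (m ^ 2 * n) = 2 * multiplicity p m + multiplicity p n := by
  rw [pow_two, mult_mul hp (mul_ne_zero hm hm) hn, mult_mul hp hm hm]; ring

theorem anis_even {E : Type*} [Field E] {p : E[X]} (hp : Irreducible p) (a b : E[X])
    (hab : ∀ s t, p ∣ a * s ^ 2 + b * t ^ 2 → p ∣ s ∧ p ∣ t) (N : ℕ) : ∀ x y : E[X],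
    multiplicity p (a * x ^ 2 + b * y ^ 2) = N → a * x ^ 2 + b * y ^ 2 ≠ 0 → Even N := by
  induction N using Nat.strong_induction_on with
  | _ N ih =>
  intro x y hN h0
  by_cases hd : p ∣ a * x ^ 2 + b * y ^ 2
  · obtain ⟨⟨x', rfl⟩, ⟨y', rfl⟩⟩ := hab _ _ hd
    have e : a * (p * x') ^ 2 + b * (p * y') ^ 2 = p ^ 2 * (a * x' ^ 2 + b * y' ^ 2) := by ring
    rw [e] at hN h0
    have h1 : a * x' ^ 2 + b * y' ^ 2 ≠ 0 := right_ne_zero_of_mul h0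
    rw [mult_sq hp hp.ne_zero h1, multiplicity_self] at hN
    have := ih _ (by omega) x' y' rfl h1
    rw [← hN]
    exact (even_two_mul _).add this
  · rw [multiplicity_eq_zero.2 hd] at hN
    rw [← hN]; exact Even.zero

/-- nonzero norms `x² - e y²` -/
def Nm {E : Type*} [Field E] (e t : E) : Prop := t ≠ 0 ∧ ∃ x y, t = x ^ 2 - e * y ^ 2

theorem Nm.mul {E : Type*} [Field E] {e s t : E} (hs : Nm e s) (ht : Nm e t) : Nm e (s * t) := by
  obtain ⟨h1, x, y, rfl⟩ := hs
  obtain ⟨h2, z, w, rfl⟩ := ht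
  exact ⟨mul_ne_zero h1 h2, x * z + e * y * w, x * w + y * z, by ring⟩

theorem Nm.sq {E : Type*} [Field E] (e : E) {s : E} (hs : s ≠ 0) : Nm e (s ^ 2) :=
  ⟨pow_ne_zero 2 hs, s, 0, by ring⟩

theorem Nm.of_sq_mul {E : Type*} [Field E] {e s t : E} (hs : s ≠ 0) (h : Nm e (s ^ 2 * t)) : Nm e t := by
  have := h.mul (Nm.sq e (inv_ne_zero hs))
  convert this using 1
  field_simp

theorem Nm.of_mul {E : Type*} [Field E] {e s t : E} (hs : Nm e s) (h : Nm e (s * t)) : Nm e t := by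
  apply Nm.of_sq_mul hs.1
  have := hs.mul h
  convert this using 1
  ring

theorem eval_norm {E : Type*} [Field E] (e : E) (he : ∀ r, r ^ 2 ≠ e) (N : ℕ) : ∀ m : E[X],
    m.natDegree = N → m ≠ 0 →
    (∀ p, Irreducible p → (∀ z, ¬ p ∣ z ^ 2 - C e) → Even (multiplicity p m)) →
    ∀ r r', m.eval r ≠ 0 → m.eval r' ≠ 0 → Nm e (m.eval r * m.eval r') := by
  induction N using Nat.strong_induction_on with
  | _ N ih =>
  intro m hN hm hev r r' hr hr'
  by_cases hu : IsUnit m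
  · obtain ⟨c, hc, rfl⟩ := isUnit_iff.1 hu
    simp only [eval_C] at *
    rw [← pow_two]
    exact Nm.sq e hr
  obtain ⟨p, hp, m2, rfl⟩ := WfDvdMonoid.exists_irreducible_factor hu hm
  have hm2 : m2 ≠ 0 := right_ne_zero_of_mul hm
  have hpd := hp.natDegree_pos
  rw [natDegree_mul hp.ne_zero hm2] at hN
  rw [eval_mul, mul_ne_zero_iff] at hr hr'
  by_cases hin : ∀ z, ¬ p ∣ z ^ 2 - C e
  · have h1 := hev p hp hin
    rw [mult_mul hp hp.ne_zero hm2, multiplicity_self] at h1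
    have hd : p ∣ m2 := by
      by_contra hd
      rw [multiplicity_eq_zero.2 hd] at h1
      simp at h1
    obtain ⟨m3, rfl⟩ := hd
    have hm3 : m3 ≠ 0 := right_ne_zero_of_mul hm2
    rw [natDegree_mul hp.ne_zero hm3] at hN
    rw [eval_mul, mul_ne_zero_iff] at hr hr'
    have := ih m3.natDegree (by omega) m3 rfl hm3 (by
      intro q hq hqi
      have := hev q hq hqi
      rw [show p * (p * m3) = p ^ 2 * m3 by ring, mult_sq hq hp.ne_zero hm3, Nat.even_add] at this
      exact this.1 (even_two_mul _)) r r' hr.2.2 hr'.2.2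
    have := (Nm.sq e (mul_ne_zero hr.1 hr'.1)).mul this
    convert this using 1
    simp only [eval_mul]; ring
  · push Not at hin
    obtain ⟨z0, hz0⟩ := hin
    obtain ⟨z, hz⟩ : ∃ z, z = z0 % p := ⟨_, rfl⟩
    have hzd : z.degree < p.degree := by rw [hz]; exact EuclideanDomain.mod_lt _ hp.ne_zero
    have hzp : p ∣ z ^ 2 - C e := by
      have h1 : z0 = z + p * (z0 / p) := by rw [hz]; exact (EuclideanDomain.mod_add_div _ _).symm
      rw [h1] at hz0
      have := dvd_sub hz0 (dvd_mul_right p ((z0 / p) * (2 * z + p * (z0 / p))))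
      convert this using 1; ring
    obtain ⟨m', hm'⟩ := hzp
    have hze : ∀ a, z.eval a ^ 2 - e ≠ 0 := fun a h => he _ (sub_eq_zero.1 h)
    have hzev : ∀ a, z.eval a ^ 2 - e = p.eval a * m'.eval a := by
      intro a
      have := congrArg (eval a) hm'
      simpa using this
    have hm0 : m' ≠ 0 := by
      rintro rfl
      exact hze r (by rw [hzev]; simp)
    have hdeg : m'.natDegree < p.natDegree := by
      have h1 : (p * m').natDegree ≤ 2 * z.natDegree := by
        rw [← hm', natDegree_sub_C]
        exact natDegree_pow_le
      rw [natDegree_mul hp.ne_zero hm0] at h1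
      have h2 : z.natDegree < p.natDegree := by
        by_cases hz00 : z = 0
        · rw [hz00, natDegree_zero]; exact hpd
        · exact natDegree_lt_natDegree hz00 hzd
      omega
    have hme : ∀ a, m'.eval a ≠ 0 := fun a h => hze a (by rw [hzev, h, mul_zero])
    have i1 := ih m'.natDegree (by omega) m' rfl hm0 (by
      intro q hq hqi
      rw [multiplicity_eq_zero.2 fun hd => hqi z (hm' ▸ hd.mul_left p)]
      exact Even.zero) r r' (hme r) (hme r')
    have i2 := ih m2.natDegree (by omega) m2 rfl hm2 (by
      intro q hq hqi
      have := hev q hq hqi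
      rw [mult_mul hq hp.ne_zero hm2, multiplicity_eq_zero.2 fun hd => hqi z
        (hm' ▸ hd.mul_right m'), zero_add] at this
      exact this) r r' hr.2 hr'.2
    have i3 : ∀ a, Nm e (p.eval a * m'.eval a) := fun a => by
      rw [← hzev a]
      exact ⟨hze a, _, 1, by ring⟩
    have i4 : Nm e (p.eval r * p.eval r') := by
      apply Nm.of_mul i1
      have := (i3 r).mul (i3 r')
      convert this using 1; ring
    have := i4.mul i2
    convert this using 1
    simp only [eval_mul]; ring

theorem inert_h {E : Type*} [Field E] {p h s e : E[X]} (hp : Irreducible p) (hin : ∀ z, ¬ p ∣ z ^ 2 - e)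
    (hph : ¬ p ∣ h) (hs : p ∣ h - s ^ 2) (a b : E[X]) (hd : p ∣ e * a ^ 2 - h * b ^ 2) : p ∣ a ∧ p ∣ b := by
  have hd' : p ∣ e * a ^ 2 - s ^ 2 * b ^ 2 := by
    have := dvd_add hd (hs.mul_right (b ^ 2))
    convert this using 1; ring
  have ha : p ∣ a := by
    by_contra ha
    obtain ⟨v, hv⟩ := exists_inv_mod hp ha
    apply hin (s * b * v)
    have := dvd_add (hd'.mul_right (-(v ^ 2))) (hv.mul_right ((v * a + 1) * e))
    convert this using 1; ring
  refine ⟨ha, ?_⟩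
  have h1 : p ∣ s ^ 2 * b ^ 2 := by
    have := dvd_sub ((dvd_pow ha two_ne_zero).mul_left e) hd'
    convert this using 1; ring
  rcases hp.prime.dvd_or_dvd h1 with h | h
  · exact absurd (by have := dvd_add hs h; convert this using 1; ring) hph
  · exact hp.prime.dvd_of_dvd_pow h

theorem nonsq_h {E : Type*} [Field E] {p h : E[X]} (hp : Irreducible p) (hin : ∀ z, ¬ p ∣ h - z ^ 2)
    (a b : E[X]) (hd : p ∣ a ^ 2 - h * b ^ 2) : p ∣ a ∧ p ∣ b := by
  have hb : p ∣ b := by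
    by_contra hb
    obtain ⟨v, hv⟩ := exists_inv_mod hp hb
    apply hin (a * v)
    have := dvd_add (hd.mul_right (-(v ^ 2))) (hv.mul_right (-(v * b + 1) * h))
    convert this using 1; ring
  refine ⟨hp.prime.dvd_of_dvd_pow (n := 2) ?_, hb⟩
  have := dvd_add hd ((dvd_pow hb two_ne_zero).mul_left h)
  convert this using 1; ring

theorem theta_lemma {E : Type*} [Field E] {p e h h' g β w x y z : E[X]} (hp : Irreducible p)
    (hin : ∀ z, ¬ p ∣ z ^ 2 - e) (hh : h = p * h') (hh' : ¬ p ∣ h') (hg : ¬ p ∣ g) (hβ : ¬ p ∣ β)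
    (hgβ : p ∣ g - e * β ^ 2) (heq : e * w ^ 2 = h * x ^ 2 + g * y ^ 2 - h * g * z ^ 2)
    (hprim : ¬ (p ∣ w ∧ p ∣ x ∧ p ∣ y ∧ p ∣ z)) : ¬ p ∣ e * w ^ 2 - h * x ^ 2 := by
  intro hd
  have he : ¬ p ∣ e := fun h => hin 0 (by simpa using h)
  have hw : p ∣ w := by
    have : p ∣ e * w ^ 2 := by
      have := dvd_add hd ((dvd_mul_right p h').mul_right (x ^ 2))
      rw [← hh] at this
      convert this using 1; ring
    exact hp.prime.dvd_of_dvd_pow ((hp.prime.dvd_or_dvd this).resolve_left he)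
  have hy : p ∣ y := by
    have : p ∣ g * y ^ 2 := by
      rw [show g * y ^ 2 = e * w ^ 2 - p * (h' * (x ^ 2 - g * z ^ 2)) by rw [heq, hh]; ring]
      exact dvd_sub ((dvd_pow hw two_ne_zero).mul_left _) (dvd_mul_right _ _)
    exact hp.prime.dvd_of_dvd_pow ((hp.prime.dvd_or_dvd this).resolve_left hg)
  obtain ⟨w1, rfl⟩ := hw
  obtain ⟨y1, rfl⟩ := hy
  have h1 : h' * (x ^ 2 - g * z ^ 2) = p * (e * w1 ^ 2 - g * y1 ^ 2) := by
    apply mul_left_cancel₀ hp.ne_zero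
    rw [hh] at heq
    linear_combination (-1) * heq
  have h3 : p ∣ x ^ 2 - g * z ^ 2 := (hp.prime.dvd_or_dvd ⟨_, h1⟩).resolve_left hh'
  have h4 : p ∣ e * (β * z) ^ 2 - 1 * x ^ 2 := by
    have := dvd_add (h3.mul_left (-1)) (hgβ.mul_left (-z ^ 2))
    convert this using 1; ring
  obtain ⟨h5, h6⟩ := inert_h (s := 1) hp hin hp.prime.not_dvd_one (by simp) _ _ h4
  exact hprim ⟨dvd_mul_right _ _, h6, dvd_mul_right _ _, (hp.prime.dvd_or_dvd h5).resolve_left hβ⟩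

theorem k_lemma {E : Type*} [Field E] {p e h h' g β w x y z : E[X]} (hp : Irreducible p)
    (hin : ∀ z, ¬ p ∣ z ^ 2 - e) (hh : h = p * h') (hh' : ¬ p ∣ h') (hg : ¬ p ∣ g)
    (hgβ : p ∣ g - β ^ 2) (heq : e * w ^ 2 = h * x ^ 2 + g * y ^ 2 - h * g * z ^ 2)
    (hprim : ¬ (p ∣ w ∧ p ∣ x ∧ p ∣ y ∧ p ∣ z)) :
    ∃ κ, e * w ^ 2 - h * x ^ 2 = p * κ ∧ ¬ p ∣ κ ∧ p ∣ κ + h' * x ^ 2 := by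
  have h0 : p ∣ e * w ^ 2 - g * y ^ 2 := ⟨h' * (x ^ 2 - g * z ^ 2), by rw [heq, hh]; ring⟩
  obtain ⟨⟨w1, rfl⟩, ⟨y1, rfl⟩⟩ := inert_h hp hin hg hgβ _ _ h0
  have h1 : h' * (x ^ 2 - g * z ^ 2) = p * (e * w1 ^ 2 - g * y1 ^ 2) := by
    apply mul_left_cancel₀ hp.ne_zero
    rw [hh] at heq
    linear_combination (-1) * heq
  have h3 : p ∣ x ^ 2 - g * z ^ 2 := (hp.prime.dvd_or_dvd ⟨_, h1⟩).resolve_left hh'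
  have hx : ¬ p ∣ x := by
    intro hx
    have : p ∣ g * z ^ 2 := by
      have := dvd_sub (dvd_pow hx two_ne_zero) h3
      convert this using 1; ring
    exact hprim ⟨dvd_mul_right _ _, hx, dvd_mul_right _ _,
      hp.prime.dvd_of_dvd_pow ((hp.prime.dvd_or_dvd this).resolve_left hg)⟩
  refine ⟨e * p * w1 ^ 2 - h' * x ^ 2, by rw [hh]; ring, fun hd => ?_, ⟨e * w1 ^ 2, by ring⟩⟩
  have : p ∣ h' * x ^ 2 := by
    have := dvd_sub (dvd_mul_right p (e * w1 ^ 2)) hd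
    convert this using 1; ring
  rcases hp.prime.dvd_or_dvd this with h | h
  · exact hh' h
  · exact hx (hp.prime.dvd_of_dvd_pow h)

theorem sqf_cop {E : Type*} [Field E] {a b : E[X]} (h : Squarefree (a * b)) : IsCoprime a b :=
  isRelPrime_iff_isCoprime.1 (squarefree_mul_iff.1 h).1

theorem cop_nd {E : Type*} [Field E] {p a b : E[X]} (hp : Irreducible p) (h : IsCoprime a b) (hd : p ∣ a) :
    ¬ p ∣ b := fun h' => hp.not_isUnit (h.isUnit_of_dvd' hd h')

theorem sqf_lin {E : Type*} [Field E] (a b c d : E) (hab : a ≠ b) (hac : a ≠ c) (had : a ≠ d) (hbc : b ≠ c)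
    (hbd : b ≠ d) (hcd : c ≠ d) :
    Squarefree ((X - C a) * (X - C b) * ((X - C c) * (X - C d)) : E[X]) := by
  have cp : ∀ {a b : E}, a ≠ b → IsCoprime (X - C a) (X - C b : E[X]) := fun h =>
    isCoprime_X_sub_C_of_isUnit_sub (sub_ne_zero.2 h).isUnit
  have sq : ∀ a : E, Squarefree (X - C a : E[X]) := fun a => (irreducible_X_sub_C a).squarefree
  rw [squarefree_mul_iff, squarefree_mul_iff, squarefree_mul_iff]
  exact ⟨(((cp hac).mul_right (cp had)).mul_left ((cp hbc).mul_right (cp hbd))).isRelPrime,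
    ⟨(cp hab).isRelPrime, sq a, sq b⟩, ⟨(cp hcd).isRelPrime, sq c, sq d⟩⟩

set_option maxHeartbeats 1000000 in
theorem III_main {E : Type*} [Field E] (h2 : (2:E) ≠ 0)
    (hwsr : ∀ f : E[X], Squarefree f → ∃ h : E[X], IsSquareReflexive h ∧ f ∣ h)
    (e : E) (he : ∀ r, r ^ 2 ≠ e) (a b r1 r2 : E) (hab : a ≠ b) (har1 : a ≠ r1) (har2 : a ≠ r2)
    (hbr1 : b ≠ r1) (hbr2 : b ≠ r2) (hr : r1 ≠ r2) :
    Nm e (((r1 - a) * (r1 - b)) * ((r2 - a) * (r2 - b))) := by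
  have he0 : e ≠ 0 := fun h => he 0 (by rw [h]; ring)
  obtain ⟨h, hh, hdv⟩ := hwsr _ (sqf_lin a b r1 r2 hab har1 har2 hbr1 hbr2 hr)
  obtain ⟨P, hP⟩ : ∃ P : E[X], P = (X - C a) * (X - C b) := ⟨_, rfl⟩
  obtain ⟨k', hk'⟩ := hdv
  rw [← hP] at hk'
  obtain ⟨k, hk⟩ : ∃ k : E[X], k = (X - C r1) * (X - C r2) * k' := ⟨_, rfl⟩
  have hPk : h = P * k := by rw [hk', hk]; ring
  have hsq := hh.1
  have h0 := hsq.ne_zero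
  have hP0 : P ≠ 0 := by rintro rfl; simp [hPk] at h0
  have hk0 : k ≠ 0 := by rintro rfl; simp [hPk] at h0
  have hPd : P.natDegree = 2 := by
    rw [hP, natDegree_mul (X_sub_C_ne_zero _) (X_sub_C_ne_zero _)]; simp
  have hcPk : IsCoprime P k := sqf_cop (hPk ▸ hsq)
  obtain ⟨A, hA1, hA2⟩ := crt2 hcPk 1 0
  rw [sub_zero] at hA2
  have hαP : P ∣ (C e * A + (1 - A)) - C e := by
    have := hA1.mul_left (C e - 1)
    convert this using 1; ring
  have hαk : k ∣ (C e * A + (1 - A)) - C 1 := by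
    have := hA2.mul_left (C e - 1)
    convert this using 1; rw [C_1]; ring
  have cop : ∀ {a : E[X]} {c : E} {b : E[X]}, c ≠ 0 → a ∣ b - C c → IsCoprime a b := by
    rintro a c b hc ⟨q, hq⟩
    refine ⟨-C c⁻¹ * q, C c⁻¹, ?_⟩
    have : C c⁻¹ * C c = 1 := by rw [← C_mul, inv_mul_cancel₀ hc, C_1]
    linear_combination C c⁻¹ * hq + this
  obtain ⟨g, β, s, hg, hβ, hgα, hgs⟩ := hh.use (C e * A + (1 - A))
    (by rw [hPk]; exact (cop he0 hαP).mul_left (cop one_ne_zero hαk))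
    ⟨e, he0, by rw [hPk, nrm_mul_left _ _ _ hP0 hk0, nrm_congr hαP, nrm_congr hαk, nrm_C _ hP0,
      nrm_C _ hk0, hPd]; simp⟩
  have iL : ∀ c : E, Irreducible (X - C c) := irreducible_X_sub_C
  have nL : ∀ (c : E) (z : E[X]), ¬ (X - C c) ∣ z ^ 2 - C e := by
    intro c z hd
    rw [dvd_iff_isRoot, IsRoot, eval_sub, eval_pow, eval_C, sub_eq_zero] at hd
    exact he _ hd
  have dP : (X - C a) ∣ P := hP ▸ dvd_mul_right _ _
  have dr1 : (X - C r1) ∣ k := by rw [hk, mul_assoc]; exact dvd_mul_right _ _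
  have dr2 : (X - C r2) ∣ k := by rw [hk, mul_assoc]; exact (dvd_mul_right _ _).mul_left _
  have Ph : P ∣ h := hPk ▸ dvd_mul_right _ _
  have kh : k ∣ h := hPk ▸ dvd_mul_left _ _
  have hg0 : g ≠ 0 := by
    rintro rfl
    exact (iL a).not_isUnit (isUnit_of_dvd_unit (dP.trans Ph) (isCoprime_zero_right.1 hg))
  have hnd : ∀ p h', Irreducible p → h = p * h' → ¬ p ∣ h' := by
    rintro p h' hp hph ⟨q, rfl⟩
    exact hp.not_isUnit (hsq p ⟨q, by rw [hph]; ring⟩)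
  obtain ⟨w0, x0, y0, z0, hne, heq0⟩ := norm_slot h2 e he g h s β A r1 hg0 h0 hg
    (by rw [hPk]
        obtain ⟨q1, hq1⟩ := hA1
        obtain ⟨q2, hq2⟩ := hA2
        exact ⟨-q1 * q2, by linear_combination (-P * q1) * hq2 - A * hq1⟩) hgs hgα
    (by rw [eval_mul, (dvd_iff_isRoot.1 (dr1.trans kh) : h.eval r1 = 0), mul_zero])
    (by
      intro hd
      obtain ⟨q, hq⟩ := dr1.trans kh
      have : (X - C r1) ∣ g * q := by
        apply (mul_dvd_mul_iff_left (X_sub_C_ne_zero r1)).1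
        rw [← pow_two]
        convert hd using 1
        rw [hq]; ring
      rcases (iL r1).prime.dvd_or_dvd this with h' | h'
      · exact cop_nd (iL r1) hg (dr1.trans kh) h'
      · exact hnd _ _ (iL r1) hq h')
  obtain ⟨d, v, hd0, hv, hprim⟩ := prim_vec ![w0, x0, y0, z0] (by
    intro h
    have i0 := congrFun h 0
    have i1 := congrFun h 1
    have i2 := congrFun h 2
    have i3 := congrFun h 3
    simp at i0 i1 i2 i3
    simp [i0, i1, i2, i3] at hne)
  obtain ⟨w, hw⟩ : ∃ w, w = v 0 := ⟨_, rfl⟩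
  obtain ⟨x, hx⟩ : ∃ w, w = v 1 := ⟨_, rfl⟩
  obtain ⟨y, hy⟩ : ∃ w, w = v 2 := ⟨_, rfl⟩
  obtain ⟨z, hz⟩ : ∃ w, w = v 3 := ⟨_, rfl⟩
  have ew : w0 = d * w := by rw [hw]; simpa using hv 0
  have ex : x0 = d * x := by rw [hx]; simpa using hv 1
  have ey : y0 = d * y := by rw [hy]; simpa using hv 2
  have ez : z0 = d * z := by rw [hz]; simpa using hv 3
  have heq : C e * w ^ 2 = h * x ^ 2 + g * y ^ 2 - h * g * z ^ 2 := by
    apply mul_left_cancel₀ (pow_ne_zero 2 hd0)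
    rw [ew, ex, ey, ez] at heq0
    linear_combination heq0
  have hpr : ∀ p, Irreducible p → ¬ (p ∣ w ∧ p ∣ x ∧ p ∣ y ∧ p ∣ z) := by
    rintro p hp ⟨e1, e2, e3, e4⟩
    obtain ⟨i, hi⟩ := hprim p hp
    rw [hw] at e1; rw [hx] at e2; rw [hy] at e3; rw [hz] at e4
    fin_cases i
    · exact hi e1
    · exact hi e2
    · exact hi e3
    · exact hi e4
  clear hprim hv hw hx hy hz ew ex ey ez heq0 hne
  obtain ⟨κ, hκ⟩ : ∃ κ, κ = C e * w ^ 2 - h * x ^ 2 := ⟨_, rfl⟩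
  have tP : ∀ p, Irreducible p → (∀ z, ¬ p ∣ z ^ 2 - C e) → p ∣ P → ¬ p ∣ κ := by
    intro p hp hin hpP
    obtain ⟨h', hh'⟩ := hpP.trans Ph
    rw [hκ]
    refine theta_lemma hp hin hh' (hnd _ _ hp hh') (cop_nd hp hg (hpP.trans Ph))
      (cop_nd hp hβ (hpP.trans Ph)) ?_ heq (hpr p hp)
    have := dvd_add ((hpP.trans Ph).trans hgα) ((hpP.trans hαP).mul_right (β ^ 2))
    convert this using 1; ring
  have tk : ∀ p, Irreducible p → (∀ z, ¬ p ∣ z ^ 2 - C e) → p ∣ k → ∀ h', h = p * h' → ¬ p ∣ h' ∧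
      ∃ κ', κ = p * κ' ∧ ¬ p ∣ κ' ∧ p ∣ κ' + h' * x ^ 2 := by
    intro p hp hin hpk h' hh'
    refine ⟨hnd _ _ hp hh', ?_⟩
    rw [hκ]
    refine k_lemma (β := β) hp hin hh' (hnd _ _ hp hh') (cop_nd hp hg (hpk.trans kh)) ?_ heq (hpr p hp)
    have := dvd_add ((hpk.trans kh).trans hgα) ((hpk.trans hαk).mul_right (β ^ 2))
    convert this using 1; rw [C_1]; ring
  have hκ0 : κ ≠ 0 := by
    intro h
    exact tP _ (iL a) (nL a) dP (h ▸ dvd_zero _)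
  have hκ2 : κ = g * (1 * y ^ 2 + (-h) * z ^ 2) := by rw [hκ, heq]; ring
  have hev : ∀ p, Irreducible p → (∀ z, ¬ p ∣ z ^ 2 - C e) → ¬ p ∣ P → Even (multiplicity p (h * κ)) := by
    intro p hp hin hpP
    rw [mult_mul hp h0 hκ0]
    by_cases hph : p ∣ h
    · have hpk : p ∣ k := (hp.prime.dvd_or_dvd (hPk ▸ hph)).resolve_left hpP
      obtain ⟨h', hh'⟩ := hph
      obtain ⟨n1, κ', e1, n2, -⟩ := tk p hp hin hpk h' hh'
      have n3 : h' ≠ 0 := by rintro rfl; simp at n1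
      have n4 : κ' ≠ 0 := by rintro rfl; simp at n2
      rw [hh', e1, mult_mul hp hp.ne_zero n3, mult_mul hp hp.ne_zero n4, multiplicity_self,
        multiplicity_eq_zero.2 n1, multiplicity_eq_zero.2 n2]
      exact ⟨1, rfl⟩
    · rw [multiplicity_eq_zero.2 hph, zero_add]
      by_cases hs : ∃ s, p ∣ h - s ^ 2
      · obtain ⟨s, hs⟩ := hs
        have e1 : κ = C e * w ^ 2 + (-h) * x ^ 2 := by rw [hκ]; ring
        rw [e1] at hκ0 ⊢
        refine anis_even hp (C e) (-h) ?_ _ w x rfl hκ0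
        intro a b hd
        exact inert_h hp hin hph hs a b (by convert hd using 1; ring)
      · push Not at hs
        have hpg : ¬ p ∣ g := fun hd => hs s (hd.trans hgs)
        rw [hκ2] at hκ0 ⊢
        rw [mult_mul hp hg0 (right_ne_zero_of_mul hκ0), multiplicity_eq_zero.2 hpg, zero_add]
        refine anis_even hp 1 (-h) ?_ _ y z rfl (right_ne_zero_of_mul hκ0)
        intro a b hd
        exact nonsq_h hp hs a b (by convert hd using 1; ring)
  -- values at the roots
  have hr12 : r1 - r2 ≠ 0 := sub_ne_zero.2 hr
  have hr21 : r2 - r1 ≠ 0 := sub_ne_zero.2 hr.symm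
  obtain ⟨n1, κ1, e1, m1, f1⟩ := tk _ (iL r1) (nL r1) dr1 (P * ((X - C r2) * k')) (by rw [hk']; ring)
  obtain ⟨n2, κ2, e2, m2, f2⟩ := tk _ (iL r2) (nL r2) dr2 (P * ((X - C r1) * k')) (by rw [hk']; ring)
  have hd2 : (X - C r2) ∣ κ1 := by
    have : (X - C r2) ∣ (X - C r1) * κ1 := e1 ▸ e2 ▸ dvd_mul_right _ _
    refine ((iL r2).prime.dvd_or_dvd this).resolve_left ?_
    rw [dvd_iff_isRoot, IsRoot]; simpa using hr21
  obtain ⟨κ3, rfl⟩ := hd2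
  have e3 : κ2 = (X - C r1) * κ3 := by
    apply mul_left_cancel₀ (X_sub_C_ne_zero r2)
    rw [← e2, e1]; ring
  rw [dvd_iff_isRoot, IsRoot] at n1 n2 m1 m2 f1 f2
  rw [e3] at m2 f2
  simp only [eval_mul, eval_add, eval_sub, eval_X, eval_C, eval_pow, mul_eq_zero, not_or] at n1 n2 m1 m2 f1 f2
  have v1 : κ3.eval r1 = - (P.eval r1 * k'.eval r1 * x.eval r1 ^ 2) := by
    apply mul_left_cancel₀ hr12; linear_combination f1
  have v2 : κ3.eval r2 = - (P.eval r2 * k'.eval r2 * x.eval r2 ^ 2) := by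
    apply mul_left_cancel₀ hr21; linear_combination f2
  have hκ3 : κ3 ≠ 0 := by rintro rfl; simp at m1
  have hk'0 : k' ≠ 0 := by rintro rfl; simp at n1
  have fin := eval_norm e he _ (-(k' * κ3)) rfl (neg_ne_zero.2 (mul_ne_zero hk'0 hκ3)) (by
    intro p hp hin
    by_cases hpP : p ∣ P
    · rw [multiplicity_eq_zero.2]
      · exact Even.zero
      · rw [dvd_neg]
        intro hd
        rcases hp.prime.dvd_or_dvd hd with hd | hd
        · exact cop_nd hp hcPk hpP (hk ▸ hd.mul_left _)
        · exact tP p hp hin hpP (by rw [e1]; exact (hd.mul_left _).mul_left _)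
    · have := hev p hp hin hpP
      rw [hk', e1, show P * ((X - C r1) * (X - C r2)) * k' * ((X - C r1) * ((X - C r2) * κ3)) =
        ((X - C r1) * (X - C r2)) ^ 2 * (P * -(-(k' * κ3))) by ring,
        mult_sq hp (mul_ne_zero (X_sub_C_ne_zero _) (X_sub_C_ne_zero _))
          (mul_ne_zero hP0 (neg_ne_zero.2 (neg_ne_zero.2 (mul_ne_zero hk'0 hκ3)))), mult_mul hp hP0
          (neg_ne_zero.2 (neg_ne_zero.2 (mul_ne_zero hk'0 hκ3))), multiplicity_eq_zero.2 hpP, zero_add,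
          Nat.even_add, multiplicity_neg] at this
      exact this.1 (even_two_mul _)) r1 r2 (by simp [n1.2.2, m1.2]) (by simp [n2.2.2, m2.2])
  simp only [eval_neg, eval_mul, v1, v2] at fin
  rw [v1] at m1
  rw [v2] at m2
  simp at m1 m2
  apply Nm.of_sq_mul (s := k'.eval r1 * k'.eval r2 * x.eval r1 * x.eval r2) (by
    simp [m1.2.1.2, m2.2.1.2, m1.2.2, m2.2.2])
  convert fin using 1
  rw [hP]; simp; ring

theorem UF_inf {E : Type*} [Field E] [Infinite E] (h2 : (2:E) ≠ 0)
    (hwsr : ∀ f : E[X], Squarefree f → ∃ h : E[X], IsSquareReflexive h ∧ f ∣ h) : UF E := by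
  classical
  have hN : ∀ e t : E, e ≠ 0 → t ≠ 0 → Nm e t := by
    intro e t he ht
    by_cases hs : ∃ r, r ^ 2 = e
    · obtain ⟨f, rfl⟩ := hs
      have hf : f ≠ 0 := by rintro rfl; simp at he
      exact ⟨ht, (t + 1) / 2, (t - 1) / (2 * f), by field_simp; ring⟩
    · push Not at hs
      by_cases ht1 : t = 1
      · exact ⟨ht, 1, 0, by rw [ht1]; ring⟩
      obtain ⟨v, hv⟩ := Infinite.exists_notMem_finset
        (((X * (X ^ 2 - C 1) * (X ^ 2 - C t) : E[X])).roots.toFinset)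
      rw [Multiset.mem_toFinset, mem_roots (by
        refine mul_ne_zero (mul_ne_zero X_ne_zero (X_pow_sub_C_ne_zero two_pos _))
          (X_pow_sub_C_ne_zero two_pos _))] at hv
      simp only [IsRoot, eval_mul, eval_X, eval_sub, eval_pow, eval_C, mul_eq_zero, not_or] at hv
      obtain ⟨⟨hv0, hv1⟩, hvt⟩ := hv
      have ht1' : t - 1 ≠ 0 := sub_ne_zero.2 ht1
      have := III_main h2 hwsr e hs 0 ((v ^ 2 - t) / (v ^ 2 - 1)) 1 t
        (div_ne_zero hvt hv1).symm one_ne_zero.symm ht.symm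
        (by rw [Ne, div_eq_one_iff_eq hv1, sub_right_inj]; exact ht1)
        (by
          rw [Ne, div_eq_iff hv1]
          intro h
          apply mul_ne_zero (pow_ne_zero 2 hv0) ht1'
          linear_combination -h) (Ne.symm ht1)
      apply Nm.of_sq_mul (s := v * (t - 1) / (v ^ 2 - 1)) (div_ne_zero (mul_ne_zero hv0 ht1') hv1)
      convert this using 1
      field_simp
      ring
  intro a b ha hb
  obtain ⟨-, x, y, h⟩ := hN (-(a * b)) a (neg_ne_zero.2 (mul_ne_zero ha hb)) ha
  refine ⟨x / a, y, ?_⟩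
  field_simp
  linear_combination -h

theorem tern_univ {K : Type*} [Field K] (h2 : (2:K) ≠ 0) {A B a b c : K} (hA : A ≠ 0) (hB : B ≠ 0)
    (h0 : a ≠ 0 ∨ b ≠ 0 ∨ c ≠ 0) (h : A * a ^ 2 + B * b ^ 2 - A * B * c ^ 2 = 0) :
    ∃ s t, A * s ^ 2 + B * t ^ 2 = 1 := by
  by_cases hc : c = 0
  · subst hc
    have h' : A * a ^ 2 + B * b ^ 2 = 0 := by linear_combination h
    have ha : a ≠ 0 := by
      rintro rfl
      have : B * b ^ 2 = 0 := by linear_combination h'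
      simp [hB] at this
      simp [this] at h0
    have hb : b ≠ 0 := by
      rintro rfl
      have : A * a ^ 2 = 0 := by linear_combination h'
      simp [hA, ha] at this
    refine ⟨(1 + A⁻¹) / 2, (1 - A⁻¹) * b / (2 * a), ?_⟩
    field_simp
    linear_combination (A - 1) ^ 2 * h'
  · refine ⟨b / (A * c), a / (B * c), ?_⟩
    field_simp
    linear_combination h

theorem UP_of_iso {E : Type*} [Field E] (h2 : (2:E) ≠ 0) {p A B a b c : E[X]} (hp : Irreducible p)
    (hA : ¬ p ∣ A) (hB : ¬ p ∣ B) (h0 : ¬ (p ∣ a ∧ p ∣ b ∧ p ∣ c))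
    (h : p ∣ A * a ^ 2 + B * b ^ 2 - A * B * c ^ 2) : ∃ s t, p ∣ A * s ^ 2 + B * t ^ 2 - 1 := by
  haveI : Fact (Irreducible p) := ⟨hp⟩
  rw [mk_dvd] at h
  rw [mk_dvd, mk_dvd, mk_dvd] at h0
  rw [mk_dvd] at hA hB
  simp only [map_sub, map_add, map_mul, map_pow] at h
  have h2' : (2 : AdjoinRoot p) ≠ 0 := by
    intro h
    apply h2
    apply (AdjoinRoot.of p).injective
    rw [map_ofNat, map_zero]; exact h
  obtain ⟨s, t, hst⟩ := tern_univ h2' hA hB (by tauto) h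
  obtain ⟨s, rfl⟩ := AdjoinRoot.mk_surjective s
  obtain ⟨t, rfl⟩ := AdjoinRoot.mk_surjective t
  refine ⟨s, t, ?_⟩
  rw [mk_dvd]
  simp only [map_sub, map_add, map_mul, map_pow, map_one, hst, sub_self]

theorem exists_nonroot {E : Type*} [Field E] [Infinite E] {f : E[X]} (hf : f ≠ 0) : ∃ r, f.eval r ≠ 0 := by
  by_contra h
  push Not at h
  exact hf (Polynomial.funext (by simpa using h))

theorem exists_even_rep {E : Type*} [Field E] [Infinite E] {p a : E[X]} (hp : Irreducible p) (ha : ¬ p ∣ a) :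
    ∃ A, p ∣ A - a ∧ A ≠ 0 ∧ Even A.natDegree ∧ ∀ q, Irreducible q → q ∣ A → q.natDegree < p.natDegree := by
  obtain ⟨A0, hA0⟩ : ∃ A, A = a % p := ⟨_, rfl⟩
  have hd : p ∣ A0 - a := ⟨-(a / p), by rw [hA0]; linear_combination EuclideanDomain.mod_add_div a p⟩
  have h0 : A0 ≠ 0 := by
    rintro h
    rw [h, zero_sub, dvd_neg] at hd
    exact ha hd
  have hdeg : A0.natDegree < p.natDegree :=
    natDegree_lt_natDegree h0 (by rw [hA0]; exact EuclideanDomain.mod_lt _ hp.ne_zero)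
  by_cases hev : Even A0.natDegree
  · exact ⟨A0, hd, h0, hev, fun q hq hqd => (natDegree_le_of_dvd hqd h0).trans_lt hdeg⟩
  have hodd := Nat.not_even_iff_odd.1 hev
  have h1 : 1 ≤ A0.natDegree := hodd.pos
  by_cases hpe : Even p.natDegree
  · obtain ⟨r, hr⟩ := exists_nonroot (mul_ne_zero h0 hp.ne_zero)
    rw [eval_mul, mul_ne_zero_iff] at hr
    obtain ⟨A, hA⟩ : ∃ A, A = A0 - C (A0.eval r / p.eval r) * p := ⟨_, rfl⟩
    have hAd : A.natDegree = p.natDegree := by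
      rw [hA, natDegree_sub_eq_right_of_natDegree_lt, natDegree_C_mul (div_ne_zero hr.1 hr.2)]
      rwa [natDegree_C_mul (div_ne_zero hr.1 hr.2)]
    have hAr : (X - C r) ∣ A := by
      rw [dvd_iff_isRoot, IsRoot, hA]
      simp [hr.2]
    have hA0 : A ≠ 0 := by
      rintro h; rw [h, natDegree_zero] at hAd; omega
    refine ⟨A, ?_, hA0, hAd ▸ hpe, ?_⟩
    · rw [hA]
      have := dvd_sub hd (dvd_mul_left p (C (A0.eval r / p.eval r)))
      convert this using 1; ring
    · intro q hq hqd
      obtain ⟨A1, hA1⟩ := hAr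
      have hA10 : A1 ≠ 0 := by rintro rfl; simp at hA1; exact hA0 hA1
      rw [hA1, natDegree_mul (X_sub_C_ne_zero r) hA10, natDegree_X_sub_C] at hAd
      rw [hA1] at hqd
      rcases hq.prime.dvd_or_dvd hqd with h | h
      · have := natDegree_le_of_dvd h (X_sub_C_ne_zero r)
        rw [natDegree_X_sub_C] at this
        omega
      · have := natDegree_le_of_dvd h hA10
        omega
  · have hpo := Nat.not_even_iff_odd.1 hpe
    obtain ⟨r, hr⟩ := exists_nonroot (mul_ne_zero h0 hp.ne_zero)
    rw [eval_mul, mul_ne_zero_iff] at hr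
    have hne : C (A0.eval r) * p - C (p.eval r) * A0 ≠ 0 := by
      intro h
      have h3 := congrArg natDegree (sub_eq_zero.1 h)
      rw [natDegree_C_mul hr.1, natDegree_C_mul hr.2] at h3
      omega
    obtain ⟨r', hr'⟩ := exists_nonroot (mul_ne_zero hne hp.ne_zero)
    rw [eval_mul, mul_ne_zero_iff] at hr'
    obtain ⟨hr1, hr2⟩ := hr'
    simp only [eval_sub, eval_mul, eval_C] at hr1
    have hrr : r - r' ≠ 0 := by
      intro h
      rw [← sub_eq_zero.1 h] at hr1
      apply hr1; ring
    obtain ⟨α, hα⟩ : ∃ α, α = (A0.eval r' / p.eval r' - A0.eval r / p.eval r) / (r - r') := ⟨_, rfl⟩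
    have hα0 : α ≠ 0 := by
      rw [hα]
      refine div_ne_zero (fun h => hr1 ?_) hrr
      rw [div_sub_div _ _ hr2 hr.2, div_eq_zero_iff] at h
      rcases h with h | h
      · linear_combination -h
      · exact absurd h (mul_ne_zero hr2 hr.2)
    obtain ⟨l, hl⟩ : ∃ l : E[X], l = C α * X + C (-(A0.eval r / p.eval r) - α * r) := ⟨_, rfl⟩
    have hld : l.natDegree = 1 := by rw [hl]; exact natDegree_linear hα0
    have hl0 : l ≠ 0 := by rintro h; rw [h, natDegree_zero] at hld; omega
    obtain ⟨A, hA⟩ : ∃ A, A = A0 + l * p := ⟨_, rfl⟩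
    have hAd : A.natDegree = 1 + p.natDegree := by
      rw [hA, natDegree_add_eq_right_of_natDegree_lt, natDegree_mul hl0 hp.ne_zero, hld]
      rw [natDegree_mul hl0 hp.ne_zero, hld]; omega
    have hAr : (X - C r) ∣ A := by
      rw [dvd_iff_isRoot, IsRoot, hA, hl]
      simp
      have := hr.2
      field_simp
      ring
    have hA0 : A ≠ 0 := by
      rintro h; rw [h, natDegree_zero] at hAd; omega
    have hAr' : A.eval r' = 0 := by
      rw [hA, hl, hα]
      simp
      have := hr.2
      field_simp
      ring
    refine ⟨A, ?_, hA0, hAd ▸ (odd_one.add_odd hpo), ?_⟩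
    · rw [hA]
      have := dvd_add hd (dvd_mul_left p l)
      convert this using 1; ring
    · intro q hq hqd
      obtain ⟨A1, hA1⟩ := hAr
      have hA10 : A1 ≠ 0 := by rintro rfl; simp at hA1; exact hA0 hA1
      have hd' : (X - C r') ∣ A1 := by
        rw [dvd_iff_isRoot, IsRoot]
        rw [hA1, eval_mul, mul_eq_zero] at hAr'
        refine hAr'.resolve_left ?_
        simp only [eval_sub, eval_X, eval_C]
        intro h; apply hrr; linear_combination -h
      obtain ⟨A2, rfl⟩ := hd'
      have hA20 : A2 ≠ 0 := right_ne_zero_of_mul hA10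
      rw [hA1, natDegree_mul (X_sub_C_ne_zero r) hA10, natDegree_X_sub_C,
        natDegree_mul (X_sub_C_ne_zero r') hA20, natDegree_X_sub_C] at hAd
      rw [hA1] at hqd
      have aux : ∀ r : E, q ∣ X - C r → q.natDegree < p.natDegree := by
        intro r h
        have := natDegree_le_of_dvd h (X_sub_C_ne_zero r)
        rw [natDegree_X_sub_C] at this
        omega
      rcases hq.prime.dvd_or_dvd hqd with h | h
      · exact aux _ h
      rcases hq.prime.dvd_or_dvd h with h | h
      · exact aux _ h
      · have := natDegree_le_of_dvd h hA20
        omega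

theorem UP_inf {E : Type*} [Field E] [Infinite E] (h2 : (2:E) ≠ 0)
    (hwsr : ∀ f : E[X], Squarefree f → ∃ h : E[X], IsSquareReflexive h ∧ f ∣ h) (d : ℕ) :
    ∀ p : E[X], p.natDegree = d → Irreducible p → UP p := by
  induction d using Nat.strong_induction_on with
  | _ d ih =>
  intro p hpd hp a b ha hb
  obtain ⟨A, hAa, hA0, hAe, hAq⟩ := exists_even_rep hp ha
  obtain ⟨B, hBb, hB0, hBe, hBq⟩ := exists_even_rep hp hb
  obtain ⟨h, hsq, hph, hsl⟩ := EV h2 hwsr (UF_inf h2 hwsr) 1 (fun _ => A) (fun _ => B) (fun _ => hA0)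
    (fun _ => hB0) (fun _ => hAe) (fun _ => hBe) (by
      intro _ q hq hqd
      rcases hq.prime.dvd_or_dvd hqd with h | h
      · exact ih _ (hpd ▸ hAq q hq h) q rfl hq
      · exact ih _ (hpd ▸ hBq q hq h) q rfl hq) p hp.ne_zero
  obtain ⟨x0, y0, z0, w0, hne, heq⟩ := hsl 0
  obtain ⟨h', rfl⟩ := hph p hp dvd_rfl
  have hh' : ¬ p ∣ h' := by
    rintro ⟨q, rfl⟩
    exact hp.not_isUnit (hsq p ⟨q, by ring⟩)
  obtain ⟨d, v, hd0, hv, hprim⟩ := prim_vec ![x0, y0, z0, w0] (by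
    intro h
    have i0 := congrFun h 0
    have i1 := congrFun h 1
    have i2 := congrFun h 2
    have i3 := congrFun h 3
    simp at i0 i1 i2 i3
    simp [i0, i1, i2, i3] at hne)
  have ew : x0 = d * v 0 := by simpa using hv 0
  have ex : y0 = d * v 1 := by simpa using hv 1
  have ey : z0 = d * v 2 := by simpa using hv 2
  have ez : w0 = d * v 3 := by simpa using hv 3
  have heq' : A * v 0 ^ 2 + B * v 1 ^ 2 - A * B * v 2 ^ 2 = p * (h' * v 3 ^ 2) := by
    apply mul_left_cancel₀ (pow_ne_zero 2 hd0)
    rw [ew, ex, ey, ez] at heq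
    linear_combination heq
  have cg : ∀ {A a : E[X]}, p ∣ A - a → ¬ p ∣ a → ¬ p ∣ A := by
    intro A a h h1 h3
    apply h1
    have := dvd_sub h3 h
    convert this using 1; ring
  obtain ⟨s, t, hst⟩ := UP_of_iso h2 hp (cg hAa ha) (cg hBb hb) (a := v 0) (b := v 1) (c := v 2) (by
    rintro ⟨⟨k1, e1⟩, ⟨k2, e2⟩, ⟨k3, e3⟩⟩
    have h5 : p ∣ h' * v 3 ^ 2 := by
      refine ⟨A * k1 ^ 2 + B * k2 ^ 2 - A * B * k3 ^ 2, mul_left_cancel₀ hp.ne_zero ?_⟩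
      rw [← heq', e1, e2, e3]; ring
    have h6 := hp.prime.dvd_of_dvd_pow ((hp.prime.dvd_or_dvd h5).resolve_left hh')
    obtain ⟨i, hi⟩ := hprim p hp
    fin_cases i
    · exact hi ⟨_, e1⟩
    · exact hi ⟨_, e2⟩
    · exact hi ⟨_, e3⟩
    · exact hi h6) ⟨_, heq'⟩
  refine ⟨s, t, ?_⟩
  have := dvd_sub (dvd_sub hst (hAa.mul_right (s ^ 2))) (hBb.mul_right (t ^ 2))
  convert this using 1; ring

theorem Slot.scale {K : Type*} [Field K] {A B h s t : K} (hs : s ≠ 0) (ht : t ≠ 0) (H : Slot A B h) :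
    Slot (A * s ^ 2) (B * t ^ 2) h := by
  obtain ⟨a, b, c, w, h0, h1⟩ := H
  refine ⟨a * t, b * s, c, w * s * t, ?_, ?_⟩
  · simpa [hs, ht] using h0
  · linear_combination (s * t) ^ 2 * h1

theorem rat_poly {E : Type*} [Field E] (a : RatFunc E) (ha : a ≠ 0) :
    ∃ (A : E[X]) (s : RatFunc E), A ≠ 0 ∧ s ≠ 0 ∧ a = algebraMap E[X] (RatFunc E) A * s ^ 2 := by
  refine ⟨a.num * a.denom, (algebraMap E[X] (RatFunc E) a.denom)⁻¹,
    mul_ne_zero (RatFunc.num_ne_zero ha) a.denom_ne_zero, ?_, ?_⟩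
  · simp [a.denom_ne_zero]
  · have hd : algebraMap E[X] (RatFunc E) a.denom ≠ 0 := by simp [a.denom_ne_zero]
    nth_rewrite 1 [← RatFunc.num_div_denom a]
    rw [map_mul]
    field_simp

theorem subst_inj {E : Type*} [Field E] (r : E) (f : E[X])
    (hf : eval₂ (algebraMap E (RatFunc E)) (algebraMap E[X] (RatFunc E) (X - C r))⁻¹ f = 0) : f = 0 := by
  have hx : algebraMap E[X] (RatFunc E) (X - C r) ≠ 0 := by
    rw [Ne, FaithfulSMul.algebraMap_eq_zero_iff]; exact X_sub_C_ne_zero r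
  letI := invertibleOfNonzero (inv_ne_zero hx)
  have h := eval₂_reverse_mul_pow (algebraMap E (RatFunc E)) (algebraMap E[X] (RatFunc E) (X - C r))⁻¹ f
  rw [hf, mul_eq_zero, invOf_eq_inv, inv_inv] at h
  have h := h.resolve_right (pow_ne_zero _ (inv_ne_zero hx))
  have e : eval₂ (algebraMap E (RatFunc E)) (algebraMap E[X] (RatFunc E) (X - C r)) f.reverse =
      algebraMap E[X] (RatFunc E) (f.reverse.comp (X - C r)) := by
    rw [comp, hom_eval₂]; rfl
  rw [e, FaithfulSMul.algebraMap_eq_zero_iff] at h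
  have h3 : f.reverse = 0 := by
    have := congrArg (fun q => q.comp (X + C r)) h
    simpa [comp_assoc] using this
  simpa using h3

theorem subst_even {E : Type*} [Field E] (r : E) (A : E[X]) (hA : A.eval r ≠ 0) :
    ∃ (B : E[X]) (s : RatFunc E), B ≠ 0 ∧ Even B.natDegree ∧ s ≠ 0 ∧ algebraMap E[X] (RatFunc E) A =
      eval₂ (algebraMap E (RatFunc E)) (algebraMap E[X] (RatFunc E) (X - C r))⁻¹ B * s ^ 2 := by
  have hx : algebraMap E[X] (RatFunc E) (X - C r) ≠ 0 := by
    rw [Ne, FaithfulSMul.algebraMap_eq_zero_iff]; exact X_sub_C_ne_zero r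
  obtain ⟨x, hxx⟩ : ∃ x, x = algebraMap E[X] (RatFunc E) (X - C r) := ⟨_, rfl⟩
  obtain ⟨T, hT⟩ : ∃ T, T = taylor r A := ⟨_, rfl⟩
  have hc : T.coeff 0 ≠ 0 := by rw [hT, taylor_coeff_zero]; exact hA
  have hT0 : T ≠ 0 := by rintro h; rw [h, coeff_zero] at hc; exact hc rfl
  rw [← hxx] at hx ⊢
  letI := invertibleOfNonzero hx
  have h := eval₂_reverse_mul_pow (algebraMap E (RatFunc E)) x T
  have e : eval₂ (algebraMap E (RatFunc E)) x T = algebraMap E[X] (RatFunc E) A := by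
    have : A = T.comp (X - C r) := by
      rw [hT, taylor_apply, comp_assoc]; simp
    conv_rhs => rw [this]
    rw [comp, hom_eval₂, hxx]; rfl
  rw [e, invOf_eq_inv] at h
  have hr0 : T.reverse ≠ 0 := by simpa using hT0
  obtain ⟨m, hm⟩ : ∃ m, T.natDegree + T.natDegree % 2 = 2 * m := ⟨(T.natDegree + T.natDegree % 2) / 2, by omega⟩
  refine ⟨T.reverse * X ^ (T.natDegree % 2), x ^ m, mul_ne_zero hr0 (pow_ne_zero _ X_ne_zero), ?_,
    pow_ne_zero _ hx, ?_⟩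
  · rw [natDegree_mul hr0 (pow_ne_zero _ X_ne_zero), natDegree_pow, natDegree_X, reverse_natDegree,
      natTrailingDegree_eq_zero.2 (Or.inr hc), Nat.even_iff]
    omega
  · rw [← h, eval₂_mul, eval₂_pow, eval₂_X, ← pow_mul, mul_comm m 2, ← hm, pow_add]
    have : (x⁻¹) ^ (T.natDegree % 2) * x ^ (T.natDegree % 2) = 1 := by
      rw [← mul_pow, inv_mul_cancel₀ hx, one_pow]
    linear_combination (-(eval₂ (algebraMap E (RatFunc E)) x⁻¹ T.reverse * x ^ T.natDegree)) * this

theorem slots_inf {E : Type*} [Field E] [Infinite E] (h2 : (2:E) ≠ 0)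
    (hwsr : ∀ f : E[X], Squarefree f → ∃ h : E[X], IsSquareReflexive h ∧ f ∣ h) (n : ℕ)
    (a b : Fin n → RatFunc E) (ha : ∀ i, a i ≠ 0) (hb : ∀ i, b i ≠ 0) :
    ∃ c, c ≠ 0 ∧ ∀ i, Slot (a i) (b i) c := by
  choose A s hA hs ea using fun i => rat_poly (a i) (ha i)
  choose B t hB ht eb using fun i => rat_poly (b i) (hb i)
  obtain ⟨r, hr⟩ := exists_nonroot (f := ∏ i, (A i * B i))
    (Finset.prod_ne_zero_iff.2 fun i _ => mul_ne_zero (hA i) (hB i))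
  rw [eval_prod, Finset.prod_ne_zero_iff] at hr
  simp only [Finset.mem_univ, true_implies, eval_mul, mul_ne_zero_iff] at hr
  choose A' s' hA' hAe hs' ea' using fun i => subst_even r (A i) (hr i).1
  choose B' t' hB' hBe ht' eb' using fun i => subst_even r (B i) (hr i).2
  obtain ⟨h, hsq, -, hsl⟩ := EV h2 hwsr (UF_inf h2 hwsr) n A' B' hA' hB' hAe hBe
    (fun i p hp _ => UP_inf h2 hwsr _ p rfl hp) 1 one_ne_zero
  let σ := eval₂RingHom (algebraMap E (RatFunc E)) (algebraMap E[X] (RatFunc E) (X - C r))⁻¹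
  have hσ : ∀ f, f ≠ 0 → σ f ≠ 0 := fun f hf h => hf (subst_inj r f h)
  refine ⟨σ h, hσ h hsq.ne_zero, fun i => ?_⟩
  rw [ea, eb, ea', eb']
  refine Slot.scale (hs i) (ht i) (Slot.scale (hs' i) (ht' i) ?_)
  obtain ⟨x, y, z, w, h0, h1⟩ := hsl i
  refine ⟨σ x, σ y, σ z, σ w, ?_, ?_⟩
  · rcases h0 with h | h | h | h
    · exact Or.inl (hσ _ h)
    · exact Or.inr (Or.inl (hσ _ h))
    · exact Or.inr (Or.inr (Or.inl (hσ _ h)))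
    · exact Or.inr (Or.inr (Or.inr (hσ _ h)))
  · have := congrArg σ h1
    simp only [map_sub, map_add, map_mul, map_pow] at this
    exact this

theorem iso_univ {K : Type*} [Field K] (h2 : (2:K) ≠ 0) {n : ℕ} (d : Fin n → K) (hd : ∀ i, d i ≠ 0)
    (h : ∃ x : Fin n → K, x ≠ 0 ∧ ∑ i, d i * x i ^ 2 = 0) (e : K) : ∃ x : Fin n → K, ∑ i, d i * x i ^ 2 = e := by
  classical
  obtain ⟨x, hx, h0⟩ := h
  obtain ⟨j, hj⟩ := Function.ne_iff.1 hx
  have hj' : x j ≠ 0 := hj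
  have hdj := hd j
  obtain ⟨l, hl⟩ : ∃ l, l = (e - d j) / (2 * d j * x j) := ⟨_, rfl⟩
  refine ⟨fun i => (if i = j then 1 else 0) + l * x i, ?_⟩
  have : ∀ i, d i * ((if i = j then 1 else 0) + l * x i) ^ 2 =
      (if i = j then d j + 2 * l * d j * x j else 0) + l ^ 2 * (d i * x i ^ 2) := by
    intro i
    split_ifs with h
    · rw [h]; ring
    · ring
  rw [Finset.sum_congr rfl fun i _ => this i, Finset.sum_add_distrib, ← Finset.mul_sum, h0,
    Finset.sum_ite_eq' Finset.univ j]
  simp only [Finset.mem_univ, if_true, hl]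
  field_simp
  ring

/-- every 2-fold Pfister form is universal -/
def PU (K : Type*) [Field K] : Prop := ∀ a b e : K, a ≠ 0 → b ≠ 0 → e ≠ 0 →
  ∃ x y z w, x ^ 2 - a * y ^ 2 - b * z ^ 2 + a * b * w ^ 2 = e

theorem pf_of_iso8 {K : Type*} [Field K] (h2 : (2:K) ≠ 0) {a b e x0 x1 x2 x3 y0 y1 y2 y3 : K}
    (ha : a ≠ 0) (hb : b ≠ 0) 
    (hne : x0 ≠ 0 ∨ x1 ≠ 0 ∨ x2 ≠ 0 ∨ x3 ≠ 0 ∨ y0 ≠ 0 ∨ y1 ≠ 0 ∨ y2 ≠ 0 ∨ y3 ≠ 0)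
    (h : x0 ^ 2 - a * x1 ^ 2 - b * x2 ^ 2 + a * b * x3 ^ 2 =
      e * (y0 ^ 2 - a * y1 ^ 2 - b * y2 ^ 2 + a * b * y3 ^ 2)) :
    ∃ x y z w, x ^ 2 - a * y ^ 2 - b * z ^ 2 + a * b * w ^ 2 = e := by
  by_cases hv : y0 ^ 2 - a * y1 ^ 2 - b * y2 ^ 2 + a * b * y3 ^ 2 = 0
  · have hu : x0 ^ 2 - a * x1 ^ 2 - b * x2 ^ 2 + a * b * x3 ^ 2 = 0 := by rw [h, hv, mul_zero]
    have : ∃ x : Fin 4 → K, x ≠ 0 ∧ ∑ i, ![1, -a, -b, a * b] i * x i ^ 2 = 0 := by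
      by_cases hx : x0 ≠ 0 ∨ x1 ≠ 0 ∨ x2 ≠ 0 ∨ x3 ≠ 0
      · refine ⟨![x0, x1, x2, x3], fun h => ?_, ?_⟩
        · have i0 := congrFun h 0
          have i1 := congrFun h 1
          have i2 := congrFun h 2
          have i3 := congrFun h 3
          simp at i0 i1 i2 i3
          simp [i0, i1, i2, i3] at hx
        · simp [Fin.sum_univ_four]; linear_combination hu
      · refine ⟨![y0, y1, y2, y3], fun h => ?_, ?_⟩
        · have i0 := congrFun h 0
          have i1 := congrFun h 1
          have i2 := congrFun h 2
          have i3 := congrFun h 3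
          simp at i0 i1 i2 i3
          simp [i0, i1, i2, i3] at hne
          tauto
        · simp [Fin.sum_univ_four]; linear_combination hv
    obtain ⟨x, hx⟩ := iso_univ h2 ![1, -a, -b, a * b] (by
      intro i; fin_cases i <;> simp [ha, hb]) this e
    refine ⟨x 0, x 1, x 2, x 3, ?_⟩
    simp [Fin.sum_univ_four] at hx
    linear_combination hx
  · obtain ⟨N, hN⟩ : ∃ N, N = y0 ^ 2 - a * y1 ^ 2 - b * y2 ^ 2 + a * b * y3 ^ 2 := ⟨_, rfl⟩
    rw [← hN] at hv h
    refine ⟨(x0 * y0 + a * x1 * y1 + b * x2 * y2 - a * b * x3 * y3) / N,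
      (x0 * y1 + x1 * y0 - b * x2 * y3 + b * x3 * y2) / N,
      (x0 * y2 + x2 * y0 + a * x1 * y3 - a * x3 * y1) / N,
      (x0 * y3 + x3 * y0 + x1 * y2 - x2 * y1) / N, ?_⟩
    field_simp
    linear_combination N * h - (x0 ^ 2 - a * x1 ^ 2 - b * x2 ^ 2 + a * b * x3 ^ 2) * hN

theorem split_gcd {E : Type*} [Field E] (e x : E[X]) (he : Squarefree e) :
    ∃ e1 x' e2, x = e1 * x' ∧ e = e1 * e2 ∧ IsCoprime e2 x := by
  classical
  obtain ⟨a, b, h1, h2, h3⟩ := extract_gcd e x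
  refine ⟨gcd e x, b, a, h2, h1, ?_⟩
  rw [h2]
  exact (sqf_cop (h1 ▸ he)).symm.mul_right ((gcd_isUnit_iff a b).1 h3)

set_option maxHeartbeats 1000000 in
theorem PU_rat {E : Type*} [Field E] (h2 : (2:E) ≠ 0) (hU : UF E) (hUP : ∀ p : E[X], Irreducible p → UP p) :
    PU (RatFunc E) := by
  intro α β ε hα hβ hε
  have h2K : (2 : RatFunc E) ≠ 0 := by
    rw [← map_ofNat (algebraMap E (RatFunc E)) 2]
    exact fun h => h2 ((algebraMap E (RatFunc E)).injective (by rw [h, map_zero]))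
  obtain ⟨A, σ, hA, hσ, eA⟩ := rat_poly α hα
  obtain ⟨B, τ, hB, hτ, eB⟩ := rat_poly β hβ
  obtain ⟨e', ρ, he', hρ, eE⟩ := rat_poly ε hε
  obtain ⟨m, e, hm, hsqe, rfl⟩ := exists_sq_mul_sqf e' he'
  obtain ⟨x, y, z, s, t, hsq, hs, ht, rfl, rfl⟩ := exists_NF A B hA hB
  obtain ⟨e1, a, f1, rfl, rfl, c1⟩ := split_gcd e x hsqe
  obtain ⟨e2, b, f2, rfl, rfl, c2⟩ := split_gcd f1 y hsqe.of_mul_right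
  obtain ⟨e3, c, e0, rfl, rfl, c3⟩ := split_gcd f2 z hsqe.of_mul_right.of_mul_right
  have hsq' : Squarefree (a * b * c * e0 * e1 * e2 * e3) := by
    have : Squarefree (e0 * (e1 * a * (e2 * b) * (e3 * c))) := by
      rw [squarefree_mul_iff]
      refine ⟨?_, hsqe.of_mul_right.of_mul_right.of_mul_right, hsq⟩
      apply IsCoprime.isRelPrime
      exact ((c1.of_mul_left_right.of_mul_left_right).mul_right c2.of_mul_left_right).mul_right c3
    convert this using 1; ring
  obtain ⟨X', hX0, hX⟩ := iso8 h2 hU hUP a b c e0 e1 e2 e3 hsq' ![1, e2*e3*b*c, e1*e3*a*c, e1*e2*a*b,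
    -(e0*e1*e2*e3), -(e0*e1*b*c), -(e0*e2*a*c), -(e0*e3*a*b)] rfl rfl rfl rfl rfl rfl rfl rfl
  have hn0 := hsq'.ne_zero
  simp only [mul_ne_zero_iff] at hn0
  obtain ⟨⟨⟨⟨⟨⟨na, nb⟩, nc⟩, n0⟩, n1⟩, n2⟩, n3⟩ := hn0
  obtain ⟨φ, hφ⟩ : ∃ φ, φ = algebraMap E[X] (RatFunc E) := ⟨_, rfl⟩
  have hφ0 : ∀ f, f ≠ 0 → φ f ≠ 0 := fun f hf h => hf (by
    rw [hφ, FaithfulSMul.algebraMap_eq_zero_iff] at h; exact h)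
  have hX' : φ (∑ i, ![1, e2*e3*b*c, e1*e3*a*c, e1*e2*a*b,
    -(e0*e1*e2*e3), -(e0*e1*b*c), -(e0*e2*a*c), -(e0*e3*a*b)] i * X' i ^ 2) = 0 := by rw [hX, map_zero]
  rw [Fin.sum_univ_eight] at hX'
  simp at hX'
  rw [← hφ] at eA eB eE
  have ma := hφ0 _ na
  have mb := hφ0 _ nb
  have mc := hφ0 _ nc
  have m0 := hφ0 _ n0
  have m1 := hφ0 _ n1
  have m2 := hφ0 _ n2
  have m3 := hφ0 _ n3
  have ms := hφ0 _ hs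
  have mt := hφ0 _ ht
  have mm := hφ0 _ hm
  simp only [map_mul, map_neg, map_pow] at eA eB eE
  refine pf_of_iso8 h2K hα hβ (x0 := φ (X' 0)) (x1 := φ (X' 1) / (φ s * σ)) (x2 := φ (X' 2) / (φ t * τ))
    (x3 := φ (X' 3) / (φ e3 * φ c * φ s * σ * φ t * τ))
    (y0 := φ (X' 4) / (φ m * ρ)) (y1 := φ (X' 5) / (φ e2 * φ e3 * φ s * σ * φ m * ρ))
    (y2 := φ (X' 6) / (φ e1 * φ e3 * φ t * τ * φ m * ρ))
    (y3 := φ (X' 7) / (φ e1 * φ e2 * φ e3 * φ c * φ s * σ * φ t * τ * φ m * ρ)) ?_ ?_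
  · by_contra hcon
    push Not at hcon
    simp only [div_eq_zero_iff, mul_eq_zero, ma, mb, mc, m0, m1, m2, m3, ms, mt, mm, hσ, hτ, hρ, or_false] at hcon
    obtain ⟨i0, i1, i2, i3, i4, i5, i6, i7⟩ := hcon
    apply hX0
    funext i
    by_contra hi
    apply hφ0 _ hi
    fin_cases i <;> assumption
  · rw [eA, eB, eE]
    field_simp
    linear_combination hX'

theorem four_univ {K : Type*} [Field K] (hPU : PU K) {f1 f2 f3 f4 m e : K} (h1 : f1 ≠ 0) (h2 : f2 ≠ 0)
    (h3 : f3 ≠ 0) (h4 : f4 ≠ 0) (he : e ≠ 0) (hm : f1 * f2 * f3 * f4 = m ^ 2) :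
    ∃ t1 t2 t3 t4, f1 * t1 ^ 2 + f2 * t2 ^ 2 + f3 * t3 ^ 2 + f4 * t4 ^ 2 = e := by
  obtain ⟨x, y, z, w, h⟩ := hPU (-(f1 * f2)) (-(f1 * f3)) (f1 * e) (by simp [*]) (by simp [*]) (by simp [*])
  refine ⟨x / f1, y, z, m * w / f4, ?_⟩
  field_simp
  linear_combination f4 * h - w ^ 2 * f1 * hm

def Iso5 {K : Type*} [Field K] (a0 a1 a2 a3 a4 : K) : Prop :=
  ∃ p q r x y : K, ¬(p = 0 ∧ q = 0 ∧ r = 0 ∧ x = 0 ∧ y = 0) ∧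
    a0 * p ^ 2 + a1 * q ^ 2 + a2 * r ^ 2 + a3 * x ^ 2 + a4 * y ^ 2 = 0

theorem five_add {K : Type*} [Field K] {a0 a1 a2 a3 a4 δ p q r x y p' q' r' x' y' : K} (hδ : δ ≠ 0)
    (h : a0 * p ^ 2 + a1 * q ^ 2 + a2 * r ^ 2 + a3 * x ^ 2 + a4 * y ^ 2 = -δ)
    (h' : a0 * p' ^ 2 + a1 * q' ^ 2 + a2 * r' ^ 2 + a3 * x' ^ 2 + a4 * y' ^ 2 = δ)
    (h0 : a0 * p * p' + a1 * q * q' + a2 * r * r' + a3 * x * x' + a4 * y * y' = 0) :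
    Iso5 a0 a1 a2 a3 a4 := by
  refine ⟨p + p', q + q', r + r', x + x', y + y', ?_, by linear_combination h + h' + 2 * h0⟩
  rintro ⟨e1, e2, e3, e4, e5⟩
  apply hδ
  linear_combination h0 - a0 * p * e1 - a1 * q * e2 - a2 * r * e3 - a3 * x * e4 - a4 * y * e5 + h

theorem five_core {K : Type*} [Field K] (hPU : PU K) {a0 a1 a2 a3 a4 δ p q r x y : K} (h0 : a0 ≠ 0) (h1 : a1 ≠ 0)
    (h2 : a2 ≠ 0) (h3 : a3 ≠ 0) (h4 : a4 ≠ 0) (hδ : δ = -(a0 * a1 * a2 * a3 * a4))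
    (hu : a0 * p ^ 2 + a1 * q ^ 2 + a2 * r ^ 2 ≠ 0)
    (h : a0 * p ^ 2 + a1 * q ^ 2 + a2 * r ^ 2 + a3 * x ^ 2 + a4 * y ^ 2 = -δ) : Iso5 a0 a1 a2 a3 a4 := by
  have hδ0 : δ ≠ 0 := by rw [hδ]; simp [h0, h1, h2, h3, h4]
  obtain ⟨u, eu⟩ : ∃ u, u = a0 * p ^ 2 + a1 * q ^ 2 + a2 * r ^ 2 := ⟨_, rfl⟩
  obtain ⟨w, ew⟩ : ∃ w, w = a3 * x ^ 2 + a4 * y ^ 2 := ⟨_, rfl⟩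
  obtain ⟨m, em⟩ : ∃ m, m = a0 * p ^ 2 + a1 * q ^ 2 := ⟨_, rfl⟩
  rw [← eu] at hu
  have huw : u + w = -δ := by rw [eu, ew, ← h]; ring
  have huw0 : u + w ≠ 0 := by rw [huw]; simpa
  by_cases hv : x = 0 ∧ y = 0
  · obtain ⟨rfl, rfl⟩ := hv
    have hw : w = 0 := by rw [ew]; ring
    by_cases hp : p = 0 ∧ q = 0
    · obtain ⟨rfl, rfl⟩ := hp
      obtain ⟨t1, t2, t3, t4, ht⟩ := four_univ hPU (m := r) h3 h4 h0 h1 hδ0 (by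
        apply mul_left_cancel₀ h2; linear_combination - h - hδ + 2 * hδ)
      exact five_add hδ0 h (p' := t3) (q' := t4) (r' := 0) (x' := t1) (y' := t2) (by linear_combination ht) (by ring)
    · by_cases hm : m = 0
      · exact ⟨p, q, 0, 0, 0, by tauto, by linear_combination hm - em⟩
      obtain ⟨t1, t2, t3, t4, ht⟩ := four_univ hPU (f3 := a0 * a1 * m) (f4 := a2 * m * u) (m := m * δ) h3 h4
        (by repeat' first | assumption | apply mul_ne_zero) (by repeat' first | assumption | apply mul_ne_zero) hδ0 (by
        rw [hw] at huw; linear_combination a0 * a1 * a2 * a3 * a4 * m ^ 2 * huw - m ^ 2 * δ * hδ)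
      refine five_add hδ0 h (p' := t3 * (-a1 * q) + t4 * (a2 * r * p)) (q' := t3 * (a0 * p) + t4 * (a2 * r * q))
        (r' := t4 * (-m)) (x' := t1) (y' := t2) ?_ ?_
      · rw [← ht, eu, em]; ring
      · rw [em]; ring
  · by_cases hw : w = 0
    · exact ⟨0, 0, 0, x, y, by tauto, by linear_combination hw - ew⟩
    by_cases hp : p = 0 ∧ q = 0
    · obtain ⟨rfl, rfl⟩ := hp
      obtain ⟨t1, t2, t3, t4, ht⟩ := four_univ hPU (f1 := u * w * (u + w)) (f2 := a3 * a4 * w) (m := r * w * δ)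
        (by repeat' first | assumption | apply mul_ne_zero) (by repeat' first | assumption | apply mul_ne_zero) h0 h1 hδ0 (by
        rw [huw, eu]; linear_combination (-r ^ 2 * w ^ 2 * δ * hδ))
      refine five_add hδ0 h (p' := t3) (q' := t4)
        (r' := t1 * w * r) (x' := - t1 * u * x - t2 * a4 * y) (y' := - t1 * u * y + t2 * a3 * x) ?_ ?_
      · rw [← ht, ew, eu]; ring
      · rw [ew, eu]; ring
    · by_cases hm : m = 0
      · exact ⟨p, q, 0, 0, 0, by tauto, by linear_combination hm - em⟩
      obtain ⟨t1, t2, t3, t4, ht⟩ := four_univ hPU (f1 := u * w * (u + w)) (f2 := a3 * a4 * w)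
        (f3 := a0 * a1 * m) (f4 := a2 * m * u) (m := u * w * m * δ)
        (by repeat' first | assumption | apply mul_ne_zero) (by repeat' first | assumption | apply mul_ne_zero) (by repeat' first | assumption | apply mul_ne_zero) (by repeat' first | assumption | apply mul_ne_zero) hδ0 (by
        rw [huw]; linear_combination (-u ^ 2 * w ^ 2 * m ^ 2 * δ * hδ))
      refine five_add hδ0 h (p' := t1 * w * p + t3 * (-a1 * q) + t4 * (a2 * r * p))
        (q' := t1 * w * q + t3 * (a0 * p) + t4 * (a2 * r * q))
        (r' := t1 * w * r + t4 * (-m)) (x' := - t1 * u * x - t2 * a4 * y) (y' := - t1 * u * y + t2 * a3 * x) ?_ ?_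
      · rw [← ht, ew, eu, em]; ring
      · rw [ew, eu, em]; ring

theorem Slot.rep {K : Type*} [Field K] (h2 : (2:K) ≠ 0) {a b c : K} (ha : a ≠ 0) (hb : b ≠ 0) (H : Slot a b c) :
    ∃ x y z, a * x ^ 2 + b * y ^ 2 - a * b * z ^ 2 = c := by
  obtain ⟨x, y, z, w, h0, h⟩ := H
  by_cases hw : w = 0
  · obtain ⟨v, hv⟩ := iso_univ h2 ![a, b, -(a * b)] (by intro i; fin_cases i <;> simp [ha, hb]) ⟨![x, y, z],
      by
        intro h
        have i0 := congrFun h 0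
        have i1 := congrFun h 1
        have i2 := congrFun h 2
        simp at i0 i1 i2
        simp [i0, i1, i2, hw] at h0, by
        rw [hw] at h; simp [Fin.sum_univ_three]; linear_combination h⟩ c
    refine ⟨v 0, v 1, v 2, ?_⟩
    simp [Fin.sum_univ_three] at hv
    linear_combination hv
  · refine ⟨x / w, y / w, z / w, ?_⟩
    field_simp
    linear_combination h

theorem five_iso {K : Type*} [Field K] (h2 : (2:K) ≠ 0) (hPU : PU K)
    (SL : ∀ a b c d : K, a ≠ 0 → b ≠ 0 → c ≠ 0 → d ≠ 0 → ∃ e, e ≠ 0 ∧ Slot a b e ∧ Slot c d e)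
    (v : Fin 5 → K) (hv : ∀ i, v i ≠ 0) : IsotropicDiag v := by
  suffices H : Iso5 (v 0) (v 1) (v 2) (v 3) (v 4) by
    obtain ⟨p, q, r, x, y, h0, h⟩ := H
    refine ⟨![p, q, r, x, y], fun h => h0 ?_, ?_⟩
    · have i0 := congrFun h 0
      have i1 := congrFun h 1
      have i2 := congrFun h 2
      have i3 := congrFun h 3
      have i4 := congrFun h 4
      exact ⟨i0, i1, i2, i3, i4⟩
    · rw [Fin.sum_univ_five]; exact h
  have h0 := hv 0
  have h1 := hv 1
  have h3 := hv 2
  have h4 := hv 3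
  have h5 := hv 4
  generalize v 0 = a0, v 1 = a1, v 2 = a2, v 3 = a3, v 4 = a4 at *
  obtain ⟨s, es⟩ : ∃ s, s = -(a0 * a1 * a2) := ⟨_, rfl⟩
  have hs : s ≠ 0 := by rw [es]; simp [*]
  obtain ⟨e, he, S1, S2⟩ := SL (-(a1 * a2)) (-(a0 * a2)) (-(s * a3)) (-(s * a4)) (by simp [*]) (by simp [*])
    (by simp [h4, hs]) (by simp [h5, hs])
  obtain ⟨p, q, r, e1⟩ := S1.rep h2 (by simp [*]) (by simp [*])
  obtain ⟨x, y, z, e2⟩ := S2.rep h2 (by simp [h4, hs]) (by simp [h5, hs])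
  have e1' : a0 * (a1 * a2 * p) ^ 2 + a1 * (a0 * a2 * q) ^ 2 + a2 * (a0 * a1 * a2 * r) ^ 2 = s * e := by
    rw [← e1, es]; ring
  have e3 : a0 * (a1 * a2 * p) ^ 2 + a1 * (a0 * a2 * q) ^ 2 + a2 * (a0 * a1 * a2 * r) ^ 2 + a3 * (s * x) ^ 2
      + a4 * (s * y) ^ 2 = -(s * a3 * a4) * (s * z) ^ 2 := by
    rw [e1', ← e2]; ring
  by_cases hz : s * z = 0
  · refine ⟨_, _, _, _, _, ?_, e3.trans (by rw [hz]; ring)⟩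
    rintro ⟨i1, i2, i3, -, -⟩
    rw [i1, i2, i3] at e1'
    exact mul_ne_zero hs he (by rw [← e1']; ring)
  · refine five_core hPU (δ := s * a3 * a4) (p := a1 * a2 * p / (s * z)) (q := a0 * a2 * q / (s * z))
      (r := a0 * a1 * a2 * r / (s * z)) (x := s * x / (s * z)) (y := s * y / (s * z)) h0 h1 h3 h4 h5 (by rw [es]; ring) ?_ ?_
    · have : a0 * (a1 * a2 * p / (s * z)) ^ 2 + a1 * (a0 * a2 * q / (s * z)) ^ 2 +
          a2 * (a0 * a1 * a2 * r / (s * z)) ^ 2 = s * e / (s * z) ^ 2 := by rw [← e1']; ring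
      rw [this]
      exact div_ne_zero (mul_ne_zero hs he) (pow_ne_zero _ hz)
    · trans -(s * a3 * a4) * (s * z) ^ 2 / (s * z) ^ 2
      · rw [← e3]; ring
      · rw [mul_div_assoc, div_self (pow_ne_zero _ hz), mul_one]

theorem pf_slot {K : Type*} [Field K] (h2 : (2:K) ≠ 0) {a b c : K} (ha : a ≠ 0) (hb : b ≠ 0) (hc : c ≠ 0)
    (H : Slot a b c) : ∃ d, d ≠ 0 ∧ QuadraticMap.Equivalent (Pfister2 K a b) (Pfister2 K c d) := by
  obtain ⟨x, y, z, hv⟩ := H.rep h2 ha hb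
  obtain ⟨p, q, r, hd, ho⟩ : ∃ p q r, a * p ^ 2 + b * q ^ 2 - a * b * r ^ 2 ≠ 0 ∧
      a * x * p + b * y * q - a * b * z * r = 0 := by
    by_cases h1 : a * (b * y) ^ 2 + b * (-(a * x)) ^ 2 - a * b * 0 ^ 2 = 0
    · by_cases h3 : a * (b * z) ^ 2 + b * 0 ^ 2 - a * b * x ^ 2 = 0
      · by_cases h4 : a * 0 ^ 2 + b * (a * z) ^ 2 - a * b * y ^ 2 = 0
        · exfalso
          apply hc
          have h1 : b * y ^ 2 + a * x ^ 2 = 0 := by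
            apply mul_left_cancel₀ (mul_ne_zero ha hb); linear_combination h1
          have h3 : b * z ^ 2 - x ^ 2 = 0 := by
            apply mul_left_cancel₀ (mul_ne_zero ha hb); linear_combination h3
          have h4 : a * z ^ 2 - y ^ 2 = 0 := by
            apply mul_left_cancel₀ (mul_ne_zero ha hb); linear_combination h4
          have : 2 * (a * b * z ^ 2) = 0 := by linear_combination a * h3 + b * h4 + h1
          rw [mul_eq_zero] at this
          rw [← hv]; linear_combination h1 - this.resolve_left h2
        · exact ⟨_, _, _, h4, by ring⟩
      · exact ⟨_, _, _, h3, by ring⟩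
    · exact ⟨_, _, _, h1, by ring⟩
  obtain ⟨d, ed⟩ : ∃ d, d = a * p ^ 2 + b * q ^ 2 - a * b * r ^ 2 := ⟨_, rfl⟩
  rw [← ed] at hd
  refine ⟨d, hd, QuadraticMap.Equivalent.symm ?_⟩
  let M : Matrix (Fin 4) (Fin 4) K := !![1, 0, 0, a * x * p + b * y * q - a * b * z * r;
    0, x, p, -b * y * r + b * z * q; 0, y, q, a * x * r - a * z * p; 0, z, r, x * q - y * p]
  have key : ∀ X, Pfister2 K a b (M.mulVecLin X) = Pfister2 K c d X := by
    intro X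
    simp only [Pfister2, QuadraticMap.weightedSumSquares_apply, Fin.sum_univ_four, Matrix.mulVecLin_apply, M,
      Matrix.mulVec, dotProduct]
    simp
    rw [ho, ← hv, ed]
    linear_combination (- 2 * X 1 * X 2) * ho - X 3 ^ 2 * (a * x * p + b * y * q - a * b * z * r) * ho
  have hinj : Function.Injective M.mulVecLin := by
    rw [injective_iff_map_eq_zero]
    intro X hX
    have h1 : ∀ t, Pfister2 K c d (X + t) = Pfister2 K c d t := by
      intro t; rw [← key, ← key, map_add, hX, zero_add]
    have t0 := h1 0
    have t1 := h1 (fun i => if i = 0 then 1 else 0)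
    have t2 := h1 (fun i => if i = 1 then 1 else 0)
    have t3 := h1 (fun i => if i = 2 then 1 else 0)
    have t4 := h1 (fun i => if i = 3 then 1 else 0)
    simp [Pfister2, QuadraticMap.weightedSumSquares_apply, Fin.sum_univ_four] at t0 t1 t2 t3 t4
    funext i
    fin_cases i <;> simp
    · apply mul_left_cancel₀ h2
      linear_combination t1 - t0
    · apply mul_left_cancel₀ (mul_ne_zero h2 hc)
      linear_combination t0 - t2
    · apply mul_left_cancel₀ (mul_ne_zero h2 hd)
      linear_combination t0 - t3
    · apply mul_left_cancel₀ (mul_ne_zero h2 (mul_ne_zero hc hd))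
      linear_combination t4 - t0
  exact ⟨{ LinearEquiv.ofInjectiveEndo _ hinj with map_app' := fun X => key X }⟩

theorem UF_fin {E : Type*} [Field E] [Finite E] (h2 : (2:E) ≠ 0) : UF E := by
  intro a b ha hb
  cases nonempty_fintype E
  obtain ⟨s, t, h⟩ := FiniteField.exists_root_sum_quadratic (f := C a * X ^ 2 - 1) (g := C b * X ^ 2)
    (by compute_degree!) (by compute_degree!) (FiniteField.odd_card_of_char_ne_two fun h => h2 (by
      have := CharP.cast_eq_zero E (ringChar E); rw [h] at this; exact_mod_cast this))
  refine ⟨s, t, ?_⟩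
  simp at h
  linear_combination h

theorem adj_finite {E : Type*} [Field E] [Finite E] {p : E[X]} (hp : p ≠ 0) : Finite (AdjoinRoot p) := by
  have := (AdjoinRoot.powerBasis hp).finite
  exact Module.finite_of_finite E

theorem UP_fin {E : Type*} [Field E] [Finite E] (h2 : (2:E) ≠ 0) (p : E[X]) (hp : Irreducible p) : UP p := by
  intro a b ha hb
  haveI := Fact.mk hp
  haveI := adj_finite hp.ne_zero
  obtain ⟨s, t, h⟩ := UF_fin (E := AdjoinRoot p) (by
    rw [← map_ofNat (algebraMap E (AdjoinRoot p)) 2, Ne, FaithfulSMul.algebraMap_eq_zero_iff]; exact h2)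
    (AdjoinRoot.mk p a) (AdjoinRoot.mk p b) (by rwa [Ne, ← mk_dvd]) (by rwa [Ne, ← mk_dvd])
  obtain ⟨s, rfl⟩ := AdjoinRoot.mk_surjective s
  obtain ⟨t, rfl⟩ := AdjoinRoot.mk_surjective t
  refine ⟨s, t, ?_⟩
  rw [mk_dvd, map_sub, map_add, map_mul, map_mul, map_pow, map_pow, h, map_one, sub_self]

theorem fin_monic (E : Type*) [Field E] [Finite E] (N : ℕ) : {p : E[X] | p.Monic ∧ p.natDegree = N}.Finite := by
  have : Finite (degreeLT E (N + 1)) := Finite.of_equiv _ (degreeLTEquiv E (N + 1)).toEquiv.symm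
  refine Set.Finite.subset (Set.toFinite (degreeLT E (N + 1) : Set E[X])) ?_
  rintro p ⟨-, h⟩
  rw [SetLike.mem_coe, mem_degreeLT]
  exact (degree_le_of_natDegree_le h.le).trans_lt (by exact_mod_cast Nat.lt_succ_self N)

noncomputable def Mn (E : Type*) [Field E] [Finite E] (N : ℕ) : Finset E[X] := (fin_monic E N).toFinset

theorem mem_Mn {E : Type*} [Field E] [Finite E] {N : ℕ} {p : E[X]} : p ∈ Mn E N ↔ p.Monic ∧ p.natDegree = N := by
  simp [Mn]

open Classical in
noncomputable def dvs {E : Type*} [Field E] [Finite E] (m : E[X]) : Finset E[X] :=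
  {d ∈ (Finset.range (m.natDegree + 1)).biUnion (Mn E) | d ∣ m}

theorem mem_dvs {E : Type*} [Field E] [Finite E] {m d : E[X]} (hm : m ≠ 0) : d ∈ dvs m ↔ d.Monic ∧ d ∣ m := by
  simp only [dvs, Finset.mem_filter, Finset.mem_biUnion, Finset.mem_range, mem_Mn]
  constructor
  · rintro ⟨⟨_, _, h, _⟩, h'⟩
    exact ⟨h, h'⟩
  · rintro ⟨h, h'⟩
    exact ⟨⟨_, Nat.lt_succ_of_le (natDegree_le_of_dvd h' hm), h, rfl⟩, h'⟩

theorem msum_zero {E : Type*} [Field E] [Finite E] {c : E[X]} (hc : c.Monic) (χ : MulChar (AdjoinRoot c) ℤ)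
    (hχ : χ ≠ 1) (i : ℕ) (hi : c.natDegree ≤ i) : ∑ a ∈ Mn E i, χ (AdjoinRoot.mk c a) = 0 := by
  haveI := adj_finite hc.ne_zero
  cases nonempty_fintype (AdjoinRoot c)
  have hρ : ∀ t : AdjoinRoot c, ∃ ρ : E[X], AdjoinRoot.mk c ρ = t ∧ ρ.degree < c.degree := by
    intro t
    obtain ⟨a, rfl⟩ := AdjoinRoot.mk_surjective t
    refine ⟨a %ₘ c, ?_, degree_modByMonic_lt a hc⟩
    rw [← sub_eq_zero, ← map_sub, ← mk_dvd]
    exact ⟨-(a /ₘ c), by linear_combination modByMonic_add_div a c⟩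
  choose ρ h1 h3 using hρ
  have key : ∀ t, ∑ a ∈ Mn E i, χ (AdjoinRoot.mk c a) = ∑ a ∈ Mn E i, χ (AdjoinRoot.mk c a + t) := by
    intro t
    have aux : ∀ a ∈ Mn E i, ∀ r : E[X], r.degree < c.degree → a + r ∈ Mn E i := by
      intro a ha r hr
      rw [mem_Mn] at ha ⊢
      have : r.degree < a.degree := hr.trans_le (by
        rw [degree_eq_natDegree hc.ne_zero, degree_eq_natDegree ha.1.ne_zero, ha.2]; exact_mod_cast hi)
      exact ⟨ha.1.add_of_left this, by rw [natDegree_add_eq_left_of_degree_lt this, ha.2]⟩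
    refine Finset.sum_bij' (fun a _ => a - ρ t) (fun a _ => a + ρ t) ?_ ?_ ?_ ?_ ?_
    · intro a ha; rw [sub_eq_add_neg]; exact aux a ha _ (by rw [degree_neg]; exact h3 t)
    · intro a ha; exact aux a ha _ (h3 t)
    · intro a _; ring
    · intro a _; ring
    · intro a _; rw [map_sub, h1, sub_add_cancel]
  have h4 : ∑ t : AdjoinRoot c, ∑ a ∈ Mn E i, χ (AdjoinRoot.mk c a) = 0 := by
    rw [Finset.sum_congr rfl fun t _ => key t, Finset.sum_comm]
    refine Finset.sum_eq_zero fun a _ => ?_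
    rw [← MulChar.sum_eq_zero_of_ne_one hχ]
    exact Fintype.sum_equiv (Equiv.addLeft (AdjoinRoot.mk c a)) _ _ fun _ => rfl
  rw [Finset.sum_const, smul_eq_zero] at h4
  refine h4.resolve_left ?_
  have : Nontrivial (AdjoinRoot c) := by
    by_contra hn
    apply hχ
    rw [not_nontrivial_iff_subsingleton] at hn
    ext u
    rw [Subsingleton.elim u 1]; simp
  rw [Finset.card_univ]; exact Fintype.card_ne_zero

theorem sum_conv {E : Type*} [Field E] [Finite E] (f ψ : E[X] → ℤ) (hf : ∀ a b, f (a * b) = f a * f b) (N : ℕ) :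
    ∑ m ∈ Mn E N, f m * ∑ d ∈ dvs m, ψ d =
      ∑ i ∈ Finset.range (N + 1), (∑ a ∈ Mn E i, f a * ψ a) * ∑ b ∈ Mn E (N - i), f b := by
  simp_rw [Finset.sum_mul_sum, Finset.mul_sum, Finset.sum_sigma']
  symm
  refine Finset.sum_bij (fun x _ => ⟨x.2.1 * x.2.2, x.2.1⟩) ?_ ?_ ?_ ?_
  · rintro ⟨i, a, b⟩ h
    simp only [Finset.mem_sigma, Finset.mem_range, mem_Mn] at h ⊢
    obtain ⟨h1, ⟨h2, h3⟩, h4, h5⟩ := h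
    rw [mem_dvs (h2.mul h4).ne_zero, h2.natDegree_mul h4]
    exact ⟨⟨h2.mul h4, by omega⟩, h2, dvd_mul_right _ _⟩
  · rintro ⟨i, a, b⟩ h ⟨i', a', b'⟩ h' e
    simp only [Finset.mem_sigma, Finset.mem_range, mem_Mn] at h h'
    simp only [Sigma.mk.injEq, heq_eq_eq] at e
    obtain ⟨e1, rfl⟩ := e
    obtain rfl := mul_left_cancel₀ h.2.1.1.ne_zero e1
    obtain rfl : i = i' := by rw [← h.2.1.2, ← h'.2.1.2]
    rfl
  · rintro ⟨m, d⟩ h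
    simp only [Finset.mem_sigma, mem_Mn] at h
    obtain ⟨⟨h1, h2⟩, h3⟩ := h
    rw [mem_dvs h1.ne_zero] at h3
    obtain ⟨h3, b, rfl⟩ := h3
    have h4 : b.Monic := h3.of_mul_monic_left h1
    rw [h3.natDegree_mul h4] at h2
    refine ⟨⟨d.natDegree, d, b⟩, ?_, rfl⟩
    simp only [Finset.mem_sigma, Finset.mem_range, mem_Mn]
    exact ⟨by omega, ⟨h3, trivial⟩, h4, by omega⟩
  · rintro ⟨i, a, b⟩ h
    simp only [hf]; ring

theorem dvs_mul {E : Type*} [Field E] [Finite E] (ψ : E[X] → ℤ) (hψ : ∀ a b, ψ (a * b) = ψ a * ψ b) {x y : E[X]}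
    (h : IsCoprime x y) (hx : x ≠ 0) (hy : y ≠ 0) :
    ∑ d ∈ dvs (x * y), ψ d = (∑ d ∈ dvs x, ψ d) * ∑ d ∈ dvs y, ψ d := by
  rw [Finset.sum_mul_sum, ← Finset.sum_product']
  symm
  refine Finset.sum_bij (fun z _ => z.1 * z.2) ?_ ?_ ?_ ?_
  · rintro ⟨a, b⟩ hz
    rw [Finset.mem_product, mem_dvs hx, mem_dvs hy] at hz
    rw [mem_dvs (mul_ne_zero hx hy)]
    exact ⟨hz.1.1.mul hz.2.1, mul_dvd_mul hz.1.2 hz.2.2⟩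
  · rintro ⟨a, b⟩ hz ⟨a', b'⟩ hz' e
    rw [Finset.mem_product, mem_dvs hx, mem_dvs hy] at hz hz'
    have e : a * b = a' * b' := e
    have i1 : a ∣ a' := (h.of_isCoprime_of_dvd_left hz.1.2 |>.of_isCoprime_of_dvd_right hz'.2.2).dvd_of_dvd_mul_right
      (e ▸ dvd_mul_right a b)
    have i2 : a' ∣ a := (h.of_isCoprime_of_dvd_left hz'.1.2 |>.of_isCoprime_of_dvd_right hz.2.2).dvd_of_dvd_mul_right
      (e ▸ dvd_mul_right a' b')
    obtain rfl := eq_of_monic_of_associated hz.1.1 hz'.1.1 (associated_of_dvd_dvd i1 i2)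
    obtain rfl := mul_left_cancel₀ hz.1.1.ne_zero e
    rfl
  · intro d hd
    rw [mem_dvs (mul_ne_zero hx hy)] at hd
    obtain ⟨hd, hdd⟩ := hd
    obtain ⟨a, b, ha, hb, rfl⟩ := exists_dvd_and_dvd_of_dvd_mul hdd
    have hab := hd.ne_zero
    rw [mul_ne_zero_iff] at hab
    have hl : a.leadingCoeff * b.leadingCoeff = 1 := by rw [← leadingCoeff_mul]; exact hd
    have hl' := leadingCoeff_ne_zero.2 hab.1
    refine ⟨⟨a * C a.leadingCoeff⁻¹, b * C b.leadingCoeff⁻¹⟩, ?_, ?_⟩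
    · rw [Finset.mem_product, mem_dvs hx, mem_dvs hy]
      have u : ∀ t : E[X], t ≠ 0 → IsUnit (C t.leadingCoeff⁻¹) := fun t ht =>
        isUnit_C.2 (isUnit_iff_ne_zero.2 (inv_ne_zero (leadingCoeff_ne_zero.2 ht)))
      exact ⟨⟨monic_mul_leadingCoeff_inv hab.1, (u a hab.1).mul_right_dvd.2 ha⟩,
        monic_mul_leadingCoeff_inv hab.2, (u b hab.2).mul_right_dvd.2 hb⟩
    · have : C a.leadingCoeff⁻¹ * C b.leadingCoeff⁻¹ = (1 : E[X]) := by
        rw [← C_mul, ← mul_inv, hl, inv_one, C_1]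
      linear_combination a * b * this
  · rintro ⟨a, b⟩ _
    exact (hψ a b).symm

theorem r_prop {E : Type*} [Field E] [Finite E] (ψ : E[X] → ℤ) (hψ : ∀ a b, ψ (a * b) = ψ a * ψ b) (h1 : ψ 1 = 1)
    (h3 : ∀ a, ψ a = 0 ∨ ψ a = 1 ∨ ψ a = -1) (m : E[X]) : m ≠ 0 → 0 ≤ ∑ d ∈ dvs m, ψ d ∧
    (∑ d ∈ dvs m, ψ d ≠ 0 → ∀ p, p.Monic → Irreducible p → Odd (multiplicity p m) → ψ p ≠ -1) ∧
    ((∀ p, Irreducible p → Even (multiplicity p m)) → 1 ≤ ∑ d ∈ dvs m, ψ d) := by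
  classical
  have hpow : ∀ p k, ψ (p ^ k) = ψ p ^ k := by
    intro p k
    induction k with
    | zero => simpa using h1
    | succ k ih => rw [pow_succ, hψ, ih, pow_succ]
  refine UniqueFactorizationMonoid.induction_on_coprime m (fun h => absurd rfl h) ?_ ?_ ?_
  · intro x hx h0
    have : dvs x = {1} := by
      ext d
      rw [mem_dvs h0, Finset.mem_singleton]
      constructor
      · rintro ⟨h, h'⟩
        exact h.eq_one_of_isUnit (isUnit_of_dvd_unit h' hx)
      · rintro rfl
        exact ⟨monic_one, one_dvd _⟩
    rw [this, Finset.sum_singleton, h1]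
    refine ⟨by norm_num, fun _ p _ hp ho => ?_, fun _ => le_rfl⟩
    rw [multiplicity_eq_zero.2 fun h => hp.not_isUnit (isUnit_of_dvd_unit h hx)] at ho
    simp at ho
  · intro p k hp h0
    obtain ⟨q, hq, hqa⟩ : ∃ q : E[X], q.Monic ∧ Associated q p := by
      obtain ⟨q, hq, h⟩ := exists_monic_assoc hp.ne_zero
      exact ⟨q, hq, h.symm⟩
    have hqi : Irreducible q := hqa.irreducible_iff.2 hp.irreducible
    have hs : ∑ d ∈ dvs (p ^ k), ψ d = ∑ j ∈ Finset.range (k + 1), ψ q ^ j := by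
      have : dvs (p ^ k) = (Finset.range (k + 1)).image (fun j => q ^ j) := by
        ext d
        rw [mem_dvs h0, Finset.mem_image, (hqa.symm.pow_pow (n := k)).dvd_iff_dvd_right]
        simp only [Finset.mem_range]
        constructor
        · rintro ⟨h, h'⟩
          obtain ⟨j, hj, h'⟩ := (dvd_prime_pow hqi.prime k).1 h'
          exact ⟨j, by omega, (eq_of_monic_of_associated h (hq.pow j) h').symm⟩
        · rintro ⟨j, hj, rfl⟩
          exact ⟨hq.pow j, pow_dvd_pow _ (by omega)⟩
      rw [this, Finset.sum_image]
      · exact Finset.sum_congr rfl fun j _ => hpow q j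
      · intro i _ j _ e
        have e := congrArg natDegree e
        simp only [natDegree_pow] at e
        exact Nat.eq_of_mul_eq_mul_right hqi.natDegree_pos e
    have hmq : multiplicity q (p ^ k) = k := by
      rw [multiplicity_eq_of_associated_right (hqa.symm.pow_pow (n := k)), multiplicity_pow_self hq.ne_zero hqi.not_isUnit]
    have hodd : ∀ r : E[X], r.Monic → Irreducible r → Odd (multiplicity r (p ^ k)) → r = q := by
      intro r hr hri ho
      have : r ∣ p ^ k := by
        by_contra hn
        rw [multiplicity_eq_zero.2 hn] at ho
        simp at ho
      exact eq_of_monic_of_associated hr hq ((hri.associated_of_dvd hp.irreducible (hri.prime.dvd_of_dvd_pow this)).trans hqa.symm)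
    rw [hs]
    rcases h3 q with h | h | h
    · have : ∑ j ∈ Finset.range (k + 1), ψ q ^ j = 1 := by rw [h, Finset.sum_range_succ']; simp
      rw [this]
      refine ⟨by norm_num, fun _ r hr hri ho => ?_, fun _ => le_rfl⟩
      rw [hodd r hr hri ho, h]; norm_num
    · have : ∑ j ∈ Finset.range (k + 1), ψ q ^ j = k + 1 := by rw [h]; simp
      rw [this]
      refine ⟨by positivity, fun _ r hr hri ho => ?_, fun _ => by omega⟩
      rw [hodd r hr hri ho, h]; norm_num
    · rw [h, neg_one_geom_sum]
      refine ⟨by split_ifs <;> norm_num, fun h r hr hri ho => ?_, fun he => ?_⟩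
      · exfalso
        rw [hodd r hr hri ho, hmq] at ho
        exact h (if_pos ho.add_one)
      · have := he q hqi
        rw [hmq] at this
        rw [if_neg]
        rw [Nat.not_even_iff_odd]; exact this.add_one
  · intro x y hxy hx hy h0
    rw [mul_ne_zero_iff] at h0
    obtain ⟨x1, x2, x3⟩ := hx h0.1
    obtain ⟨y1, y2, y3⟩ := hy h0.2
    rw [isRelPrime_iff_isCoprime] at hxy
    rw [dvs_mul ψ hψ hxy h0.1 h0.2]
    refine ⟨mul_nonneg x1 y1, fun hn p hpm hp ho => ?_, fun he => ?_⟩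
    · rw [mul_ne_zero_iff] at hn
      rw [mult_mul hp h0.1 h0.2, Nat.odd_add] at ho
      by_cases hox : Odd (multiplicity p x)
      · exact x2 hn.1 p hpm hp hox
      · exact y2 hn.2 p hpm hp (Nat.not_even_iff_odd.1 fun h => hox (ho.2 h))
    · have aux : ∀ p, Irreducible p → multiplicity p x = 0 ∨ multiplicity p y = 0 := by
        intro p hp
        by_cases h : p ∣ x
        · exact Or.inr (multiplicity_eq_zero.2 (cop_nd hp hxy h))
        · exact Or.inl (multiplicity_eq_zero.2 h)
      refine one_le_mul_of_one_le_of_one_le (x3 fun p hp => ?_) (y3 fun p hp => ?_)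
      · have := he p hp
        rw [mult_mul hp h0.1 h0.2] at this
        rcases aux p hp with h | h <;> simp_all
      · have := he p hp
        rw [mult_mul hp h0.1 h0.2] at this
        rcases aux p hp with h | h <;> simp_all

/-- a norm which is a square comes from a square -/
theorem sq_of_nrm {E : Type*} [Field E] [Finite E] (h2 : (2:E) ≠ 0) {p x : E[X]} (hp : Irreducible p)
    (hx : ¬ p ∣ x) (h : IsSquare (nrm p x)) : ∃ s, p ∣ x - s ^ 2 := by
  haveI := Fact.mk hp
  haveI := adj_finite hp.ne_zero
  cases nonempty_fintype E
  cases nonempty_fintype (AdjoinRoot p)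
  have r2 : ∀ (F : Type _) [Field F], (2:F) ≠ 0 → ringChar F ≠ 2 := fun F _ h2 h => h2 (by
      have := CharP.cast_eq_zero F (ringChar F); rw [h] at this; exact_mod_cast this)
  have h2' : (2 : AdjoinRoot p) ≠ 0 := by
    rw [← map_ofNat (algebraMap E (AdjoinRoot p)) 2, Ne, FaithfulSMul.algebraMap_eq_zero_iff]; exact h2
  have hx' : AdjoinRoot.mk p x ≠ 0 := by rwa [Ne, ← mk_dvd]
  have hn : nrm p x ≠ 0 := nrm_ne_zero p x hp.ne_zero ((hp.coprime_iff_not_dvd).2 hx)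
  rw [FiniteField.isSquare_iff (r2 E h2) hn] at h
  have : IsSquare (AdjoinRoot.mk p x) := by
    rw [FiniteField.isSquare_iff (r2 _ h2') hx']
    have e := congrArg (algebraMap E (AdjoinRoot p)) h
    rw [map_pow, map_one, nrm_eq_adj, FiniteField.algebraMap_norm_eq_pow, ← pow_mul] at e
    rw [← e]
    congr 1
    rw [Nat.card_eq_fintype_card, Nat.card_eq_fintype_card]
    have o1 := FiniteField.odd_card_of_char_ne_two (r2 E h2)
    have o2 := FiniteField.odd_card_of_char_ne_two (r2 _ h2')
    have hd : Fintype.card E - 1 ∣ Fintype.card (AdjoinRoot p) - 1 := by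
      rw [Module.card_eq_pow_finrank (K := E) (V := AdjoinRoot p)]
      simpa using Nat.sub_dvd_pow_sub_pow (Fintype.card E) 1 (Module.finrank E (AdjoinRoot p))
    obtain ⟨k, hk⟩ := hd
    have : 0 < Fintype.card E - 1 := Nat.sub_pos_of_lt Fintype.one_lt_card
    rw [hk, Nat.mul_div_cancel_left _ this]
    obtain ⟨u, hu⟩ : ∃ u, Fintype.card E = 2 * u + 1 := ⟨Fintype.card E / 2, by omega⟩
    have hq : Fintype.card (AdjoinRoot p) = 2 * (u * k) + 1 := by
      have : 0 < Fintype.card (AdjoinRoot p) := Fintype.card_pos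
      rw [hu, Nat.add_sub_cancel, mul_assoc] at hk
      omega
    rw [hq, hu, show (2 * (u * k) + 1) / 2 = u * k by omega, show (2 * u + 1) / 2 = u by omega, mul_comm]
  obtain ⟨s, hs⟩ := this
  obtain ⟨s, rfl⟩ := AdjoinRoot.mk_surjective s
  exact ⟨s, by rw [mk_dvd, map_sub, hs, map_pow]; ring⟩

def Good {E : Type*} [Field E] (h g : E[X]) : Prop :=
  g ≠ 0 ∧ ∀ p, Irreducible p → Odd (multiplicity p g) → ∃ s, p ∣ h - s ^ 2

theorem Good.mul {E : Type*} [Field E] {h g g' : E[X]} (hg : Good h g) (hg' : Good h g') : Good h (g * g') := by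
  refine ⟨mul_ne_zero hg.1 hg'.1, fun p hp ho => ?_⟩
  rw [mult_mul hp hg.1 hg'.1, Nat.odd_add] at ho
  by_cases h : Odd (multiplicity p g)
  · exact hg.2 p hp h
  · exact hg'.2 p hp (Nat.not_even_iff_odd.1 fun h' => h (ho.2 h'))

theorem Good.sq {E : Type*} [Field E] {h g : E[X]} (hg : g ≠ 0) : Good h (g ^ 2) := by
  refine ⟨pow_ne_zero 2 hg, fun p hp ho => ?_⟩
  rw [pow_two, mult_mul hp hg hg] at ho
  exact absurd ho (by rw [Nat.not_odd_iff_even]; exact Even.add_self _)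

theorem Good.unit {E : Type*} [Field E] {h g : E[X]} (hg : IsUnit g) : Good h g := by
  refine ⟨hg.ne_zero, fun p hp ho => ?_⟩
  rw [multiplicity_eq_zero.2 fun h => hp.not_isUnit (isUnit_of_dvd_unit h hg)] at ho
  simp at ho

theorem crt_sq {E : Type*} [Field E] (h g : E[X]) : Squarefree g →
    (∀ p, Irreducible p → p ∣ g → ∃ s, p ∣ h - s ^ 2) → ∃ s, g ∣ h - s ^ 2 := by
  refine WfDvdMonoid.induction_on_irreducible g ?_ ?_ ?_
  · intro h; exact absurd h not_squarefree_zero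
  · intro u hu _ _; exact ⟨0, hu.dvd⟩
  · intro a i ha hi ih hs H
    obtain ⟨s, h1⟩ := ih hs.of_mul_right fun p hp hpa => H p hp (hpa.mul_left _)
    obtain ⟨t, h2⟩ := H i hi (dvd_mul_right _ _)
    have hc : IsCoprime i a := sqf_cop hs
    obtain ⟨w, w1, w2⟩ := crt2 hc t s
    refine ⟨w, hc.mul_dvd ?_ ?_⟩
    · have := dvd_sub h2 (w1.mul_right (w + t))
      convert this using 1; ring
    · have := dvd_sub h1 (w2.mul_right (w + s))
      convert this using 1; ring

theorem good_sqf {E : Type*} [Field E] {h g : E[X]} (hg : Good h g) :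
    ∃ m g0 s : E[X], m ≠ 0 ∧ g = m ^ 2 * g0 ∧ g0 ≠ 0 ∧ g0 ∣ h - s ^ 2 := by
  obtain ⟨m, g0, hm, hs, rfl⟩ := exists_sq_mul_sqf g hg.1
  obtain ⟨s, hss⟩ := crt_sq h g0 hs (fun p hp hpg => hg.2 p hp (by
    rw [mult_sq hp hm hs.ne_zero]
    have : multiplicity p g0 = 1 := by
      obtain ⟨b, rfl⟩ := hpg
      have hb := hs.ne_zero
      rw [mul_ne_zero_iff] at hb
      rw [mult_mul hp hb.1 hb.2, multiplicity_self, multiplicity_eq_zero.2 fun ⟨d, hd⟩ =>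
        hp.not_isUnit (hs p ⟨d, by rw [hd]; ring⟩)]
    rw [this]
    exact odd_two_mul_add_one _))
  exact ⟨m, g0, s, hm, rfl, hs.ne_zero, hss⟩

theorem unit_adj {E : Type*} [Field E] {c m : E[X]} : IsUnit (AdjoinRoot.mk c m) ↔ IsCoprime c m := by
  constructor
  · intro h
    obtain ⟨y, hy⟩ := h.exists_right_inv
    obtain ⟨y, rfl⟩ := AdjoinRoot.mk_surjective y
    rw [← map_mul, ← map_one (AdjoinRoot.mk c), ← sub_eq_zero, ← map_sub, ← mk_dvd] at hy
    obtain ⟨k, hk⟩ := hy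
    exact ⟨-k, y, by linear_combination hk⟩
  · rintro ⟨a, b, h⟩
    refine IsUnit.of_mul_eq_one (AdjoinRoot.mk c b) ?_
    have := congrArg (AdjoinRoot.mk c) h
    rw [map_add, map_mul, AdjoinRoot.mk_self, mul_zero, zero_add, map_one, map_mul, mul_comm] at this
    exact this

/-- separation by quadratic characters -/
theorem exists_qchar {G : Type*} [CommGroup G] [Finite G] (H : Subgroup G) (hH : ∀ g, g ^ 2 ∈ H) (a : G) (ha : a ∉ H) :
    ∃ φ : G →* ℤˣ, (∀ h ∈ H, φ h = 1) ∧ φ a ≠ 1 := by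
  have ha' : (QuotientGroup.mk a : G ⧸ H) ≠ 1 := by rwa [Ne, QuotientGroup.eq_one_iff]
  have hex : Monoid.exponent (G ⧸ H) = 2 := by
    have hd : Monoid.exponent (G ⧸ H) ∣ 2 := by
      rw [Monoid.exponent_dvd_iff_forall_pow_eq_one]
      intro g
      obtain ⟨g, rfl⟩ := QuotientGroup.mk_surjective g
      rw [← QuotientGroup.mk_pow, QuotientGroup.eq_one_iff]
      exact hH g
    rcases (Nat.dvd_prime Nat.prime_two).1 hd with h | h
    · exfalso
      apply ha'
      have := Monoid.pow_exponent_eq_one (QuotientGroup.mk a : G ⧸ H)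
      rwa [h, pow_one] at this
    · exact h
  haveI : HasEnoughRootsOfUnity ℤ (Monoid.exponent (G ⧸ H)) := by
    rw [hex]
    exact ⟨⟨-1, IsPrimitiveRoot.neg_one 0 (by norm_num)⟩, inferInstance⟩
  obtain ⟨φ, hφ⟩ := CommGroup.exists_apply_ne_one_of_hasEnoughRootsOfUnity (G ⧸ H) ℤ ha'
  refine ⟨φ.comp (QuotientGroup.mk' H), fun h hh => ?_, hφ⟩
  rw [MonoidHom.comp_apply, QuotientGroup.mk'_apply, (QuotientGroup.eq_one_iff h).2 hh, map_one]

set_option maxHeartbeats 1000000 in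
theorem good_all {E : Type*} [Field E] [Finite E] (h2 : (2:E) ≠ 0) {c : E[X]} (hc : c.Monic) (hD : Odd c.natDegree)
    (α : E[X]) (hα : IsCoprime c α) : ∃ g, Good (-c) g ∧ c ∣ g - α := by
  classical
  cases nonempty_fintype E
  haveI := adj_finite hc.ne_zero
  have hnt : Nontrivial (AdjoinRoot c) := AdjoinRoot.nontrivial c (by
    intro h
    have h0 : c.natDegree = 0 := natDegree_eq_of_degree_eq_some h
    rw [h0] at hD; exact absurd hD (by decide))
  have n0 : ∀ m : E[X], IsUnit (AdjoinRoot.mk c m) → m ≠ 0 := by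
    rintro m hm rfl; rw [map_zero] at hm; exact not_isUnit_zero hm
  have r2 : ringChar E ≠ 2 := fun h => h2 (by
      have := CharP.cast_eq_zero E (ringChar E); rw [h] at this; exact_mod_cast this)
  let H : Subgroup (AdjoinRoot c)ˣ :=
    { carrier := {u | ∃ g, Good (-c) g ∧ AdjoinRoot.mk c g = u}
      mul_mem' := by
        rintro u v ⟨g, h, e⟩ ⟨g', h', e'⟩
        exact ⟨g * g', h.mul h', by rw [map_mul, e, e', Units.val_mul]⟩
      one_mem' := ⟨1, Good.unit isUnit_one, by simp⟩
      inv_mem' := by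
        rintro u ⟨g, h, e⟩
        obtain ⟨w, hw⟩ := AdjoinRoot.mk_surjective (u⁻¹ : (AdjoinRoot c)ˣ).val
        refine ⟨g * w ^ 2, h.mul (Good.sq (n0 w (hw ▸ Units.isUnit _))), ?_⟩
        rw [map_mul, map_pow, e, hw, pow_two, ← mul_assoc, Units.mul_inv, one_mul] }
  by_contra hcon
  have hα' := unit_adj.2 hα
  obtain ⟨φ, hφ, hφα⟩ := exists_qchar H (by
    intro u
    obtain ⟨w, hw⟩ := AdjoinRoot.mk_surjective u.val
    exact ⟨w ^ 2, Good.sq (n0 w (hw ▸ Units.isUnit _)), by rw [map_pow, hw, Units.val_pow_eq_pow_val]⟩) hα'.unit (by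
    rintro ⟨g, h, e⟩
    exact hcon ⟨g, h, by rw [mk_dvd, map_sub, e, IsUnit.unit_spec, sub_self]⟩)
  let χ : MulChar (AdjoinRoot c) ℤ := MulChar.ofUnitHom φ
  have hχg : ∀ g, Good (-c) g → IsCoprime c g → χ (AdjoinRoot.mk c g) = 1 := by
    intro g hg hcg
    have hu := unit_adj.2 hcg
    have : φ hu.unit = 1 := hφ _ ⟨g, hg, rfl⟩
    rw [← hu.unit_spec, MulChar.ofUnitHom_coe, this, Units.val_one]
  have hχ1 : χ ≠ 1 := by
    intro h
    have : χ hα'.unit = 1 := by rw [h, MulChar.one_apply_coe]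
    rw [MulChar.ofUnitHom_coe] at this
    exact hφα (Units.val_eq_one.1 this)
  let ψ : MulChar (AdjoinRoot c) ℤ :=
    MulChar.ofUnitHom ((quadraticChar E).toUnitHom.comp (Units.map (Algebra.norm E)))
  have hψ : ∀ m, IsCoprime c m → ψ (AdjoinRoot.mk c m) = quadraticChar E (nrm c m) := by
    intro m hm
    have hu := unit_adj.2 hm
    rw [← hu.unit_spec, MulChar.ofUnitHom_coe]
    rfl
  have hψ0 : ∀ m, ψ (AdjoinRoot.mk c m) = 0 ∨ ψ (AdjoinRoot.mk c m) = 1 ∨ ψ (AdjoinRoot.mk c m) = -1 := by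
    intro m
    by_cases hm : IsCoprime c m
    · rw [hψ m hm]; exact quadraticChar_isQuadratic E _
    · exact Or.inl (ψ.map_nonunit fun h => hm (unit_adj.1 h))
  have hχψ : χ * ψ ≠ 1 := by
    intro h
    obtain ⟨ε, hε⟩ := quadraticChar_exists_neg_one' r2
    have hu : IsUnit (C (ε : E)) := isUnit_C.2 ε.isUnit
    have hcu : IsCoprime c (C (ε : E)) := unit_adj.1 (hu.map (AdjoinRoot.mk c))
    have e : (χ * ψ) (AdjoinRoot.mk c (C (ε : E))) = 1 := by
      rw [h, MulChar.one_apply (unit_adj.2 hcu)]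
    rw [MulChar.mul_apply, hχg _ (Good.unit hu) hcu, hψ _ hcu, nrm_C c hc.ne_zero, map_pow, hε, hD.neg_one_pow] at e
    norm_num at e
  have hrp := r_prop (E := E) (fun m => ψ (AdjoinRoot.mk c m)) (by intro a b; rw [map_mul, map_mul]) (by
    rw [map_one, map_one]) hψ0
  have hS := sum_conv (E := E) (fun m => χ (AdjoinRoot.mk c m)) (fun m => ψ (AdjoinRoot.mk c m))
    (by intro a b; rw [map_mul, map_mul]) (2 * c.natDegree)
  have hzero : ∑ m ∈ Mn E (2 * c.natDegree), χ (AdjoinRoot.mk c m) * ∑ d ∈ dvs m, ψ (AdjoinRoot.mk c d) = 0 := by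
    rw [hS]
    refine Finset.sum_eq_zero fun i hi => ?_
    by_cases h : c.natDegree ≤ i
    · have := msum_zero hc (χ * ψ) hχψ i h
      simp only [MulChar.mul_apply] at this
      rw [this, zero_mul]
    · rw [msum_zero hc χ hχ1 _ (by omega), mul_zero]
  have hnn : ∀ m ∈ Mn E (2 * c.natDegree), 0 ≤ χ (AdjoinRoot.mk c m) * ∑ d ∈ dvs m, ψ (AdjoinRoot.mk c d) := by
    intro m hm
    rw [mem_Mn] at hm
    obtain ⟨m1, m2, -⟩ := hrp m hm.1.ne_zero
    by_cases hr : ∑ d ∈ dvs m, ψ (AdjoinRoot.mk c d) = 0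
    · rw [hr, mul_zero]
    by_cases hcm : IsCoprime c m
    · rw [hχg m ⟨hm.1.ne_zero, fun p hp ho => ?_⟩ hcm, one_mul]
      · exact m1
      obtain ⟨q, hq, hpq⟩ := exists_monic_assoc hp.ne_zero
      have hqi : Irreducible q := hpq.irreducible hp
      have hqm : q ∣ m := by
        rw [← hpq.dvd_iff_dvd_left]
        by_contra hn
        rw [multiplicity_eq_zero.2 hn] at ho
        simp at ho
      rw [multiplicity_eq_of_associated_left hpq.symm] at ho
      have hne := m2 hr q hq hqi ho
      have hcq : IsCoprime c q := hcm.of_isCoprime_of_dvd_right hqm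
      have hqc : nrm c q = nrm q (-c) := by
        have := nrm_recip c q hc.ne_zero hq.ne_zero
        rw [hc.leadingCoeff, hq.leadingCoeff, one_pow, one_pow, one_mul, one_mul, pow_mul, hD.neg_one_pow] at this
        rw [this, neg_eq_neg_one_mul c, nrm_mul_right, show (-1 : E[X]) = C (-1) by simp, nrm_C q hq.ne_zero]
      have hq0 := nrm_ne_zero c q hc.ne_zero hcq
      rw [hψ q hcq] at hne
      have h1 := (quadraticChar_dichotomy hq0).resolve_right hne
      rw [quadraticChar_one_iff_isSquare hq0, hqc] at h1
      obtain ⟨s, hs⟩ := sq_of_nrm h2 hqi (fun h => cop_nd hqi hcq.symm dvd_rfl ((dvd_neg).1 h)) h1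
      exact ⟨s, hpq.dvd.trans hs⟩
    · rw [χ.map_nonunit fun h => hcm (unit_adj.1 h), zero_mul]
  have hm1 : (c + 1).Monic := hc.add_of_left (by
    rw [degree_one, degree_eq_natDegree hc.ne_zero]; exact_mod_cast hD.pos)
  have hmd : (c + 1).natDegree = c.natDegree := by rw [← C_1, natDegree_add_C]
  have hcop : IsCoprime c ((c + 1) ^ 2) := IsCoprime.pow_right ⟨-1, 1, by ring⟩
  have hpos := (hrp ((c + 1) ^ 2) (hm1.pow 2).ne_zero).2.2 (by
    intro p hp
    rw [pow_two, mult_mul hp hm1.ne_zero hm1.ne_zero]; exact Even.add_self _)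
  have h5 := (Finset.sum_eq_zero_iff_of_nonneg hnn).1 hzero ((c + 1) ^ 2) (mem_Mn.2 ⟨hm1.pow 2, by
    rw [natDegree_pow, hmd]⟩)
  rw [hχg _ (Good.sq hm1.ne_zero) hcop, one_mul] at h5
  omega

theorem odd_ext {E : Type*} [Field E] (T : E[X]) (hT : T ≠ 0) :
    ∃ c : E[X], c.Monic ∧ Squarefree c ∧ Odd c.natDegree ∧ ∀ f, Squarefree f → f ∣ T → f ∣ c := by
  classical
  have key : ∃ c : E[X], Squarefree c ∧ Odd c.natDegree ∧ ∀ f, Squarefree f → f ∣ T → f ∣ c := by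
    obtain ⟨R, hR⟩ : ∃ R, R = UniqueFactorizationMonoid.radical T := ⟨_, rfl⟩
    have hRs : Squarefree R := hR ▸ UniqueFactorizationMonoid.squarefree_radical
    have hdiv : ∀ f, Squarefree f → f ∣ T → f ∣ R := fun f hf hfT =>
      hR ▸ (UniqueFactorizationMonoid.dvd_radical_iff hf.isRadical hT).2 hfT
    rcases Nat.even_or_odd R.natDegree with he | ho
    · have hf : (R * X + 1).natDegree = R.natDegree + 1 := by
        rw [← C_1, natDegree_add_C, natDegree_mul_X hRs.ne_zero]
      have hf0 : R * X + 1 ≠ 0 := by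
        intro h; rw [h, natDegree_zero] at hf; omega
      obtain ⟨m, f0, hm, hs, e⟩ := exists_sq_mul_sqf _ hf0
      have hc : IsCoprime R f0 := ⟨-X, m ^ 2, by linear_combination -e⟩
      refine ⟨R * f0, ?_, ?_, fun f h1 h2 => (hdiv f h1 h2).mul_right _⟩
      · rw [squarefree_mul_iff]; exact ⟨hc.isRelPrime, hRs, hs⟩
      · rw [natDegree_mul hRs.ne_zero hs.ne_zero]
        rw [e, natDegree_mul (pow_ne_zero _ hm) hs.ne_zero, natDegree_pow] at hf
        rw [Nat.even_iff] at he
        rw [Nat.odd_iff]; omega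
    · exact ⟨R, hRs, ho, hdiv⟩
  obtain ⟨c, h1, h2, h3⟩ := key
  obtain ⟨q, hq, ha⟩ := exists_monic_assoc h1.ne_zero
  refine ⟨q, hq, h1.squarefree_of_dvd ha.symm.dvd, ?_, fun f hf h => (h3 f hf h).trans ha.dvd⟩
  rw [← natDegree_eq_of_degree_eq (degree_eq_degree_of_associated ha)]; exact h2

theorem slots_poly_fin {E : Type*} [Field E] [Finite E] (h2 : (2:E) ≠ 0) (n : ℕ)
    (A B : Fin n → E[X]) (hA : ∀ i, A i ≠ 0) (hB : ∀ i, B i ≠ 0) :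
    ∃ h : E[X], h ≠ 0 ∧ ∀ i, Slot (A i) (B i) h := by
  classical
  obtain ⟨T, hT⟩ : ∃ T, T = ∏ i, (A i * B i) := ⟨_, rfl⟩
  have hT0 : T ≠ 0 := by
    rw [hT]
    exact Finset.prod_ne_zero_iff.2 fun i _ => mul_ne_zero (hA i) (hB i)
  obtain ⟨c, hcm, hcs, hco, hdiv⟩ := odd_ext T hT0
  refine ⟨-c, neg_ne_zero.2 hcs.ne_zero, fun i => ?_⟩
  obtain ⟨x, y, z, s, t, hsq, hs, ht, eA, eB⟩ := exists_NF (A i) (B i) (hA i) (hB i)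
  have hd : x * y * z ∣ A i * B i := ⟨z * s ^ 2 * t ^ 2, by rw [eA, eB]; ring⟩
  have hd' : x * y * z ∣ -c := (dvd_neg).2 (hdiv _ hsq (by
    rw [hT]
    exact hd.trans (Finset.dvd_prod_of_mem (fun i => A i * B i) (Finset.mem_univ i))))
  obtain ⟨k, hk⟩ := hd'
  have hcE : c = -(x * y * z * k) := by rw [← hk, neg_neg]
  have hsq' : Squarefree (x * y * z * k) := hcs.squarefree_of_dvd ⟨-1, by rw [hcE]; ring⟩
  have h0 := hsq.ne_zero
  simp only [mul_ne_zero_iff] at h0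
  obtain ⟨⟨hx0, hy0⟩, hz0⟩ := h0
  have hsq2 := hsq'
  simp only [squarefree_mul_iff, isRelPrime_iff_isCoprime, IsCoprime.mul_left_iff] at hsq2
  obtain ⟨⟨⟨cxk, cyk⟩, czk⟩, ⟨⟨cxz, cyz⟩, ⟨cxy, _⟩, _⟩, _⟩ := hsq2
  obtain ⟨c1, h11, h12⟩ := crt2 cxy (-(y * z)) (-(x * z))
  obtain ⟨c2, h21, h22⟩ := crt2 (cxz.mul_left cyz) c1 (-(x * y))
  obtain ⟨α, h31, h32⟩ := crt2 ((cxk.mul_left cyk).mul_left czk) c2 1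
  have hαx : x ∣ α - -(y * z) := by
    have e1 : x ∣ α - c2 := (Dvd.intro _ (by ring : x * (y * z) = x * y * z)).trans h31
    have e2 : x ∣ c2 - c1 := (dvd_mul_right _ _).trans h21
    have := dvd_add (dvd_add e1 e2) h11
    convert this using 1; ring
  have hαy : y ∣ α - -(x * z) := by
    have e1 : y ∣ α - c2 := (Dvd.intro _ (by ring : y * (x * z) = x * y * z)).trans h31
    have e2 : y ∣ c2 - c1 := (dvd_mul_left _ _).trans h21
    have := dvd_add (dvd_add e1 e2) h12
    convert this using 1; ring
  have hαz : z ∣ α - -(x * y) := by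
    have e1 : z ∣ α - c2 := (dvd_mul_left _ _).trans h31
    have := dvd_add e1 h22
    convert this using 1; ring
  have cop : ∀ {a b c : E[X]}, a ∣ b - c → IsCoprime a c → IsCoprime a b := by
    rintro a b c ⟨q, hq⟩ ⟨m, n, hmn⟩
    exact ⟨m - n * q, n, by linear_combination hmn + n * hq⟩
  have hcop : IsCoprime (x * y * z * k) α := by
    refine IsCoprime.mul_left (IsCoprime.mul_left (IsCoprime.mul_left ?_ ?_) ?_) ?_
    · exact cop hαx (cxy.mul_right cxz).neg_right
    · exact cop hαy (cxy.symm.mul_right cyz).neg_right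
    · exact cop hαz (cxz.symm.mul_right cyz.symm).neg_right
    · exact cop h32 isCoprime_one_right
  obtain ⟨G, hG, hGα⟩ := good_all h2 hcm hco α (by rw [hcE]; exact hcop.neg_left)
  obtain ⟨m, g, r, hm, eG, hg0, hgr⟩ := good_sqf hG
  rw [hk] at hgr
  rw [hcE, neg_dvd] at hGα
  have hGc : IsCoprime (x * y * z * k) G := cop hGα hcop
  rw [eG] at hGc hGα
  have hg : IsCoprime (x * y * z * k) g := hGc.of_mul_right_right
  obtain ⟨u, β, huβ⟩ := (IsCoprime.pow_right_iff (by norm_num : 0 < 2)).1 hGc.of_mul_right_left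
  have hgα : x * y * z * k ∣ g - α * β ^ 2 := by
    obtain ⟨q, hq⟩ := hGα
    refine ⟨q * β ^ 2 + g * u * (1 + β * m), ?_⟩
    linear_combination (β ^ 2) * hq - g * (1 + β * m) * huβ
  have fin : ∀ {a c : E[X]}, a ∣ x * y * z * k → a ∣ α - c → a ∣ g - c * β ^ 2 := by
    intro a c h1 h2
    have := dvd_add (h1.trans hgα) (h2.mul_right (β ^ 2))
    convert this using 1; ring
  rw [eA, eB, hk]
  refine slot_of_L hz0 hs ht (thmL h2 (UF_fin h2) x y z k g r hsq' hg hg0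
    (fun p hp _ => UP_fin h2 p hp) hgr ⟨β, ?_⟩ ⟨β, ?_⟩ ⟨β, ?_⟩ ⟨β, ?_⟩)
  · have := fin ⟨y * z * k, by ring⟩ hαx
    convert this using 1; ring
  · have := fin ⟨x * z * k, by ring⟩ hαy
    convert this using 1; ring
  · have := fin ⟨x * y * k, by ring⟩ hαz
    convert this using 1; ring
  · have := fin ⟨x * y * z, by ring⟩ h32
    convert this using 1; ring

theorem slots_fin {E : Type*} [Field E] [Finite E] (h2 : (2:E) ≠ 0) (n : ℕ)
    (a b : Fin n → RatFunc E) (ha : ∀ i, a i ≠ 0) (hb : ∀ i, b i ≠ 0) :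
    ∃ c, c ≠ 0 ∧ ∀ i, Slot (a i) (b i) c := by
  choose A s hA hs ea using fun i => rat_poly (a i) (ha i)
  choose B t hB ht eb using fun i => rat_poly (b i) (hb i)
  obtain ⟨h, hsq, hsl⟩ := slots_poly_fin h2 n A B hA hB
  obtain ⟨σ, hσe⟩ : ∃ φ, φ = algebraMap E[X] (RatFunc E) := ⟨_, rfl⟩
  have hσ : ∀ f, f ≠ 0 → σ f ≠ 0 := fun f hf h => hf (by
    rw [hσe, FaithfulSMul.algebraMap_eq_zero_iff] at h; exact h)
  refine ⟨σ h, hσ h hsq, fun i => ?_⟩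
  rw [ea, eb, ← hσe]
  refine Slot.scale (hs i) (ht i) ?_
  obtain ⟨x, y, z, w, h0, h1⟩ := hsl i
  refine ⟨σ x, σ y, σ z, σ w, ?_, ?_⟩
  · rcases h0 with h | h | h | h
    · exact Or.inl (hσ _ h)
    · exact Or.inr (Or.inl (hσ _ h))
    · exact Or.inr (Or.inr (Or.inl (hσ _ h)))
    · exact Or.inr (Or.inr (Or.inr (hσ _ h)))
  · have := congrArg σ h1
    simp only [map_sub, map_add, map_mul, map_pow] at this
    exact this

theorem final_aux {E : Type*} [Field E] (h2 : (2:E) ≠ 0) (hPU : PU (RatFunc E))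
    (SL : ∀ (n : ℕ) (a b : Fin n → RatFunc E), (∀ i, a i ≠ 0) → (∀ i, b i ≠ 0) →
      ∃ c, c ≠ 0 ∧ ∀ i, Slot (a i) (b i) c) :
    (∀ a : Fin 5 → RatFunc E, (∀ i, a i ≠ 0) → IsotropicDiag a) ∧
    (∀ (n : ℕ) (a b : Fin n → (RatFunc E)ˣ), ∃ c : (RatFunc E)ˣ,
      ∀ i : Fin n, ∃ d : (RatFunc E)ˣ,
        QuadraticMap.Equivalent
          (Pfister2 (RatFunc E) (a i : RatFunc E) (b i : RatFunc E))
          (Pfister2 (RatFunc E) (c : RatFunc E) (d : RatFunc E))) := by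
  have h2K : (2 : RatFunc E) ≠ 0 := by
    rw [← map_ofNat (algebraMap E (RatFunc E)) 2]
    exact fun h => h2 ((algebraMap E (RatFunc E)).injective (by rw [h, map_zero]))
  constructor
  · intro v hv
    refine five_iso h2K hPU ?_ v hv
    intro a b c d ha hb hc hd
    obtain ⟨e, he, h⟩ := SL 2 ![a, c] ![b, d] (by intro i; fin_cases i <;> assumption)
      (by intro i; fin_cases i <;> assumption)
    exact ⟨e, he, h 0, h 1⟩
  · intro n a b
    obtain ⟨c, hc, h⟩ := SL n (fun i => a i) (fun i => b i) (fun i => (a i).ne_zero) (fun i => (b i).ne_zero)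
    refine ⟨Units.mk0 c hc, fun i => ?_⟩
    obtain ⟨d, hd, e⟩ := pf_slot h2K (a i).ne_zero (b i).ne_zero hc (h i)
    exact ⟨Units.mk0 d hd, e⟩

/-- If every square-free polynomial in `E[X]` divides a square-reflexive polynomial,
then every 5-dimensional regular quadratic form over `E(X)` is isotropic, and any finite
family of 2-fold Pfister forms over `E(X)` has a common slot. -/
theorem statement2 (E : Type*) [Field E] (hchar : ringChar E ≠ 2)
    (hwsr : ∀ f : Polynomial E, Squarefree f →
      ∃ h : Polynomial E, IsSquareReflexive h ∧ f ∣ h) :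
    (∀ a : Fin 5 → RatFunc E, (∀ i, a i ≠ 0) → IsotropicDiag a) ∧
    (∀ (n : ℕ) (a b : Fin n → (RatFunc E)ˣ), ∃ c : (RatFunc E)ˣ,
      ∀ i : Fin n, ∃ d : (RatFunc E)ˣ,
        QuadraticMap.Equivalent
          (Pfister2 (RatFunc E) (a i : RatFunc E) (b i : RatFunc E))
          (Pfister2 (RatFunc E) (c : RatFunc E) (d : RatFunc E))) := by
  have h2 : (2 : E) ≠ 0 := Ring.two_ne_zero hchar
  rcases finite_or_infinite E with hf | hi
  · exact final_aux h2 (PU_rat h2 (UF_fin h2) (UP_fin h2)) (slots_fin h2)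
  · exact final_aux h2 (PU_rat h2 (UF_inf h2 hwsr) (fun p hp => UP_inf h2 hwsr _ p rfl hp)) (slots_inf h2 hwsr)
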